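/- Let F be a field of characteristic 2, let φ be an anisotropic quadratic form over F of dimension 5 and type (1,3) that is not a Pfister neighbour, and let ψ be an anisotropic quadratic form over F of type (1,3). Then φ_{F(ψ)} is isotropic if and only if φ is similar to ψ, i.e. φ ≅ cψ for some c ∈ F*. -/

import Mathlib

open QuadraticMap MvPolynomial
open scoped TensorProduct

set_option synthInstance.maxHeartbeats 1000000
set_option maxHeartbeats 1000000


section Defs

variable {K : Type} [CommRing K]

/-- The binary quadratic form `[a,b] : (x,y) ↦ a·x² + x·y + b·y²`. -/
noncomputable def binQF (a b : K) : QuadraticForm K (Fin 2 → K) :=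
  (Matrix.of ![![a, 1], ![0, b]]).toQuadraticMap'

/-- The diagonal (totally singular) quadratic form `⟨c₁, …, c_s⟩`. -/
noncomputable def diagQF {s : ℕ} (c : Fin s → K) : QuadraticForm K (Fin s → K) :=
  QuadraticMap.weightedSumSquares K c

/-- The orthogonal sum `[a₁,b₁] ⊥ ⋯ ⊥ [a_r,b_r]` of binary forms. -/
noncomputable def binsQF {r : ℕ} (a b : Fin r → K) : QuadraticForm K (Fin r → Fin 2 → K) :=
  QuadraticMap.pi fun i => binQF (a i) (b i)

/-- The orthogonal sum of `m` hyperbolic planes `[0,0]`. -/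
noncomputable def hypQF (K : Type) [CommRing K] (m : ℕ) :
    QuadraticForm K (Fin m → Fin 2 → K) :=
  binsQF (fun _ => 0) (fun _ => 0)

/-- The `(n+1)`-fold quadratic Pfister form `⟨⟨a₁,…,aₙ⟩⟩_b ⊗ [1,c]`, i.e. the orthogonal
sum over all subsets `S ⊆ {1,…,n}` of `(∏_{i∈S} aᵢ)·[1,c]`. -/
noncomputable def pfisterQF (n : ℕ) (a : Fin n → K) (c : K) :
    QuadraticForm K (Finset (Fin n) → Fin 2 → K) :=
  QuadraticMap.pi fun S : Finset (Fin n) => (∏ i ∈ S, a i) • binQF 1 c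

variable {V W : Type} [AddCommGroup V] [Module K V] [AddCommGroup W] [Module K W]

/-- `φ` has type `(r,s)`: it is isometric to `[a₁,b₁] ⊥ ⋯ ⊥ [a_r,b_r] ⊥ ⟨c₁,…,c_s⟩`. -/
def HasTypeRS (φ : QuadraticForm K V) (r s : ℕ) : Prop :=
  ∃ (a b : Fin r → K) (c : Fin s → K), φ.Equivalent ((binsQF a b).prod (diagQF c))

/-- `φ` is dominated by `ψ`. -/
def Dominated (φ : QuadraticForm K V) (ψ : QuadraticForm K W) : Prop :=
  ∃ f : V →ₗ[K] W, Function.Injective f ∧ ∀ v, φ v = ψ (f v)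

/-- `φ` is weakly dominated by `ψ`: `α·φ` is dominated by `ψ` for some unit `α`. -/
def WeaklyDominated (φ : QuadraticForm K V) (ψ : QuadraticForm K W) : Prop :=
  ∃ α : Kˣ, Dominated ((α : K) • φ) ψ

/-- Witt equivalence of quadratic forms. -/
def WittEquiv (Q₁ : QuadraticForm K V) (Q₂ : QuadraticForm K W) : Prop :=
  ∃ k l : ℕ, (Q₁.prod (hypQF K k)).Equivalent (Q₂.prod (hypQF K l))

/-- `φ` is a Pfister neighbour: there is a quadratic Pfister form `π` with
`2·dim φ > dim π` and `φ ≺_w π`. -/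
def IsPfisterNeighbour (φ : QuadraticForm K V) : Prop :=
  ∃ (n : ℕ) (a : Fin n → Kˣ) (c : K),
    2 * Module.finrank K V > 2 ^ (n + 1) ∧
      WeaklyDominated φ (pfisterQF n (fun i => (a i : K)) c)

/-- The Artin–Schreier set `℘(K) = {t² + t : t ∈ K}`. -/
def ArtinSchreier (K : Type) [CommRing K] : Set K := {x : K | ∃ t : K, x = t ^ 2 + t}

end Defs

section FunField

variable (F : Type) [Field F]

/-- The coefficient matrix of a quadratic form on `Fin n → F` with respect to the
standard basis: diagonal entries `ψ(eᵢ)`, above-diagonal entries `b_ψ(eᵢ,eⱼ)`. -/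
noncomputable def coeffMat {n : ℕ} (ψ : QuadraticForm F (Fin n → F)) :
    Matrix (Fin n) (Fin n) F :=
  Matrix.of fun i j =>
    if i = j then ψ (Pi.single i 1)
    else if i < j then polar ψ (Pi.single i 1) (Pi.single j 1) else 0

/-- The homogeneous degree 2 polynomial `P_ψ` associated to a quadratic form `ψ`. -/
noncomputable def qfPoly {n : ℕ} (ψ : QuadraticForm F (Fin n → F)) :
    MvPolynomial (Fin n) F :=
  ∑ i : Fin n, ∑ j : Fin n, MvPolynomial.C (coeffMat F ψ i j) * (X i * X j)

/-- The affine coordinate ring `F[x₁,…,xₙ]/(P_ψ)` of the quadric `ψ = 0`. -/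
def FunFieldRing {n : ℕ} (ψ : QuadraticForm F (Fin n → F)) : Type :=
  MvPolynomial (Fin n) F ⧸ Ideal.span {qfPoly F ψ}

noncomputable instance {n : ℕ} (ψ : QuadraticForm F (Fin n → F)) :
    CommRing (FunFieldRing F ψ) :=
  inferInstanceAs (CommRing (MvPolynomial (Fin n) F ⧸ Ideal.span {qfPoly F ψ}))

noncomputable instance {n : ℕ} (ψ : QuadraticForm F (Fin n → F)) :
    Algebra F (FunFieldRing F ψ) :=
  inferInstanceAs (Algebra F (MvPolynomial (Fin n) F ⧸ Ideal.span {qfPoly F ψ}))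

/-- The function field `F(ψ)` of the quadric `ψ = 0`. -/
def FunField {n : ℕ} (ψ : QuadraticForm F (Fin n → F)) : Type :=
  FractionRing (FunFieldRing F ψ)

noncomputable instance {n : ℕ} (ψ : QuadraticForm F (Fin n → F)) :
    CommRing (FunField F ψ) :=
  inferInstanceAs (CommRing (FractionRing (FunFieldRing F ψ)))

noncomputable instance {n : ℕ} (ψ : QuadraticForm F (Fin n → F)) :
    Algebra (FunFieldRing F ψ) (FunField F ψ) :=
  inferInstanceAs (Algebra (FunFieldRing F ψ) (FractionRing (FunFieldRing F ψ)))

noncomputable instance {n : ℕ} (ψ : QuadraticForm F (Fin n → F)) :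
    Algebra F (FunField F ψ) :=
  inferInstanceAs (Algebra F (FractionRing (FunFieldRing F ψ)))

/-- The canonical map `F → F(ψ)`. -/
noncomputable def funFieldMap {n : ℕ} (ψ : QuadraticForm F (Fin n → F)) :
    F →+* FunField F ψ :=
  algebraMap F (FunField F ψ)

/-- Scalar extension of a quadratic form on `Fin n → F` along a ring homomorphism
`f : F → K`. -/
noncomputable def extendQF {K : Type} [CommRing K] (f : F →+* K) {n : ℕ}
    (φ : QuadraticForm F (Fin n → F)) : QuadraticForm K (Fin n → K) :=
  ((coeffMat F φ).map f).toQuadraticMap'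

end FunField


section Quat

variable (K : Type) [CommRing K]

/-- Defining relations for the char-2 quaternion algebra `[a,b)`: generators `i,j` with
`i² + i = a`, `j² = b`, `j·i = i·j + j` (i.e. `j·i·j⁻¹ = i + 1`). -/
inductive QuatRel (a b : K) : FreeAlgebra K (Fin 2) → FreeAlgebra K (Fin 2) → Prop
  | i_sq : QuatRel a b (FreeAlgebra.ι K 0 * FreeAlgebra.ι K 0 + FreeAlgebra.ι K 0)
      (algebraMap K _ a)
  | j_sq : QuatRel a b (FreeAlgebra.ι K 1 * FreeAlgebra.ι K 1) (algebraMap K _ b)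
  | swap : QuatRel a b (FreeAlgebra.ι K 1 * FreeAlgebra.ι K 0)
      (FreeAlgebra.ι K 0 * FreeAlgebra.ι K 1 + FreeAlgebra.ι K 1)

/-- The quaternion algebra `[a,b)` over `K` (characteristic two convention). -/
def QuatAlg (a b : K) : Type := RingQuot (QuatRel K a b)

noncomputable instance (a b : K) : Ring (QuatAlg K a b) :=
  inferInstanceAs (Ring (RingQuot (QuatRel K a b)))
noncomputable instance (a b : K) : Algebra K (QuatAlg K a b) :=
  inferInstanceAs (Algebra K (RingQuot (QuatRel K a b)))

/-- `[a,b)` is split over `K`: isomorphic to the `2×2` matrix algebra. -/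
def QuatSplit (a b : K) : Prop :=
  Nonempty (QuatAlg K a b ≃ₐ[K] Matrix (Fin 2) (Fin 2) K)

end Quat

section Sqrt

variable (F : Type) [Field F]

/-- The field `F(√c₁,…,√c_s)` obtained by adjoining square roots of the `cᵢ`
(inside an algebraic closure of `F`). -/
noncomputable def sqrtExt {s : ℕ} (c : Fin s → F) :
    IntermediateField F (AlgebraicClosure F) :=
  IntermediateField.adjoin F
    {y : AlgebraicClosure F | ∃ i, y ^ 2 = algebraMap F (AlgebraicClosure F) (c i)}

/-- The subfield `F² = {x² : x ∈ F}` of squares of a field of characteristic 2. -/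
noncomputable def sqSubfield : Subfield F := Subfield.closure (Set.range fun x : F => x ^ 2)

set_option synthInstance.maxHeartbeats 1000000 in
/-- The norm degree `[F²(cᵢ·cⱼ) : F²]` of a diagonal form `⟨c₁,…,c_s⟩`. -/
noncomputable def normDegree {s : ℕ} (c : Fin s → F) : ℕ :=
  Module.finrank (sqSubfield F)
    (IntermediateField.adjoin (sqSubfield F)
      (Set.range fun p : Fin s × Fin s => c p.1 * c p.2))

end Sqrt

/-- A ring is a division algebra if it is nontrivial and every nonzero element is a unit. -/
def IsDivisionAlgebra (T : Type) [Ring T] : Prop :=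
  (0 : T) ≠ 1 ∧ ∀ x : T, x ≠ 0 → IsUnit x


section Similarity

variable {F : Type} [Field F]

/-- Similarity of quadratic forms. -/
def SimilarQF {V W : Type} [AddCommGroup V] [Module F V] [AddCommGroup W] [Module F W]
    (Q : QuadraticForm F V) (Q' : QuadraticForm F W) : Prop :=
  ∃ c : Fˣ, Q.Equivalent ((c : F) • Q')

variable {V W U : Type} [AddCommGroup V] [Module F V] [AddCommGroup W] [Module F W]
  [AddCommGroup U] [Module F U]

theorem SimilarQF.trans {Q : QuadraticForm F V} {Q' : QuadraticForm F W}
    {Q'' : QuadraticForm F U} (h : SimilarQF Q Q') (h' : SimilarQF Q' Q'') :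
    SimilarQF Q Q'' := by
  obtain ⟨c, ⟨e⟩⟩ := h
  obtain ⟨d, ⟨e'⟩⟩ := h'
  refine ⟨c * d, ⟨⟨e.toLinearEquiv.trans e'.toLinearEquiv, fun m => ?_⟩⟩⟩
  have h1 := e.map_app m
  have h2 := e'.map_app (e m)
  simp only [_root_.smul_apply, smul_eq_mul, Units.val_mul] at h1 h2 ⊢
  calc _ = (c : F) * ((d : F) * Q'' (e' (e m))) := by
        rw [mul_assoc]; rfl
    _ = _ := by rw [h2, h1]

theorem SimilarQF.symm {Q : QuadraticForm F V} {Q' : QuadraticForm F W}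
    (h : SimilarQF Q Q') : SimilarQF Q' Q := by
  obtain ⟨c, ⟨e⟩⟩ := h
  refine ⟨c⁻¹, ⟨⟨e.toLinearEquiv.symm, fun m => ?_⟩⟩⟩
  have h1 := e.map_app (e.toLinearEquiv.symm m)
  have h2 : e (e.toLinearEquiv.symm m) = m := e.toLinearEquiv.apply_symm_apply m
  rw [h2] at h1
  simp only [_root_.smul_apply, smul_eq_mul] at h1 ⊢
  show _ * Q (e.toLinearEquiv.symm m) = _
  rw [← h1, ← mul_assoc]
  simp

theorem SimilarQF.of_equivalent {Q : QuadraticForm F V} {Q' : QuadraticForm F W}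
    (h : Q.Equivalent Q') : SimilarQF Q Q' :=
  ⟨1, by simpa using h⟩

theorem SimilarQF.of_linear {n : ℕ} {Q Q' : QuadraticForm F (Fin n → F)}
    (hQ : Q.Anisotropic) (g : (Fin n → F) →ₗ[F] (Fin n → F)) {c : F} (hc : c ≠ 0)
    (h : ∀ v, Q v = c * Q' (g v)) : SimilarQF Q Q' := by
  have hinj : Function.Injective g := by
    rw [← LinearMap.ker_eq_bot, LinearMap.ker_eq_bot']
    intro m hm
    exact hQ m (by rw [h, hm]; simp)
  refine ⟨Units.mk0 c hc, ⟨⟨LinearEquiv.ofInjectiveEndo g hinj, fun m => ?_⟩⟩⟩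
  simp [h]

theorem SimilarQF.anisotropic {Q : QuadraticForm F V} {Q' : QuadraticForm F W}
    (h : SimilarQF Q Q') (hQ : Q.Anisotropic) : Q'.Anisotropic := by
  obtain ⟨c, ⟨e⟩⟩ := h.symm
  intro x hx
  have h1 := e.map_app x
  rw [hx, _root_.smul_apply, smul_eq_mul] at h1
  have h2 : e x = 0 := hQ _ (by simpa using h1)
  have h3 : e.toLinearEquiv x = 0 := h2
  simpa using h3

theorem toQuadraticMap'_apply {K : Type} [CommRing K] {n : ℕ} (M : Matrix (Fin n) (Fin n) K)
    (v : Fin n → K) : M.toQuadraticMap' v = ∑ i, ∑ j, M i j * (v i * v j) := by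
  change M.toQuadraticForm' v = _
  simp only [Matrix.toQuadraticForm', LinearMap.BilinMap.toQuadraticMap_apply,
    Matrix.toLinearMap₂'_apply, smul_eq_mul, RingHom.id_apply]
  refine Finset.sum_congr rfl fun i _ => Finset.sum_congr rfl fun j _ => ?_
  ring

/-- The explicit quinary form `a x₀² + h x₀x₁ + b x₁² + c₁x₂² + c₂x₃² + c₃x₄²`. -/
noncomputable def form5 (a h b c₁ c₂ c₃ : F) : QuadraticForm F (Fin 5 → F) :=
  QuadraticMap.weightedSumSquares F ![a, b, c₁, c₂, c₃] +
    h • QuadraticMap.linMulLin (LinearMap.proj 0) (LinearMap.proj 1)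

theorem form5_apply (a h b c₁ c₂ c₃ : F) (v : Fin 5 → F) :
    form5 a h b c₁ c₂ c₃ v = a * v 0 ^ 2 + h * (v 0 * v 1) + b * v 1 ^ 2 + c₁ * v 2 ^ 2 +
      c₂ * v 3 ^ 2 + c₃ * v 4 ^ 2 := by
  simp [form5, QuadraticMap.weightedSumSquares_apply, Fin.sum_univ_five]
  ring

theorem HasTypeRS.exists_form5 {Q : QuadraticForm F (Fin 5 → F)} (h : HasTypeRS Q 1 3) :
    ∃ a b c₁ c₂ c₃ : F, SimilarQF Q (form5 a 1 b c₁ c₂ c₃) := by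
  obtain ⟨a, b, c, ⟨e⟩⟩ := h
  let g : (Fin 5 → F) ≃ₗ[F] (Fin 1 → Fin 2 → F) × (Fin 3 → F) :=
    { toFun := fun v => (fun _ => ![v 0, v 1], ![v 2, v 3, v 4])
      map_add' := fun v w => by
        ext i j
        · fin_cases j <;> simp
        · fin_cases i <;> simp
      map_smul' := fun v w => by
        ext i j
        · fin_cases j <;> simp
        · fin_cases i <;> simp
      invFun := fun p => ![p.1 0 0, p.1 0 1, p.2 0, p.2 1, p.2 2]
      left_inv := fun v => by ext i; fin_cases i <;> simp
      right_inv := fun p => by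
        ext i j
        · fin_cases i; fin_cases j <;> simp
        · fin_cases i <;> simp }
  refine ⟨a 0, b 0, c 0, c 1, c 2, SimilarQF.symm (SimilarQF.of_equivalent
    ⟨⟨g.trans e.toLinearEquiv.symm, fun m => ?_⟩⟩)⟩
  have h1 := e.map_app (e.toLinearEquiv.symm (g m))
  have h2 : e (e.toLinearEquiv.symm (g m)) = g m := e.toLinearEquiv.apply_symm_apply _
  rw [h2] at h1
  change Q (e.toLinearEquiv.symm (g m)) = _
  rw [← h1, form5_apply]
  simp [g, binsQF, binQF, diagQF, QuadraticMap.weightedSumSquares_apply, Fin.sum_univ_three,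
    QuadraticMap.pi_apply, toQuadraticMap'_apply, Fin.sum_univ_two]
  ring

end Similarity

section Extension

variable {F : Type} [Field F]

theorem extendQF_apply {K : Type} [CommRing K] (f : F →+* K) {n : ℕ}
    (Q : QuadraticForm F (Fin n → F)) (v : Fin n → K) :
    extendQF F f Q v = eval₂Hom f v (qfPoly F Q) := by
  simp only [extendQF, toQuadraticMap'_apply, qfPoly, map_sum, map_mul, eval₂Hom_C, eval₂Hom_X',
    Matrix.map_apply]

theorem eval_qfPoly {n : ℕ} (Q : QuadraticForm F (Fin n → F)) (v : Fin n → F) :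
    eval v (qfPoly F Q) = Q v := by
  have h1 : (coeffMat F Q).toQuadraticMap' = Q := by
    have h2 := QuadraticMap.toQuadraticMap_toBilin Q (Pi.basisFun F (Fin n))
    refine Eq.trans ?_ h2
    have h3 : (coeffMat F Q) = LinearMap.toMatrix₂' F (Q.toBilin (Pi.basisFun F (Fin n))) := by
      ext i j
      rw [LinearMap.toMatrix₂'_apply, ← Pi.basisFun_apply, ← Pi.basisFun_apply,
        QuadraticMap.toBilin_apply]
      simp [coeffMat]
    change (coeffMat F Q).toQuadraticForm' = _
    simp only [h3, Matrix.toQuadraticForm', Matrix.toLinearMap₂'_toMatrix']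
  conv_rhs => rw [← h1]
  simp only [toQuadraticMap'_apply, qfPoly, map_sum, map_mul, eval_C, eval_X]

theorem qfPoly_form5 [Infinite F] (a h b c₁ c₂ c₃ : F) :
    qfPoly F (form5 a h b c₁ c₂ c₃) = C a * X 0 ^ 2 + C h * (X 0 * X 1) + C b * X 1 ^ 2 +
      C c₁ * X 2 ^ 2 + C c₂ * X 3 ^ 2 + C c₃ * X 4 ^ 2 := by
  refine MvPolynomial.funext fun v => ?_
  rw [eval_qfPoly, form5_apply]
  simp

theorem extendQF_form5 [Infinite F] {K : Type} [CommRing K] (f : F →+* K)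
    (a h b c₁ c₂ c₃ : F) (v : Fin 5 → K) :
    extendQF F f (form5 a h b c₁ c₂ c₃) v = f a * v 0 ^ 2 + f h * (v 0 * v 1) + f b * v 1 ^ 2 +
      f c₁ * v 2 ^ 2 + f c₂ * v 3 ^ 2 + f c₃ * v 4 ^ 2 := by
  rw [extendQF_apply, qfPoly_form5]
  simp

/-- Substituting a linear map in the polynomial of a quadratic form. -/
theorem bind₁_qfPoly [Infinite F] {n : ℕ} {Q Q' : QuadraticForm F (Fin n → F)}
    (g : (Fin n → F) →ₗ[F] (Fin n → F)) {d : F} (h : ∀ v, Q (g v) = d * Q' v) :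
    bind₁ (fun i => ∑ j, C (LinearMap.toMatrix' g i j) * X j) (qfPoly F Q) =
      C d * qfPoly F Q' := by
  refine MvPolynomial.funext fun v => ?_
  rw [map_mul, eval_C, eval_qfPoly, ← h, ← eval_qfPoly, MvPolynomial.eval,
    MvPolynomial.eval₂Hom_bind₁]
  congr 2
  ext i
  have h1 := LinearMap.toMatrix'_mulVec g v
  rw [← h1]
  simp [Matrix.mulVec, dotProduct]

theorem extendQF_linear [Infinite F] {K : Type} [CommRing K] (f : F →+* K) {n : ℕ}
    {Q Q' : QuadraticForm F (Fin n → F)} (g : (Fin n → F) →ₗ[F] (Fin n → F)) {d : F}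
    (h : ∀ v, Q (g v) = d * Q' v) (v : Fin n → K) :
    extendQF F f Q (((LinearMap.toMatrix' g).map f).mulVec v) = f d * extendQF F f Q' v := by
  have h1 := congrArg (eval₂Hom f v) (bind₁_qfPoly g h)
  rw [MvPolynomial.eval₂Hom_bind₁, map_mul] at h1
  rw [extendQF_apply, extendQF_apply]
  convert h1 using 2
  · congr 1
    ext i
    simp [Matrix.mulVec, dotProduct]
  · simp

/-- `Q` acquires over `E` an isotropic vector outside of the radical of the polar form. -/
def IsNonradicallyIsotropic {E : Type} [Field E] (f : F →+* E) {n : ℕ}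
    (Q : QuadraticForm F (Fin n → F)) : Prop :=
  ∃ v w, extendQF F f Q v = 0 ∧ extendQF F f Q (v + w) ≠ extendQF F f Q w

theorem IsNonradicallyIsotropic.of_similar [Infinite F] {E : Type} [Field E] {f : F →+* E}
    {n : ℕ} {Q Q' : QuadraticForm F (Fin n → F)} (hs : SimilarQF Q Q')
    (h : IsNonradicallyIsotropic f Q) : IsNonradicallyIsotropic f Q' := by
  obtain ⟨c, ⟨e⟩⟩ := hs
  obtain ⟨v, w, h1, h2⟩ := h
  have h3 : ∀ v, Q' (e.toLinearEquiv.toLinearMap v) = ((c : F)⁻¹) * Q v := fun v => by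
    have := e.map_app v
    rw [_root_.smul_apply, smul_eq_mul] at this
    rw [← this, ← mul_assoc, inv_mul_cancel₀ c.ne_zero, one_mul]
    rfl
  have h4 := extendQF_linear f e.toLinearEquiv.toLinearMap h3
  refine ⟨_, ((LinearMap.toMatrix' e.toLinearEquiv.toLinearMap).map f).mulVec w,
    (h4 v).trans (by rw [h1, mul_zero]), ?_⟩
  rw [← Matrix.mulVec_add, h4, h4]
  intro h5
  exact h2 (mul_left_cancel₀ (by simp) h5)

theorem isNonradicallyIsotropic_form5 [Infinite F] [CharP F 2] {E : Type} [Field E]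
    (f : F →+* E) {a h b c₁ c₂ c₃ : F} (hh : h ≠ 0) :
    IsNonradicallyIsotropic f (form5 a h b c₁ c₂ c₃) ↔
      ∃ x y z₁ z₂ z₃ : E, (x ≠ 0 ∨ y ≠ 0) ∧ f a * x ^ 2 + f h * (x * y) + f b * y ^ 2 +
        f c₁ * z₁ ^ 2 + f c₂ * z₂ ^ 2 + f c₃ * z₃ ^ 2 = 0 := by
  have : CharP E 2 := charP_of_injective_ringHom f.injective 2
  have hE : (2 : E) = 0 := CharTwo.two_eq_zero
  constructor
  · rintro ⟨v, w, h1, h2⟩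
    rw [extendQF_form5] at h1
    refine ⟨v 0, v 1, v 2, v 3, v 4, ?_, h1⟩
    by_contra! h3
    apply h2
    rw [extendQF_form5, extendQF_form5]
    rw [h3.1, h3.2] at h1
    simp only [Pi.add_apply, h3.1, h3.2, CharTwo.add_sq]
    linear_combination h1
  · classical
    rintro ⟨x, y, z₁, z₂, z₃, h1, h2⟩
    have hfh : f h ≠ 0 := by simpa using hh
    refine ⟨![x, y, z₁, z₂, z₃], if x ≠ 0 then ![0, 1, 0, 0, 0] else ![1, 0, 0, 0, 0], ?_, ?_⟩
    · rw [extendQF_form5]; simpa using h2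
    · rw [extendQF_form5, extendQF_form5]
      split_ifs with hx
      · intro h3
        simp at h3
        apply mul_ne_zero hfh hx
        linear_combination h3 - h2 - f b * y * hE
      · have hy : y ≠ 0 := by tauto
        simp only [not_not] at hx
        intro h3
        simp [hx] at h3
        apply mul_ne_zero hfh hy
        linear_combination h3 - h2  + (f a * x + f h * y) * hx

/-- Every field extension making `ψ` nonradically isotropic makes `φ` so. -/
def IsotropyImplies {n : ℕ} (ψ φ : QuadraticForm F (Fin n → F)) : Prop :=
  ∀ (E : Type) [Field E] (f : F →+* E),
    IsNonradicallyIsotropic f ψ → IsNonradicallyIsotropic f φ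

theorem IsotropyImplies.of_similar [Infinite F] {n : ℕ} {ψ ψ' φ φ' : QuadraticForm F (Fin n → F)}
    (h : IsotropyImplies ψ φ) (hψ : SimilarQF ψ ψ') (hφ : SimilarQF φ φ') :
    IsotropyImplies ψ' φ' := fun E _ f h1 =>
  (h E f (h1.of_similar hψ.symm)).of_similar hφ

end Extension

section Neighbour

variable {F : Type} [Field F]

theorem IsPfisterNeighbour.of_similar {V W : Type} [AddCommGroup V] [Module F V] [AddCommGroup W]
    [Module F W] {Q : QuadraticForm F V} {Q' : QuadraticForm F W} (hs : SimilarQF Q Q')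
    (h : IsPfisterNeighbour Q') : IsPfisterNeighbour Q := by
  obtain ⟨c, ⟨e⟩⟩ := hs
  obtain ⟨n, a, d, hd, α, g, hg, hgv⟩ := h
  refine ⟨n, a, d, ?_, α * c⁻¹, g ∘ₗ e.toLinearEquiv.toLinearMap,
    hg.comp e.toLinearEquiv.injective, fun v => ?_⟩
  · rwa [e.toLinearEquiv.finrank_eq]
  · have h1 := hgv (e v)
    have h2 := e.map_app v
    rw [_root_.smul_apply, smul_eq_mul] at h1 h2
    change _ = _ at h1
    change _ = pfisterQF n (fun i => (a i : F)) d (g (e v))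
    rw [← h1, _root_.smul_apply, smul_eq_mul, ← h2, Units.val_mul, mul_assoc, ← mul_assoc _ (c : F)]
    simp

theorem form5_anisotropic {a h b c₁ c₂ c₃ : F} (hQ : (form5 a h b c₁ c₂ c₃).Anisotropic)
    {x y z₁ z₂ z₃ : F} (h0 : a * x ^ 2 + h * (x * y) + b * y ^ 2 +
      c₁ * z₁ ^ 2 + c₂ * z₂ ^ 2 + c₃ * z₃ ^ 2 = 0) :
    x = 0 ∧ y = 0 ∧ z₁ = 0 ∧ z₂ = 0 ∧ z₃ = 0 := by
  have h1 := hQ ![x, y, z₁, z₂, z₃] (by rw [form5_apply]; simpa using h0)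
  exact ⟨congrFun h1 0, congrFun h1 1, congrFun h1 2, congrFun h1 3, congrFun h1 4⟩

variable [CharP F 2]

theorem infinite_of_form5_anisotropic {a h b c₁ c₂ c₃ : F}
    (hQ : (form5 a h b c₁ c₂ c₃).Anisotropic) : Infinite F := by
  by_contra hF
  have : Finite F := not_infinite_iff_finite.mp hF
  have : Fintype F := Fintype.ofFinite F
  have hr : ringChar F = 2 := ringChar.eq F 2 ▸ rfl
  obtain ⟨r, rfl⟩ := FiniteField.isSquare_of_char_two hr c₁
  obtain ⟨s, rfl⟩ := FiniteField.isSquare_of_char_two hr c₂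
  have h2 : (2 : F) = 0 := CharTwo.two_eq_zero
  obtain ⟨-, -, h3, h4, -⟩ := form5_anisotropic hQ (x := 0) (y := 0) (z₁ := s) (z₂ := r) (z₃ := 0)
    (by linear_combination (r * r * s * s) * h2)
  obtain ⟨-, -, h3, -⟩ := form5_anisotropic hQ (x := 0) (y := 0) (z₁ := 1) (z₂ := 0) (z₃ := 0)
    (by rw [h4]; ring)
  exact one_ne_zero h3

theorem exists_polar_eq_one {x y : F} (h : x ≠ 0 ∨ y ≠ 0) : ∃ x' y', x * y' + y * x' = 1 := by
  rcases h with h | h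
  · exact ⟨0, x⁻¹, by field_simp; ring⟩
  · exact ⟨y⁻¹, 0, by field_simp; ring⟩

/-- If the binary part represents a value of the fourfold totally singular form attached to the
quasilinear part, then the form is a Pfister neighbour. -/
theorem isPfisterNeighbour_form5 {a b c₁ c₂ c₃ : F} (hQ : (form5 a 1 b c₁ c₂ c₃).Anisotropic)
    {x y z₁ z₂ z₃ z₄ : F} (h0 : a * x ^ 2 + x * y + b * y ^ 2 =
      c₁ * z₁ ^ 2 + c₂ * z₂ ^ 2 + c₃ * z₃ ^ 2 + c₁ * c₂ * c₃ * z₄ ^ 2) (hxy : x ≠ 0 ∨ y ≠ 0) :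
    IsPfisterNeighbour (form5 a 1 b c₁ c₂ c₃) := by
  have h2 : (2 : F) = 0 := CharTwo.two_eq_zero
  have hc₁ : c₁ ≠ 0 := by
    rintro rfl
    have := form5_anisotropic hQ (x := 0) (y := 0) (z₁ := 1) (z₂ := 0) (z₃ := 0) (by ring)
    simp at this
  have hc₂ : c₂ ≠ 0 := by
    rintro rfl
    have := form5_anisotropic hQ (x := 0) (y := 0) (z₁ := 0) (z₂ := 1) (z₃ := 0) (by ring)
    simp at this
  have hc₃ : c₃ ≠ 0 := by
    rintro rfl
    have := form5_anisotropic hQ (x := 0) (y := 0) (z₁ := 0) (z₂ := 0) (z₃ := 1) (by ring)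
    simp at this
  have hz : z₄ ≠ 0 := by
    rintro rfl
    have := form5_anisotropic hQ (x := x) (y := y) (z₁ := z₁) (z₂ := z₂) (z₃ := z₃)
      (by linear_combination h0 + (c₁ * z₁ ^ 2 + c₂ * z₂ ^ 2 + c₃ * z₃ ^ 2) * h2)
    tauto
  obtain ⟨x', y', hf⟩ := exists_polar_eq_one hxy
  let u : Fin 2 → Fˣ := ![Units.mk0 c₁ hc₁ * Units.mk0 c₂ hc₂, Units.mk0 c₁ hc₁ * Units.mk0 c₃ hc₃]
  let m : (Fin 5 → F) →ₗ[F] F := y' • LinearMap.proj 0 + x' • LinearMap.proj 1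
  let n : (Fin 5 → F) →ₗ[F] F := y • LinearMap.proj 0 + x • LinearMap.proj 1
  let p : Fin 5 → ((Fin 5 → F) →ₗ[F] F) := fun i => LinearMap.proj i
  let g : (Fin 5 → F) →ₗ[F] (Finset (Fin 2) → Fin 2 → F) := LinearMap.pi fun S =>
    if S = ∅ then LinearMap.pi ![c₁ • (p 2 + z₁ • m), 0]
    else if S = {0} then LinearMap.pi ![p 3 + z₂ • m, 0]
    else if S = {1} then LinearMap.pi ![p 4 + z₃ • m, 0]
    else LinearMap.pi ![z₄ • m, (c₁ * c₂ * c₃ * z₄)⁻¹ • n]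
  have key : ∀ v, c₁ * form5 a 1 b c₁ c₂ c₃ v = pfisterQF 2 (fun i => (u i : F))
      (c₁ * c₂ * c₃ * z₄ ^ 2 * (a * x' ^ 2 + x' * y' + b * y' ^ 2)) (g v) := by
    intro v
    have hu : (Finset.univ : Finset (Finset (Fin 2))) = {∅, {0}, {1}, {0, 1}} := by decide
    have h01 : ({0, 1} : Finset (Fin 2)) ≠ ∅ ∧ ({0, 1} : Finset (Fin 2)) ≠ {0} ∧
      ({0, 1} : Finset (Fin 2)) ≠ {1} ∧ ({1} : Finset (Fin 2)) ≠ ∅ ∧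
      ({0} : Finset (Fin 2)) ≠ ∅ ∧ ({1} : Finset (Fin 2)) ≠ {0} := by decide
    have hv0 : v 0 = m v * x + n v * x' := by
      simp only [m, n, LinearMap.add_apply, LinearMap.smul_apply, LinearMap.proj_apply, smul_eq_mul]
      linear_combination (- v 0) * hf - (v 1 * x * x') * h2
    have hv1 : v 1 = m v * y + n v * y' := by
      simp only [m, n, LinearMap.add_apply, LinearMap.smul_apply, LinearMap.proj_apply, smul_eq_mul]
      linear_combination (- v 1) * hf - (v 0 * y * y') * h2
    rw [form5_apply, pfisterQF, QuadraticMap.pi_apply, hu, Finset.sum_insert (by decide),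
      Finset.sum_insert (by decide), Finset.sum_insert (by decide), Finset.sum_singleton]
    simp only [g, LinearMap.pi_apply, if_pos, if_neg h01.1, if_neg h01.2.1, if_neg h01.2.2.1,
      if_neg h01.2.2.2.1, if_neg h01.2.2.2.2.1, if_neg h01.2.2.2.2.2, binQF, _root_.smul_apply,
      toQuadraticMap'_apply, Fin.sum_univ_two, Finset.prod_empty, Finset.prod_singleton,
      Finset.prod_pair (show (0 : Fin 2) ≠ 1 by decide), u, p]
    simp
    rw [hv0, hv1]
    generalize m v = m
    generalize n v = n
    field_simp
    linear_combination m ^ 2 * h0 + m * n * hf + (a * m * n * x * x' + b * m * n * y * y' -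
      c₁ * m * v 2 * z₁ - c₂ * m * v 3 * z₂ - c₃ * m * v 4 * z₃) * h2
  refine ⟨2, u, _, by simp, Units.mk0 c₁ hc₁, g, ?_, key⟩
  rw [← LinearMap.ker_eq_bot, LinearMap.ker_eq_bot']
  intro v hv
  have h3 := key v
  rw [hv, map_zero] at h3
  exact hQ v ((mul_eq_zero.mp h3).resolve_left hc₁)

end Neighbour

section FunctionField

variable {F : Type} [Field F] {n : ℕ}

theorem SimilarQF.exists_linearEquiv {Q Q' : QuadraticForm F (Fin n → F)} (hs : SimilarQF Q Q') :
    ∃ (g : (Fin n → F) ≃ₗ[F] (Fin n → F)) (d : F), d ≠ 0 ∧ ∀ v, Q' (g v) = d * Q v := by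
  obtain ⟨c, ⟨e⟩⟩ := hs
  refine ⟨e.toLinearEquiv, (c : F)⁻¹, inv_ne_zero c.ne_zero, fun v => ?_⟩
  have := e.map_app v
  rw [_root_.smul_apply, smul_eq_mul] at this
  rw [← this, ← mul_assoc, inv_mul_cancel₀ c.ne_zero, one_mul]
  rfl

theorem toMatrix'_symm_mul (g : (Fin n → F) ≃ₗ[F] (Fin n → F)) :
    LinearMap.toMatrix' g.symm.toLinearMap * LinearMap.toMatrix' g.toLinearMap = 1 := by
  rw [← LinearMap.toMatrix'_comp]
  simp

theorem not_anisotropic_extendQF_of_similar [Infinite F] {K : Type} [CommRing K] {f : F →+* K}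
    {Q Q' : QuadraticForm F (Fin n → F)} (hs : SimilarQF Q Q')
    (h : ¬ (extendQF F f Q).Anisotropic) : ¬ (extendQF F f Q').Anisotropic := by
  obtain ⟨g, d, -, hg⟩ := hs.exists_linearEquiv
  intro h'
  apply h
  intro x hx
  have h1 := extendQF_linear f g.toLinearMap hg x
  rw [hx, mul_zero] at h1
  have h2 := h' _ h1
  have h3 := congrArg ((LinearMap.toMatrix' g.symm.toLinearMap).map f).mulVec h2
  rw [Matrix.mulVec_mulVec, ← Matrix.map_mul, toMatrix'_symm_mul] at h3
  simpa using h3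

/-- The canonical map from polynomials to the function field of a quadric. -/
noncomputable def toFunField (ψ : QuadraticForm F (Fin n → F)) :
    MvPolynomial (Fin n) F →+* FunField F ψ :=
  (algebraMap (FunFieldRing F ψ) (FunField F ψ)).comp
    (Ideal.Quotient.mk (Ideal.span {qfPoly F ψ}))

instance (ψ : QuadraticForm F (Fin n → F)) :
    IsLocalization (nonZeroDivisors (FunFieldRing F ψ)) (FunField F ψ) :=
  inferInstanceAs (IsLocalization (nonZeroDivisors (FunFieldRing F ψ))
    (FractionRing (FunFieldRing F ψ)))

theorem toFunField_eq_zero_iff (ψ : QuadraticForm F (Fin n → F)) (p : MvPolynomial (Fin n) F) :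
    toFunField ψ p = 0 ↔ qfPoly F ψ ∣ p := by
  rw [← Ideal.mem_span_singleton, ← Ideal.Quotient.eq_zero_iff_mem]
  have hi : Function.Injective (algebraMap (FunFieldRing F ψ) (FunField F ψ)) :=
    IsLocalization.injective _ le_rfl
  exact map_eq_zero_iff _ hi

theorem toFunField_comp_C (ψ : QuadraticForm F (Fin n → F)) :
    (toFunField ψ).comp C = funFieldMap F ψ := by
  ext a
  have h1 : funFieldMap F ψ = (algebraMap (FunFieldRing F ψ) (FunField F ψ)).comp
      (algebraMap F (FunFieldRing F ψ)) :=
    @IsScalarTower.algebraMap_eq F (FunFieldRing F ψ) (FractionRing (FunFieldRing F ψ)) _ _ _ _ _ _ _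
  rw [h1]
  rfl

theorem extendQF_toFunField (φ ψ : QuadraticForm F (Fin n → F))
    (V : Fin n → MvPolynomial (Fin n) F) :
    extendQF F (funFieldMap F ψ) φ (fun i => toFunField ψ (V i)) =
      toFunField ψ (bind₁ V (qfPoly F φ)) := by
  rw [extendQF_apply, ← toFunField_comp_C, coe_eval₂Hom]
  exact (MvPolynomial.eval₂_comp_left (toFunField ψ) C V (qfPoly F φ)).symm

theorem qfPoly_isHomogeneous (ψ : QuadraticForm F (Fin n → F)) :
    (qfPoly F ψ).IsHomogeneous 2 :=
  IsHomogeneous.sum _ _ _ fun i _ => IsHomogeneous.sum _ _ _ fun j _ => by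
    simpa using (isHomogeneous_C _ _).mul ((isHomogeneous_X F i).mul (isHomogeneous_X F j))

theorem qfPoly_ne_zero [NeZero n] {ψ : QuadraticForm F (Fin n → F)} (hψ : ψ.Anisotropic) :
    qfPoly F ψ ≠ 0 := by
  intro h
  have h1 := eval_qfPoly ψ (Pi.single 0 1)
  rw [h, map_zero] at h1
  have := congrFun (hψ _ h1.symm) 0
  simp at this

theorem not_qfPoly_dvd_X [NeZero n] {ψ : QuadraticForm F (Fin n → F)} (hψ : ψ.Anisotropic)
    (i : Fin n) : ¬ qfPoly F ψ ∣ X i := by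
  rintro ⟨G, hG⟩
  have h0 := qfPoly_ne_zero hψ
  have hG0 : G ≠ 0 := by
    rintro rfl
    exact X_ne_zero (R := F) i (by simpa using hG)
  have h1 := congrArg totalDegree hG
  rw [totalDegree_mul_of_isDomain h0 hG0, totalDegree_X,
    (qfPoly_isHomogeneous ψ).totalDegree h0] at h1
  omega

theorem not_anisotropic_of_similar [Infinite F] [NeZero n] {φ ψ : QuadraticForm F (Fin n → F)}
    (hψ : ψ.Anisotropic) (hs : SimilarQF φ ψ) :
    ¬ (extendQF F (funFieldMap F ψ) φ).Anisotropic := by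
  refine not_anisotropic_extendQF_of_similar hs.symm fun h => ?_
  have h1 := extendQF_toFunField ψ ψ X
  rw [bind₁_X_left, AlgHom.id_apply, (toFunField_eq_zero_iff ψ _).mpr dvd_rfl] at h1
  have h2 := congrFun (h _ h1) 0
  exact not_qfPoly_dvd_X hψ 0 ((toFunField_eq_zero_iff ψ _).mp h2)

theorem exists_dvd_bind₁_of_not_anisotropic {φ ψ : QuadraticForm F (Fin n → F)}
    (h : ¬ (extendQF F (funFieldMap F ψ) φ).Anisotropic) :
    ∃ V : Fin n → MvPolynomial (Fin n) F, qfPoly F ψ ∣ bind₁ V (qfPoly F φ) ∧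
      ∃ i, ¬ qfPoly F ψ ∣ V i := by
  simp only [QuadraticMap.Anisotropic, not_forall] at h
  obtain ⟨x, hx, hx0⟩ := h
  obtain ⟨b, hb⟩ := IsLocalization.exist_integer_multiples_of_finite
    (nonZeroDivisors (FunFieldRing F ψ)) x
  choose y hy using hb
  choose V hV using fun i => Ideal.Quotient.mk_surjective (I := Ideal.span {qfPoly F ψ}) (y i)
  have hV' : (fun i => toFunField ψ (V i)) = algebraMap _ (FunField F ψ) (b : FunFieldRing F ψ) • x := by
    ext i
    rw [Pi.smul_apply, smul_eq_mul, ← Algebra.smul_def]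
    refine Eq.trans ?_ (hy i)
    exact congrArg (algebraMap (FunFieldRing F ψ) (FunField F ψ)) (hV i)
  refine ⟨V, ?_, ?_⟩
  · rw [← toFunField_eq_zero_iff, ← extendQF_toFunField, hV', QuadraticMap.map_smul, hx, smul_zero]
  · by_contra! h2
    apply hx0
    have hu : IsUnit (algebraMap _ (FunField F ψ) (b : FunFieldRing F ψ)) :=
      IsLocalization.map_units _ b
    have h3 : algebraMap _ (FunField F ψ) (b : FunFieldRing F ψ) • x = 0 := by
      rw [← hV']
      ext i
      exact (toFunField_eq_zero_iff ψ _).mpr (h2 i)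
    exact (hu.smul_eq_zero).mp h3

theorem exists_dvd_bind₁_of_similar [Infinite F] {φ ψ ψ' : QuadraticForm F (Fin n → F)}
    (hs : SimilarQF ψ ψ')
    (h : ∃ V : Fin n → MvPolynomial (Fin n) F, qfPoly F ψ ∣ bind₁ V (qfPoly F φ) ∧
      ∃ i, ¬ qfPoly F ψ ∣ V i) :
    ∃ V : Fin n → MvPolynomial (Fin n) F, qfPoly F ψ' ∣ bind₁ V (qfPoly F φ) ∧
      ∃ i, ¬ qfPoly F ψ' ∣ V i := by
  obtain ⟨V, hV, i, hi⟩ := h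
  obtain ⟨g, d, hd, hg⟩ := hs.symm.exists_linearEquiv
  have hg' : ∀ v, ψ' (g.symm v) = d⁻¹ * ψ v := fun v => by
    have := hg (g.symm v)
    rw [LinearEquiv.apply_symm_apply] at this
    rw [this, ← mul_assoc, inv_mul_cancel₀ hd, one_mul]
  have h1 := bind₁_qfPoly g.toLinearMap hg
  have h2 := bind₁_qfPoly g.symm.toLinearMap hg'
  have hu : IsUnit (C d : MvPolynomial (Fin n) F) := (isUnit_iff_ne_zero.mpr hd).map C
  have hu' : IsUnit (C d⁻¹ : MvPolynomial (Fin n) F) :=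
    (isUnit_iff_ne_zero.mpr (inv_ne_zero hd)).map C
  refine ⟨fun i => bind₁ (fun i => ∑ j, C (LinearMap.toMatrix' g.toLinearMap i j) * X j) (V i),
    ?_, i, ?_⟩
  · have h3 := map_dvd (bind₁ fun i => ∑ j, C (LinearMap.toMatrix' g.toLinearMap i j) * X j) hV
    rw [h1, bind₁_bind₁, hu.mul_left_dvd] at h3
    exact h3
  · intro h3
    apply hi
    have h4 := map_dvd
      (bind₁ fun i => ∑ j, C (LinearMap.toMatrix' g.symm.toLinearMap i j) * X j) h3
    rw [h2, bind₁_bind₁, hu'.mul_left_dvd] at h4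
    convert h4
    conv_lhs => rw [← AlgHom.id_apply (R := F) (V i)]
    congr 1
    ext1 k
    rw [AlgHom.id_apply, bind₁_X_right, map_sum]
    have h5 : LinearMap.toMatrix' g.toLinearMap * LinearMap.toMatrix' g.symm.toLinearMap = 1 :=
      toMatrix'_symm_mul g.symm
    simp only [map_mul, bind₁_X_right, bind₁_C_right, Finset.mul_sum, ← mul_assoc]
    rw [Finset.sum_comm]
    simp only [← Finset.sum_mul, ← map_mul, ← map_sum]
    have h6 : ∀ j, ∑ i, LinearMap.toMatrix' g.toLinearMap k i *
        LinearMap.toMatrix' g.symm.toLinearMap i j = (1 : Matrix (Fin n) (Fin n) F) k j := fun j => by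
      rw [← h5, Matrix.mul_apply]
    simp only [h6, Matrix.one_apply]
    simp

end FunctionField

section Reduction

variable {F : Type} [Field F] [Infinite F] {a b c₁ c₂ c₃ : F}

theorem exists_linear_remainder (ha : a ≠ 0) (p : MvPolynomial (Fin 5) F) :
    ∃ p₀ p₁ : MvPolynomial (Fin 4) F, qfPoly F (form5 a 1 b c₁ c₂ c₃) ∣
      p - (rename Fin.succ p₀ + rename Fin.succ p₁ * X 0) := by
  induction p using MvPolynomial.induction_on with
  | C r => exact ⟨C r, 0, by simp⟩
  | add p q hp hq =>
    obtain ⟨p₀, p₁, hp⟩ := hp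
    obtain ⟨q₀, q₁, hq⟩ := hq
    refine ⟨p₀ + q₀, p₁ + q₁, ?_⟩
    convert dvd_add hp hq using 1
    simp only [map_add]
    ring
  | mul_X p i hp =>
    obtain ⟨p₀, p₁, G, hG⟩ := hp
    have hp : p = qfPoly F (form5 a 1 b c₁ c₂ c₃) * G +
      (rename Fin.succ p₀ + rename Fin.succ p₁ * X 0) := by rw [← hG]; ring
    refine Fin.cases ?_ (fun j => ?_) i
    · refine ⟨-C a⁻¹ * p₁ * (C b * X 0 ^ 2 + C c₁ * X 1 ^ 2 + C c₂ * X 2 ^ 2 + C c₃ * X 3 ^ 2),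
        p₀ - C a⁻¹ * p₁ * X 0, G * X 0 + C a⁻¹ * rename Fin.succ p₁, ?_⟩
      have hC : (C a * C a⁻¹ : MvPolynomial (Fin 5) F) = 1 := by
        rw [← C_mul, mul_inv_cancel₀ ha, C_1]
      rw [hp, qfPoly_form5, C_1]
      simp only [map_add, map_sub, map_neg, map_mul, map_pow, rename_C, rename_X,
        show (Fin.succ (0 : Fin 4)) = 1 from rfl, show (Fin.succ (1 : Fin 4)) = 2 from rfl,
        show (Fin.succ (2 : Fin 4)) = 3 from rfl, show (Fin.succ (3 : Fin 4)) = 4 from rfl]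
      linear_combination (-(X 0 ^ 2 * rename Fin.succ p₁)) * hC
    · exact ⟨p₀ * X j, p₁ * X j, G * X j.succ, by rw [hp]; simp only [map_mul, rename_X]; ring⟩

theorem eq_zero_of_dvd_linear (ha : a ≠ 0) {p₀ p₁ : MvPolynomial (Fin 4) F}
    (h : qfPoly F (form5 a 1 b c₁ c₂ c₃) ∣ rename Fin.succ p₀ + rename Fin.succ p₁ * X 0) :
    p₀ = 0 ∧ p₁ = 0 := by
  have hr : ∀ p : MvPolynomial (Fin 4) F, finSuccEquiv F 4 (rename Fin.succ p) = Polynomial.C p := by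
    intro p
    induction p using MvPolynomial.induction_on with
    | C r => simp [finSuccEquiv_apply]
    | add p q hp hq => simp only [map_add, hp, hq]
    | mul_X p i hp => simp only [map_mul, hp, rename_X, finSuccEquiv_X_succ]
  have h1 := map_dvd (finSuccEquiv F 4) h
  have hP : finSuccEquiv F 4 (qfPoly F (form5 a 1 b c₁ c₂ c₃)) =
      Polynomial.C (C a) * Polynomial.X ^ 2 + Polynomial.C (X 0) * Polynomial.X +
      Polynomial.C (C b * X 0 ^ 2 + C c₁ * X 1 ^ 2 + C c₂ * X 2 ^ 2 + C c₃ * X 3 ^ 2) := by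
    rw [qfPoly_form5]
    have hX : ∀ j : Fin 4, finSuccEquiv F 4 (X (Fin.succ j)) = Polynomial.C (X j) :=
      fun j => finSuccEquiv_X_succ
    have hCC : ∀ r : F, finSuccEquiv F 4 (C r) = Polynomial.C (C r) := fun r => by
      simp [finSuccEquiv_apply]
    have e0 := hX 0
    have e1 := hX 1
    have e2 := hX 2
    have e3 := hX 3
    simp only [show (Fin.succ (0 : Fin 4)) = 1 from rfl, show (Fin.succ (1 : Fin 4)) = 2 from rfl,
      show (Fin.succ (2 : Fin 4)) = 3 from rfl, show (Fin.succ (3 : Fin 4)) = 4 from rfl]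
      at e0 e1 e2 e3
    simp only [map_add, map_mul, map_pow, e0, e1, e2, e3, hCC, finSuccEquiv_X_zero, C_1,
      map_one]
    ring
  rw [map_add, map_mul, hr, hr, finSuccEquiv_X_zero, hP] at h1
  have h2 : Polynomial.C p₀ + Polynomial.C p₁ * Polynomial.X = 0 := by
    refine Polynomial.eq_zero_of_dvd_of_degree_lt h1 ?_
    rw [Polynomial.degree_quadratic (by simpa using ha), add_comm]
    exact lt_of_le_of_lt Polynomial.degree_linear_le (by norm_num)
  have h3 := congrArg (fun p => Polynomial.coeff p 0) h2
  have h4 := congrArg (fun p => Polynomial.coeff p 1) h2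
  constructor
  · simpa using h3
  · simpa [Polynomial.coeff_C] using h4

theorem dvd_of_dvd_diagonal [CharP F 2] (ha : a ≠ 0) {d₁ d₂ d₃ : F}
    (hd : ∀ x y z : F, d₁ * x ^ 2 + d₂ * y ^ 2 + d₃ * z ^ 2 = 0 → x = 0 ∧ y = 0 ∧ z = 0)
    {w₁ w₂ w₃ : MvPolynomial (Fin 5) F}
    (h : qfPoly F (form5 a 1 b c₁ c₂ c₃) ∣ C d₁ * w₁ ^ 2 + C d₂ * w₂ ^ 2 + C d₃ * w₃ ^ 2) :
    qfPoly F (form5 a 1 b c₁ c₂ c₃) ∣ w₁ ∧ qfPoly F (form5 a 1 b c₁ c₂ c₃) ∣ w₂ ∧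
      qfPoly F (form5 a 1 b c₁ c₂ c₃) ∣ w₃ := by
  obtain ⟨p₁, q₁, h₁⟩ := exists_linear_remainder (b := b) (c₁ := c₁) (c₂ := c₂) (c₃ := c₃) ha w₁
  obtain ⟨p₂, q₂, h₂⟩ := exists_linear_remainder (b := b) (c₁ := c₁) (c₂ := c₂) (c₃ := c₃) ha w₂
  obtain ⟨p₃, q₃, h₃⟩ := exists_linear_remainder (b := b) (c₁ := c₁) (c₂ := c₂) (c₃ := c₃) ha w₃
  have two : (2 : MvPolynomial (Fin 5) F) = 0 := CharTwo.two_eq_zero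
  have hdiag : ∀ r₁ r₂ r₃ : MvPolynomial (Fin 4) F,
      C d₁ * r₁ ^ 2 + C d₂ * r₂ ^ 2 + C d₃ * r₃ ^ 2 = 0 → r₁ = 0 ∧ r₂ = 0 ∧ r₃ = 0 := by
    intro r₁ r₂ r₃ hr
    have : ∀ v, eval v r₁ = 0 ∧ eval v r₂ = 0 ∧ eval v r₃ = 0 := fun v => by
      apply hd
      simpa using congrArg (eval v) hr
    refine ⟨?_, ?_, ?_⟩ <;> refine MvPolynomial.funext fun v => ?_ <;> simp [this v]
  set P := qfPoly F (form5 a 1 b c₁ c₂ c₃) with hP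
  obtain ⟨G₁, h₁'⟩ := h₁
  obtain ⟨G₂, h₂'⟩ := h₂
  obtain ⟨G₃, h₃'⟩ := h₃
  obtain ⟨G, hG⟩ := h
  have hC : (C a * C a⁻¹ : MvPolynomial (Fin 5) F) = 1 := by
    rw [← C_mul, mul_inv_cancel₀ ha, C_1]
  let N : MvPolynomial (Fin 4) F := C b * X 0 ^ 2 + C c₁ * X 1 ^ 2 + C c₂ * X 2 ^ 2 + C c₃ * X 3 ^ 2
  let σ := C d₁ * p₁ ^ 2 + C d₂ * p₂ ^ 2 + C d₃ * p₃ ^ 2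
  let τ := C d₁ * q₁ ^ 2 + C d₂ * q₂ ^ 2 + C d₃ * q₃ ^ 2
  have h5 : P ∣ rename Fin.succ (σ + C a⁻¹ * N * τ) + rename Fin.succ (C a⁻¹ * X 0 * τ) * X 0 := by
    have e1 : w₁ = P * G₁ + (rename Fin.succ p₁ + rename Fin.succ q₁ * X 0) := by rw [← h₁']; ring
    have e2 : w₂ = P * G₂ + (rename Fin.succ p₂ + rename Fin.succ q₂ * X 0) := by rw [← h₂']; ring
    have e3 : w₃ = P * G₃ + (rename Fin.succ p₃ + rename Fin.succ q₃ * X 0) := by rw [← h₃']; ring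
    rw [e1, e2, e3] at hG
    refine ⟨G - (C d₁ * P * G₁ ^ 2 + C d₂ * P * G₂ ^ 2 + C d₃ * P * G₃ ^ 2) +
      C a⁻¹ * rename Fin.succ τ, ?_⟩
    have hPe := qfPoly_form5 a 1 b c₁ c₂ c₃
    rw [← hP] at hPe
    simp only [σ, τ, N, map_add, map_mul, map_pow, rename_C, rename_X,
        show (Fin.succ (0 : Fin 4)) = 1 from rfl, show (Fin.succ (1 : Fin 4)) = 2 from rfl,
        show (Fin.succ (2 : Fin 4)) = 3 from rfl, show (Fin.succ (3 : Fin 4)) = 4 from rfl]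
      at hG ⊢
    rw [C_1, one_mul] at hPe
    generalize rename Fin.succ p₁ = r₁ at *
    generalize rename Fin.succ p₂ = r₂ at *
    generalize rename Fin.succ p₃ = r₃ at *
    generalize rename Fin.succ q₁ = s₁ at *
    generalize rename Fin.succ q₂ = s₂ at *
    generalize rename Fin.succ q₃ = s₃ at *
    linear_combination hG - (C a⁻¹ * (C d₁ * s₁ ^ 2 + C d₂ * s₂ ^ 2 + C d₃ * s₃ ^ 2)) * hPe
      + (X 0 ^ 2 * (C d₁ * s₁ ^ 2 + C d₂ * s₂ ^ 2 + C d₃ * s₃ ^ 2)) * hC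
      - (C d₁ * (P * G₁ + s₁ * X 0) * r₁ + C d₂ * (P * G₂ + s₂ * X 0) * r₂
        + C d₃ * (P * G₃ + s₃ * X 0) * r₃ + C d₁ * P * G₁ * s₁ * X 0 + C d₂ * P * G₂ * s₂ * X 0
        + C d₃ * P * G₃ * s₃ * X 0
        + C a⁻¹ * C a * X 0 ^ 2 * (C d₁ * s₁ ^ 2 + C d₂ * s₂ ^ 2 + C d₃ * s₃ ^ 2)) * two
  obtain ⟨h6, h7⟩ := eq_zero_of_dvd_linear ha (hP ▸ h5)
  have h8 : τ = 0 := by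
    have h9 : (C a⁻¹ * X 0 : MvPolynomial (Fin 4) F) ≠ 0 :=
      mul_ne_zero (by simpa using ha) (X_ne_zero _)
    exact (mul_eq_zero.mp h7).resolve_left h9
  rw [h8, mul_zero, add_zero] at h6
  obtain ⟨rfl, rfl, rfl⟩ := hdiag _ _ _ h6
  obtain ⟨rfl, rfl, rfl⟩ := hdiag _ _ _ h8
  exact ⟨⟨G₁, by simpa using h₁'⟩, ⟨G₂, by simpa using h₂'⟩, ⟨G₃, by simpa using h₃'⟩⟩

end Reduction

section Density

variable {F : Type} [Field F] [Infinite F] [CharP F 2] {a b c₁ c₂ c₃ : F}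

/-- A polynomial vanishing on all rational zeros of a quadric over an extension in which the
quadric has a nonradical zero also vanishes on the zeros over the algebraic closure that are not
orthogonal to that zero. -/
theorem eval₂Hom_eq_zero_of_vanishing {E : Type} [Field E] (f : F →+* E) {ξ : Fin 5 → E}
    (hξ : extendQF F f (form5 a 1 b c₁ c₂ c₃) ξ = 0) {p : MvPolynomial (Fin 5) F}
    (hp : ∀ Y, extendQF F f (form5 a 1 b c₁ c₂ c₃) Y = 0 → eval₂Hom f Y p = 0)
    {Y : Fin 5 → AlgebraicClosure E}
    (hY : extendQF F ((algebraMap E (AlgebraicClosure E)).comp f) (form5 a 1 b c₁ c₂ c₃) Y = 0)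
    (hY' : algebraMap E (AlgebraicClosure E) (ξ 0) * Y 1 +
      algebraMap E (AlgebraicClosure E) (ξ 1) * Y 0 ≠ 0) :
    eval₂Hom ((algebraMap E (AlgebraicClosure E)).comp f) Y p = 0 := by
  have : CharP E 2 := charP_of_injective_ringHom f.injective 2
  have h2 : (2 : E) = 0 := CharTwo.two_eq_zero
  have : Infinite E := Infinite.of_injective f f.injective
  set g := algebraMap E (AlgebraicClosure E) with hg
  let B : MvPolynomial (Fin 5) E := C (ξ 0) * X 1 + C (ξ 1) * X 0
  let Z : Fin 5 → MvPolynomial (Fin 5) E := fun i =>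
    eval₂Hom (C.comp f) X (qfPoly F (form5 a 1 b c₁ c₂ c₃)) * C (ξ i) + B * X i
  have h0 : eval₂Hom (C.comp f) Z p = 0 := by
    refine MvPolynomial.funext fun Y => ?_
    rw [map_eval₂Hom, map_zero]
    have hf : (eval Y).comp ((C : E →+* MvPolynomial (Fin 5) E).comp f) = f := by
      ext; simp
    rw [hf]
    apply hp
    have hZ : ∀ i, eval Y (Z i) = extendQF F f (form5 a 1 b c₁ c₂ c₃) Y * ξ i +
        (ξ 0 * Y 1 + ξ 1 * Y 0) * Y i := by
      intro i
      simp only [Z, B, map_add, map_mul, eval_C, eval_X, map_eval₂Hom, hf, extendQF_apply]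
    simp only [hZ, extendQF_form5, map_one] at hξ ⊢
    set q := f a * Y 0 ^ 2 + 1 * (Y 0 * Y 1) + f b * Y 1 ^ 2 + f c₁ * Y 2 ^ 2 + f c₂ * Y 3 ^ 2 +
      f c₃ * Y 4 ^ 2 with hq
    set β := ξ 0 * Y 1 + ξ 1 * Y 0 with hβ
    linear_combination q ^ 2 * hξ - β ^ 2 * hq - q * β * hβ + (q * β * β + q * β ^ 2 + q * β *
      (f a * Y 0 * ξ 0 + f b * Y 1 * ξ 1 + f c₁ * Y 2 * ξ 2 + f c₂ * Y 3 * ξ 3 +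
        f c₃ * Y 4 * ξ 4)) * h2 - β ^ 2 * q * h2
  obtain ⟨κ, hκ⟩ := IsAlgClosed.exists_pow_nat_eq (g (ξ 0) * Y 1 + g (ξ 1) * Y 0)⁻¹
    (n := 2) (by norm_num)
  have h1 := congrArg (eval₂Hom g (κ • Y)) h0
  rw [map_eval₂Hom, map_zero] at h1
  have hf : (eval₂Hom g (κ • Y)).comp ((C : E →+* MvPolynomial (Fin 5) E).comp f) = g.comp f := by
    ext; simp
  have hZ : (fun i => eval₂Hom g (κ • Y) (Z i)) = Y := by
    ext i
    simp only [Z, B, map_add, map_mul, eval₂Hom_C, eval₂Hom_X', map_eval₂Hom, hf]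
    rw [← extendQF_apply, QuadraticMap.map_smul, hY]
    simp only [Pi.smul_apply, smul_eq_mul]
    calc _ = κ ^ 2 * (g (ξ 0) * Y 1 + g (ξ 1) * Y 0) * Y i := by ring
      _ = Y i := by rw [hκ, inv_mul_cancel₀ hY', one_mul]
  rw [hf, hZ] at h1
  exact h1

theorem qfPoly_dvd_of_vanishing (ha : a ≠ 0) (hc : c₁ ≠ 0) {E : Type} [Field E] (f : F →+* E)
    {ξ : Fin 5 → E} (hξ : extendQF F f (form5 a 1 b c₁ c₂ c₃) ξ = 0)
    (hξ' : ξ 0 ≠ 0 ∨ ξ 1 ≠ 0) {p : MvPolynomial (Fin 5) F}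
    (hp : ∀ Y, extendQF F f (form5 a 1 b c₁ c₂ c₃) Y = 0 → eval₂Hom f Y p = 0) :
    qfPoly F (form5 a 1 b c₁ c₂ c₃) ∣ p := by
  have : CharP E 2 := charP_of_injective_ringHom f.injective 2
  set g := algebraMap E (AlgebraicClosure E) with hg
  have : CharP (AlgebraicClosure E) 2 := charP_of_injective_ringHom g.injective 2
  have h2 : (2 : AlgebraicClosure E) = 0 := CharTwo.two_eq_zero
  set f' := g.comp f with hf'
  have ha' : f' a ≠ 0 := by simpa using ha
  obtain ⟨p₀, p₁, G, hG⟩ := exists_linear_remainder (b := b) (c₁ := c₁) (c₂ := c₂) (c₃ := c₃) ha p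
  have key : ∀ (y : Fin 4 → AlgebraicClosure E) (T : AlgebraicClosure E),
      f' a * T ^ 2 + T * y 0 + f' b * y 0 ^ 2 + f' c₁ * y 1 ^ 2 + f' c₂ * y 2 ^ 2 +
        f' c₃ * y 3 ^ 2 = 0 → g (ξ 0) * y 0 + g (ξ 1) * T ≠ 0 →
      eval₂Hom f' y p₀ + eval₂Hom f' y p₁ * T = 0 := by
    intro y T h1 h3
    have h4 : extendQF F f' (form5 a 1 b c₁ c₂ c₃) (Fin.cons T y) = 0 := by
      rw [extendQF_form5, map_one, one_mul]
      exact h1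
    have h5 := eval₂Hom_eq_zero_of_vanishing f hξ hp h4 h3
    have h6 := congrArg (eval₂Hom f' (Fin.cons T y)) hG
    have h7 : (Fin.cons T y : Fin 5 → AlgebraicClosure E) ∘ Fin.succ = y := by
      ext; simp
    rw [map_sub, map_mul, ← extendQF_apply, h4, zero_mul, h5, map_add, map_mul,
      eval₂Hom_rename, eval₂Hom_rename, eval₂Hom_X', h7, Fin.cons_zero, zero_sub, neg_eq_zero] at h6
    exact h6
  let M : MvPolynomial (Fin 4) (AlgebraicClosure E) :=
    C (f' a * g (ξ 0) ^ 2 + g (ξ 0) * g (ξ 1)) * X 0 ^ 2 + C (g (ξ 1) ^ 2) * (C (f' b) * X 0 ^ 2 +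
      C (f' c₁) * X 1 ^ 2 + C (f' c₂) * X 2 ^ 2 + C (f' c₃) * X 3 ^ 2)
  have hM : M ≠ 0 := by
    intro hM
    by_cases h3 : ξ 1 = 0
    · have h4 := congrArg (eval ![1, 0, 0, 0]) hM
      have h5 : ξ 0 ≠ 0 := by tauto
      simp [M, h3, h5, ha] at h4
    · have h4 := congrArg (eval ![0, 1, 0, 0]) hM
      simp [M, h3, hc] at h4
  have hy : ∀ y : Fin 4 → AlgebraicClosure E, y 0 * eval y M ≠ 0 →
      eval₂Hom f' y p₀ = 0 ∧ eval₂Hom f' y p₁ = 0 := by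
    intro y hy
    obtain ⟨T, hT⟩ := IsAlgClosed.exists_root (Polynomial.C (f' a) * Polynomial.X ^ 2 +
      Polynomial.C (y 0) * Polynomial.X + Polynomial.C (f' b * y 0 ^ 2 + f' c₁ * y 1 ^ 2 +
      f' c₂ * y 2 ^ 2 + f' c₃ * y 3 ^ 2)) (by rw [Polynomial.degree_quadratic ha']; norm_num)
    have hy0 : y 0 ≠ 0 := left_ne_zero_of_mul hy
    have hMy := right_ne_zero_of_mul hy
    simp only [Polynomial.IsRoot.def, Polynomial.eval_add, Polynomial.eval_mul, Polynomial.eval_C,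
      Polynomial.eval_pow, Polynomial.eval_X] at hT
    have hprod : eval y M = f' a * (g (ξ 0) * y 0 + g (ξ 1) * T) *
        (g (ξ 0) * y 0 + g (ξ 1) * (T + y 0 * (f' a)⁻¹)) := by
      simp only [M, map_add, map_mul, eval_C, map_pow, eval_X]
      field_simp
      linear_combination g (ξ 1) ^ 2 * hT - (g (ξ 1) ^ 2 * (f' a * T ^ 2 + y 0 * T) +
        g (ξ 0) * g (ξ 1) * y 0 * T * f' a) * h2
    rw [hprod] at hMy
    have h3 := key y T (by linear_combination hT) (right_ne_zero_of_mul (left_ne_zero_of_mul hMy))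
    have h4 := key y (T + y 0 * (f' a)⁻¹) (by
      field_simp
      linear_combination f' a * hT + (f' a * y 0 * T + y 0 ^ 2) * h2) (right_ne_zero_of_mul hMy)
    have h5 : eval₂Hom f' y p₁ * (y 0 * (f' a)⁻¹) = 0 := by linear_combination h4 - h3
    have h6 := (mul_eq_zero.mp h5).resolve_right (mul_ne_zero hy0 (inv_ne_zero ha'))
    exact ⟨by simpa [h6] using h3, h6⟩
  have hzero : ∀ r : MvPolynomial (Fin 4) F, (∀ y : Fin 4 → AlgebraicClosure E,
      y 0 * eval y M ≠ 0 → eval₂Hom f' y r = 0) → r = 0 := by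
    intro r hr
    have h3 : MvPolynomial.map f' r * (X 0 * M) = 0 := by
      refine MvPolynomial.funext fun y => ?_
      rw [map_mul, map_mul, eval_X, map_zero, eval_map]
      by_cases h4 : y 0 * eval y M = 0
      · rw [h4, mul_zero]
      · have := hr y h4
        rw [coe_eval₂Hom] at this
        rw [this, zero_mul]
    have h4 := (mul_eq_zero.mp h3).resolve_right (mul_ne_zero (X_ne_zero _) hM)
    exact MvPolynomial.map_injective f' f'.injective (by rw [h4, map_zero])
  rw [hzero p₀ fun y h => (hy y h).1, hzero p₁ fun y h => (hy y h).2] at hG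
  exact ⟨G, by simpa using hG⟩

theorem isotropyImplies_of_dvd {a' b' d₁ d₂ d₃ : F}
    (hφ : (form5 a' 1 b' d₁ d₂ d₃).Anisotropic) (hψ : (form5 a 1 b c₁ c₂ c₃).Anisotropic)
    {V : Fin 5 → MvPolynomial (Fin 5) F}
    (hV : qfPoly F (form5 a 1 b c₁ c₂ c₃) ∣ bind₁ V (qfPoly F (form5 a' 1 b' d₁ d₂ d₃)))
    (hV' : ∃ i, ¬ qfPoly F (form5 a 1 b c₁ c₂ c₃) ∣ V i) :
    IsotropyImplies (form5 a 1 b c₁ c₂ c₃) (form5 a' 1 b' d₁ d₂ d₃) := by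
  have ha : a ≠ 0 := by
    rintro rfl
    have := form5_anisotropic hψ (x := 1) (y := 0) (z₁ := 0) (z₂ := 0) (z₃ := 0) (by ring)
    simp at this
  have hc : c₁ ≠ 0 := by
    rintro rfl
    have := form5_anisotropic hψ (x := 0) (y := 0) (z₁ := 1) (z₂ := 0) (z₃ := 0) (by ring)
    simp at this
  intro E _ f h
  rw [isNonradicallyIsotropic_form5 f one_ne_zero] at h ⊢
  obtain ⟨x, y, z₁, z₂, z₃, hxy, h0⟩ := h
  by_contra! hcon
  have hξ : extendQF F f (form5 a 1 b c₁ c₂ c₃) ![x, y, z₁, z₂, z₃] = 0 := by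
    rw [extendQF_form5]; simpa using h0
  have hV0 : ∀ Y, extendQF F f (form5 a 1 b c₁ c₂ c₃) Y = 0 →
      eval₂Hom f Y (V 0) = 0 ∧ eval₂Hom f Y (V 1) = 0 := by
    intro Y hY
    by_contra! h3
    refine hcon (eval₂Hom f Y (V 0)) (eval₂Hom f Y (V 1)) (eval₂Hom f Y (V 2))
      (eval₂Hom f Y (V 3)) (eval₂Hom f Y (V 4)) (by tauto) ?_
    obtain ⟨G, hG⟩ := hV
    have h4 := congrArg (eval₂Hom f Y) hG
    rw [map_mul, ← extendQF_apply, hY, zero_mul, qfPoly_form5] at h4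
    simpa using h4
  obtain ⟨G₀, h3⟩ := qfPoly_dvd_of_vanishing ha hc f hξ hxy fun Y hY => (hV0 Y hY).1
  obtain ⟨G₁, h4⟩ := qfPoly_dvd_of_vanishing ha hc f hξ hxy fun Y hY => (hV0 Y hY).2
  have h5 := dvd_of_dvd_diagonal (b := b) (c₁ := c₁) (c₂ := c₂) (c₃ := c₃) ha (d₁ := d₁) (d₂ := d₂)
    (d₃ := d₃) (w₁ := V 2) (w₂ := V 3) (w₃ := V 4)
    (fun x y z h => (form5_anisotropic hφ (x := 0) (y := 0) (by simpa using h)).2.2) (by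
      obtain ⟨G, hG⟩ := hV
      rw [qfPoly_form5 a'] at hG
      simp only [map_add, map_mul, map_pow, bind₁_X_right, bind₁_C_right, C_1, one_mul] at hG
      refine ⟨G - C a' * G₀ * V 0 - G₀ * V 1 - C b' * G₁ * V 1, ?_⟩
      linear_combination hG - C a' * V 0 * h3 - V 1 * h3 - C b' * V 1 * h4)
  obtain ⟨i, hi⟩ := hV'
  fin_cases i
  · exact hi ⟨_, h3⟩
  · exact hi ⟨_, h4⟩
  · exact hi h5.1
  · exact hi h5.2.1
  · exact hi h5.2.2

end Density

section Biquadratic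

variable {F : Type} [Field F]

/-- The form `⟨1, u, v, uv⟩` is anisotropic. -/
def AnisotropicBilin (u v : F) : Prop :=
  ∀ z₀ z₁ z₂ z₃ : F, z₀ ^ 2 + u * z₁ ^ 2 + v * z₂ ^ 2 + u * v * z₃ ^ 2 = 0 →
    z₀ = 0 ∧ z₁ = 0 ∧ z₂ = 0 ∧ z₃ = 0

/-- The form `[a, b]` takes no nonzero value represented by `⟨1, u, v, uv⟩`. -/
def AvoidsBilin (a b u v : F) : Prop :=
  ∀ x y z₀ z₁ z₂ z₃ : F, a * x ^ 2 + x * y + b * y ^ 2 =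
    z₀ ^ 2 + u * z₁ ^ 2 + v * z₂ ^ 2 + u * v * z₃ ^ 2 → x = 0 ∧ y = 0

/-- `K` is the biquadratic extension of `F` generated by square roots `α` of `u` and `β` of `v`. -/
structure IsBiquadratic {K : Type} [Field K] [Algebra F K] (u v : F) (α β : K) : Prop where
  sq_left : α ^ 2 = algebraMap F K u
  sq_right : β ^ 2 = algebraMap F K v
  exists_coords : ∀ e : K, ∃ x₀ x₁ x₂ x₃ : F, e = algebraMap F K x₀ + algebraMap F K x₁ * α +
    algebraMap F K x₂ * β + algebraMap F K x₃ * (α * β)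

variable [CharP F 2]

theorem anisotropicBilin_of_ternary {u v : F} (h : ∀ z₀ z₁ z₂ : F,
    z₀ ^ 2 + u * z₁ ^ 2 + v * z₂ ^ 2 = 0 → z₀ = 0 ∧ z₁ = 0 ∧ z₂ = 0) : AnisotropicBilin u v := by
  intro z₀ z₁ z₂ z₃ h0
  have hn : z₂ ^ 2 + u * z₃ ^ 2 = 0 := (h (z₀ * z₂ + u * z₁ * z₃) (z₀ * z₃ + z₁ * z₂)
    (z₂ ^ 2 + u * z₃ ^ 2) (by grind)).2.2
  obtain ⟨h2, h3, -⟩ := h z₂ z₃ 0 (by linear_combination hn)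
  obtain ⟨h4, h5, -⟩ := h z₀ z₁ 0 (by rw [h2, h3] at h0; linear_combination h0)
  exact ⟨h4, h5, h2, h3⟩

/-- The subfield `F²(u, v)`. -/
def bilinSubfield {u v : F} (h : AnisotropicBilin u v) : Subfield F where
  carrier := {e | ∃ z₀ z₁ z₂ z₃ : F, e = z₀ ^ 2 + u * z₁ ^ 2 + v * z₂ ^ 2 + u * v * z₃ ^ 2}
  mul_mem' := by
    rintro _ _ ⟨z₀, z₁, z₂, z₃, rfl⟩ ⟨w₀, w₁, w₂, w₃, rfl⟩
    exact ⟨z₀ * w₀ + u * z₁ * w₁ + v * z₂ * w₂ + u * v * z₃ * w₃,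
      z₀ * w₁ + z₁ * w₀ + v * (z₂ * w₃ + z₃ * w₂), z₀ * w₂ + z₂ * w₀ + u * (z₁ * w₃ + z₃ * w₁),
      z₀ * w₃ + z₃ * w₀ + z₁ * w₂ + z₂ * w₁, by grind⟩
  one_mem' := ⟨1, 0, 0, 0, by ring⟩
  add_mem' := by
    rintro _ _ ⟨z₀, z₁, z₂, z₃, rfl⟩ ⟨w₀, w₁, w₂, w₃, rfl⟩
    exact ⟨z₀ + w₀, z₁ + w₁, z₂ + w₂, z₃ + w₃, by grind⟩
  zero_mem' := ⟨0, 0, 0, 0, by ring⟩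
  neg_mem' := by
    rintro _ ⟨z₀, z₁, z₂, z₃, rfl⟩
    exact ⟨z₀, z₁, z₂, z₃, by grind⟩
  inv_mem' := by
    rintro _ ⟨z₀, z₁, z₂, z₃, rfl⟩
    set e := z₀ ^ 2 + u * z₁ ^ 2 + v * z₂ ^ 2 + u * v * z₃ ^ 2 with he
    by_cases h0 : e = 0
    · exact ⟨0, 0, 0, 0, by rw [h0]; simp⟩
    · exact ⟨z₀ * e⁻¹, z₁ * e⁻¹, z₂ * e⁻¹, z₃ * e⁻¹, by
        calc e⁻¹ = e⁻¹ ^ 2 * e := by field_simp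
          _ = _ := by rw [he]; ring⟩

theorem exists_isBiquadratic {u v : F} (h : AnisotropicBilin u v) :
    ∃ (K : Type) (_ : Field K) (_ : Algebra F K) (α β : K), IsBiquadratic u v α β := by
  let S := bilinSubfield h
  have hmem : ∀ x : F, x ^ 2 ∈ S := fun x => ⟨x, 0, 0, 0, by ring⟩
  let ι : F →+* S := (frobenius F 2).codRestrict S hmem
  let α : S := ⟨u, 0, 1, 0, 0, by ring⟩
  let β : S := ⟨v, 0, 0, 1, 0, by ring⟩
  refine ⟨S, inferInstance, ι.toAlgebra, α, β, @IsBiquadratic.mk _ _ _ _ ι.toAlgebra _ _ _ _ ?_ ?_ ?_⟩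
  · rfl
  · rfl
  · rintro ⟨e, z₀, z₁, z₂, z₃, rfl⟩
    refine ⟨z₀, z₁, z₂, z₃, Subtype.ext ?_⟩
    change _ = z₀ ^ 2 + z₁ ^ 2 * u + z₂ ^ 2 * v + z₃ ^ 2 * (u * v)
    ring

namespace IsBiquadratic

variable {K : Type} [Field K] [Algebra F K] {u v : F} {α β : K}

theorem coords_eq_zero (h : AnisotropicBilin u v) (hα : α ^ 2 = algebraMap F K u)
    (hβ : β ^ 2 = algebraMap F K v) {x₀ x₁ x₂ x₃ : F}
    (h0 : algebraMap F K x₀ + algebraMap F K x₁ * α +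
    algebraMap F K x₂ * β + algebraMap F K x₃ * (α * β) = 0) :
    x₀ = 0 ∧ x₁ = 0 ∧ x₂ = 0 ∧ x₃ = 0 := by
  have : CharP K 2 := charP_of_injective_algebraMap (algebraMap F K).injective 2
  apply h
  apply (algebraMap F K).injective
  simp only [map_add, map_mul, map_pow, map_zero, ← hα, ← hβ]
  grind

theorem exists_sq_eq (hK : IsBiquadratic u v α β) (e : K) : ∃ z₀ z₁ z₂ z₃ : F, e ^ 2 =
    algebraMap F K (z₀ ^ 2 + u * z₁ ^ 2 + v * z₂ ^ 2 + u * v * z₃ ^ 2) := by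
  have : CharP K 2 := charP_of_injective_algebraMap (algebraMap F K).injective 2
  obtain ⟨x₀, x₁, x₂, x₃, he⟩ := hK.exists_coords e
  refine ⟨x₀, x₁, x₂, x₃, ?_⟩
  simp only [map_add, map_mul, map_pow, ← hK.sq_left, ← hK.sq_right]
  grind

/-- Over the biquadratic extension the form `[a, b] ⊥ ⟨1⟩` stays anisotropic. -/
theorem eq_zero_of_eq_sq (hK : IsBiquadratic u v α β) {a b : F} (hab : AvoidsBilin a b u v)
    {x y z : K}
    (h0 : algebraMap F K a * x ^ 2 + x * y + algebraMap F K b * y ^ 2 = z ^ 2) :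
    x = 0 ∧ y = 0 := by
  have hsq : ∀ e : K, ∃ d : F, e ^ 2 = algebraMap F K d := fun e => by
    obtain ⟨_, _, _, _, h⟩ := hK.exists_sq_eq e
    exact ⟨_, h⟩
  by_cases hy : y = 0
  · subst hy
    by_contra hx
    have hx : x ≠ 0 := by tauto
    obtain ⟨z₀, z₁, z₂, z₃, hz⟩ := hK.exists_sq_eq (z * x⁻¹)
    have := hab 1 0 z₀ z₁ z₂ z₃ (by
      apply (algebraMap F K).injective
      rw [← hz]
      simp only [map_add, map_mul, map_pow, map_zero, map_one]
      field_simp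
      linear_combination h0)
    simp at this
  · obtain ⟨x', hx'⟩ := hsq x
    obtain ⟨y', hy'⟩ := hsq y
    obtain ⟨z', hz'⟩ := hsq z
    obtain ⟨z₀, z₁, z₂, z₃, hz⟩ := hK.exists_sq_eq (z * y⁻¹)
    have hy0 : y' ≠ 0 := by
      rintro rfl
      rw [map_zero] at hy'
      exact hy (by simpa using hy')
    have hxy : algebraMap F K ((z' - a * x' - b * y') / y') = x * y⁻¹ := by
      rw [map_div₀, map_sub, map_sub, map_mul, map_mul, ← hx', ← hy', ← hz']
      field_simp
      linear_combination -h0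
    have := hab ((z' - a * x' - b * y') / y') 1 z₀ z₁ z₂ z₃ (by
      apply (algebraMap F K).injective
      rw [← hz]
      simp only [map_add, map_mul, map_pow, map_zero, map_one, hxy]
      field_simp
      linear_combination h0)
    simp at this

end IsBiquadratic

end Biquadratic

section Core

variable {F : Type} [Field F]

/-- Elementary form of `IsotropyImplies` for the forms `[a', b'] ⊥ ⟨1, u', v'⟩` and
`[a, b] ⊥ ⟨1, u, v⟩`. -/
def PointTransfer (a' b' u' v' a b u v : F) : Prop :=
  ∀ (E : Type) [Field E] (f : F →+* E) (x y z₀ z₁ z₂ : E), (x ≠ 0 ∨ y ≠ 0) →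
    f a' * x ^ 2 + x * y + f b' * y ^ 2 + z₀ ^ 2 + f u' * z₁ ^ 2 + f v' * z₂ ^ 2 = 0 →
    ∃ x y z₀ z₁ z₂ : E, (x ≠ 0 ∨ y ≠ 0) ∧
      f a * x ^ 2 + x * y + f b * y ^ 2 = z₀ ^ 2 + f u * z₁ ^ 2 + f v * z₂ ^ 2

theorem IsotropyImplies.pointTransfer [Infinite F] [CharP F 2] {a' b' u' v' a b u v : F}
    (h : IsotropyImplies (form5 a' 1 b' 1 u' v') (form5 a 1 b 1 u v)) :
    PointTransfer a' b' u' v' a b u v := by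
  intro E _ f x y z₀ z₁ z₂ hxy h0
  have : CharP E 2 := charP_of_injective_ringHom f.injective 2
  have h1 := h E f
  rw [isNonradicallyIsotropic_form5 f one_ne_zero, isNonradicallyIsotropic_form5 f one_ne_zero] at h1
  obtain ⟨x, y, z₀, z₁, z₂, hxy, h2⟩ := h1 ⟨x, y, z₀, z₁, z₂, hxy, by simpa using h0⟩
  refine ⟨x, y, z₀, z₁, z₂, hxy, ?_⟩
  simp only [map_one, one_mul] at h2
  grind

end Core

section QuadraticExtension

theorem exists_quadratic_extension {k : Type} [Field k] (d c : k)
    (h : ∀ x : k, x ^ 2 + d * x + c ≠ 0) :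
    ∃ (E : Type) (_ : Field E) (f : k →+* E) (θ : E), θ ^ 2 + f d * θ + f c = 0 ∧
      (∀ e, ∃ x y, e = f x + f y * θ) ∧ ∀ x y, f x + f y * θ = 0 → x = 0 ∧ y = 0 := by
  let p : Polynomial k := Polynomial.X ^ 2 + (Polynomial.C d * Polynomial.X + Polynomial.C c)
  have hlin : (Polynomial.C d * Polynomial.X + Polynomial.C c).degree < ((2 : ℕ) : WithBot ℕ) :=
    lt_of_le_of_lt Polynomial.degree_linear_le (by norm_num)
  have hdeg : p.natDegree = 2 := by
    apply Polynomial.natDegree_eq_of_degree_eq_some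
    rw [Polynomial.degree_add_eq_left_of_degree_lt] <;> rw [Polynomial.degree_X_pow]
    exact hlin
  have hmonic : p.Monic := Polynomial.monic_X_pow_add hlin
  have hirr : Irreducible p := by
    refine Polynomial.irreducible_of_degree_le_three_of_not_isRoot (by rw [hdeg]; decide) fun x hx => ?_
    refine h x ?_
    simpa [p, Polynomial.IsRoot.def, add_assoc] using hx
  have : Fact (Irreducible p) := ⟨hirr⟩
  refine ⟨AdjoinRoot p, inferInstance, AdjoinRoot.of p, AdjoinRoot.root p, ?_, ?_, ?_⟩
  · have := AdjoinRoot.eval₂_root p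
    simpa [p, add_assoc] using this
  · intro e
    obtain ⟨r, rfl⟩ := AdjoinRoot.mk_surjective e
    rw [← Polynomial.modByMonic_add_div r p, map_add, map_mul, AdjoinRoot.mk_self,
      zero_mul, add_zero]
    have h1 : (r %ₘ p).natDegree ≤ 1 := by
      have := Polynomial.natDegree_modByMonic_lt r hmonic (fun h1 => by rw [h1] at hdeg; simp at hdeg)
      omega
    obtain ⟨y, x, h2⟩ := Polynomial.exists_eq_X_add_C_of_natDegree_le_one h1
    exact ⟨x, y, by rw [h2]; simp [add_comm]⟩
  · intro x y hxy
    by_cases hy : y = 0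
    · subst hy
      simpa using hxy
    · exfalso
      have h1 : AdjoinRoot.root p = AdjoinRoot.of p (-x / y) := by
        have : AdjoinRoot.of p y ≠ 0 := by simpa using hy
        rw [map_div₀, map_neg, eq_div_iff this]
        linear_combination hxy
      have h2 := AdjoinRoot.eval₂_root p
      rw [h1] at h2
      simp only [p, Polynomial.eval₂_add, Polynomial.eval₂_mul, Polynomial.eval₂_C,
        Polynomial.eval₂_pow, Polynomial.eval₂_X, ← map_pow, ← map_mul, ← map_add] at h2
      rw [map_eq_zero] at h2
      exact h (-x / y) (by linear_combination h2)

end QuadraticExtension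

section Represent

variable {F : Type} [Field F] [CharP F 2] {a' b' u' v' a b u v : F}

theorem PointTransfer.exists_representation (H : PointTransfer a' b' u' v' a b u v)
    {E : Type} [Field E] (f : F →+* E) {α β : E} (hα : α ^ 2 = f u) (hβ : β ^ 2 = f v)
    (hq : ∀ x y z : E, f a * x ^ 2 + x * y + f b * y ^ 2 = z ^ 2 → x = 0 ∧ y = 0)
    {x y z₀ z₁ z₂ : E} (hxy : x ≠ 0 ∨ y ≠ 0)
    (hz : z₀ ^ 2 + f u' * z₁ ^ 2 + f v' * z₂ ^ 2 ≠ 0) :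
    ∃ p₁ p₂ l : E, (f a' * x ^ 2 + x * y + f b' * y ^ 2) *
      (z₀ ^ 2 + f u' * z₁ ^ 2 + f v' * z₂ ^ 2) = f a * p₁ ^ 2 + p₁ * p₂ + f b * p₂ ^ 2 + l ^ 2 := by
  have : CharP E 2 := charP_of_injective_ringHom f.injective 2
  obtain ⟨r, hr⟩ : ∃ r, r = z₀ ^ 2 + f u' * z₁ ^ 2 + f v' * z₂ ^ 2 := ⟨_, rfl⟩
  obtain ⟨m, hm⟩ : ∃ m, m = (f a' * x ^ 2 + x * y + f b' * y ^ 2) * r := ⟨_, rfl⟩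
  rw [← hr] at hz
  rw [← hr, ← hm]
  by_cases hsq : ∃ l, m = l ^ 2
  · obtain ⟨l, hl⟩ := hsq
    exact ⟨0, 0, l, by rw [hl]; ring⟩
  push Not at hsq
  obtain ⟨L, _, g, μ, hμ, hspan, hind⟩ := exists_quadratic_extension 0 m fun t ht =>
    hsq t (by grind)
  have : CharP L 2 := charP_of_injective_ringHom g.injective 2
  have hgr : g r ≠ 0 := by simpa using hz
  obtain ⟨X, Y, Z₀, Z₁, Z₂, hXY, h0⟩ := H L (g.comp f) (g x) (g y) (g z₀ * μ / g r)
    (g z₁ * μ / g r) (g z₂ * μ / g r) (by simpa using hxy) (by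
      have h1 : μ ^ 2 = g m := by rw [map_zero] at hμ; grind
      have h2 : g m = (g (f a') * g x ^ 2 + g x * g y + g (f b') * g y ^ 2) * g r := by
        rw [hm]; simp only [map_add, map_mul, map_pow]
      have h3 : g r = g z₀ ^ 2 + g (f u') * g z₁ ^ 2 + g (f v') * g z₂ ^ 2 := by
        rw [hr]; simp only [map_add, map_mul, map_pow]
      simp only [RingHom.comp_apply]
      have h4 : (g z₀ * μ / g r) ^ 2 + g (f u') * (g z₁ * μ / g r) ^ 2 +
          g (f v') * (g z₂ * μ / g r) ^ 2 =
          g (f a') * g x ^ 2 + g x * g y + g (f b') * g y ^ 2 := by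
        calc _ = (g z₀ ^ 2 + g (f u') * g z₁ ^ 2 + g (f v') * g z₂ ^ 2) * μ ^ 2 / (g r) ^ 2 := by ring
          _ = _ := by rw [← h3, h1, h2]; field_simp
      grind)
  have hW : g (f a) * X ^ 2 + X * Y + g (f b) * Y ^ 2 = (Z₀ + g α * Z₁ + g β * Z₂) ^ 2 := by
    simp only [RingHom.comp_apply, ← hα, ← hβ, map_pow] at h0
    grind
  obtain ⟨X₀, X₁, rfl⟩ := hspan X
  obtain ⟨Y₀, Y₁, rfl⟩ := hspan Y
  obtain ⟨W₀, W₁, hW'⟩ := hspan (Z₀ + g α * Z₁ + g β * Z₂)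
  rw [hW'] at hW
  obtain ⟨h1, h2⟩ := hind (f a * X₀ ^ 2 + X₀ * Y₀ + f b * Y₀ ^ 2 +
    m * (f a * X₁ ^ 2 + X₁ * Y₁ + f b * Y₁ ^ 2) + W₀ ^ 2 + m * W₁ ^ 2) (X₀ * Y₁ + X₁ * Y₀) (by
      simp only [map_add, map_mul, map_pow, map_zero] at hμ hW ⊢
      grind)
  clear hW hW' h0 hspan hind hμ H hm hr
  by_cases hP : X₀ = 0 ∧ Y₀ = 0
  · obtain ⟨rfl, rfl⟩ := hP
    have hW₀ : W₀ ≠ 0 := by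
      rintro rfl
      have hm0 : m ≠ 0 := fun h => hsq 0 (by rw [h]; ring)
      have := hq X₁ Y₁ W₁ (by
        have : m * (f a * X₁ ^ 2 + X₁ * Y₁ + f b * Y₁ ^ 2 - W₁ ^ 2) = 0 := by grind
        exact sub_eq_zero.mp ((mul_eq_zero.mp this).resolve_left hm0))
      rw [this.1, this.2] at hXY
      simp at hXY
    refine ⟨m * X₁ / W₀, m * Y₁ / W₀, m * W₁ / W₀, ?_⟩
    field_simp
    grind
  · obtain ⟨t, ht₁, ht₂⟩ : ∃ t, X₁ = t * X₀ ∧ Y₁ = t * Y₀ := by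
      by_cases hX₀ : X₀ = 0
      · have hY₀ : Y₀ ≠ 0 := by tauto
        refine ⟨Y₁ / Y₀, ?_, by field_simp⟩
        subst hX₀
        have : X₁ * Y₀ = 0 := by simpa using h2
        rw [(mul_eq_zero.mp this).resolve_right hY₀]; ring
      · refine ⟨X₁ / X₀, by field_simp, ?_⟩
        field_simp
        grind
    subst ht₁ ht₂
    have hn : 1 + m * t ^ 2 ≠ 0 := by
      intro h3
      have ht : t ≠ 0 := by
        rintro rfl
        simp at h3
      exact hsq t⁻¹ (by field_simp; grind)
    have hl : W₀ * t + W₁ ≠ 0 := by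
      intro h3
      have := hq ((1 + m * t ^ 2) * X₀) ((1 + m * t ^ 2) * Y₀) (W₀ + m * W₁ * t) (by grind)
      simp [hn] at this
      exact hP this
    refine ⟨(1 + m * t ^ 2) * X₀ / (W₀ * t + W₁), (1 + m * t ^ 2) * Y₀ / (W₀ * t + W₁),
      (W₀ + m * W₁ * t) / (W₀ * t + W₁), ?_⟩
    have hsum : m * (W₀ * t + W₁) ^ 2 = f a * ((1 + m * t ^ 2) * X₀) ^ 2 +
        (1 + m * t ^ 2) * X₀ * ((1 + m * t ^ 2) * Y₀) + f b * ((1 + m * t ^ 2) * Y₀) ^ 2 +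
        (W₀ + m * W₁ * t) ^ 2 := by
      clear hq hsq hz hn hl
      grind
    rw [← eq_div_iff (pow_ne_zero 2 hl)] at hsum
    generalize (W₀ * t + W₁) = w at hsum ⊢
    generalize (1 + m * t ^ 2) = n at hsum ⊢
    generalize (W₀ + m * W₁ * t) = n' at hsum ⊢
    rw [hsum]
    ring

end Represent

section CasselsPfister

/-- The step of the Cassels–Pfister descent: the line through `N / D` and `q` meets the quadric
`Q = f` in a second point, whose denominator is `D'`. -/
theorem QuadraticMap.descent_step {R V : Type} [CommRing R] [AddCommGroup V] [Module R V]
    (Q : QuadraticForm R V) {q r : V} {D f : R} (h : Q (D • q + r) = D ^ 2 * f) :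
    let D' := D * (f - Q q) - polar Q q r
    Q r = D * D' ∧ Q (D' • q + (Q q - f) • r) = D' ^ 2 * f := by
  have h1 : Q r = D * (D * (f - Q q) - polar Q q r) := by
    rw [QuadraticMap.map_add Q, QuadraticMap.map_smul, polar_smul_left] at h
    simp only [smul_eq_mul] at h
    linear_combination h
  refine ⟨h1, ?_⟩
  rw [QuadraticMap.map_add Q, QuadraticMap.map_smul, QuadraticMap.map_smul, polar_smul_left,
    polar_smul_right, h1]
  simp only [smul_eq_mul]
  ring

open scoped Polynomial in
theorem coeff_toQuadraticMap'_map_C {k : Type} [Field k] {n : ℕ} (M : Matrix (Fin n) (Fin n) k)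
    {v : Fin n → k[X]} {d : ℕ} (hd : ∀ i, (v i).natDegree ≤ d) :
    ((M.map Polynomial.C).toQuadraticMap' v).coeff (d + d) =
      M.toQuadraticMap' (fun i => (v i).coeff d) := by
  simp only [toQuadraticMap'_apply, Polynomial.finset_sum_coeff, Matrix.map_apply, Polynomial.coeff_C_mul,
    Polynomial.coeff_mul_add_eq_of_natDegree_le (hd _) (hd _)]

open scoped Polynomial in
theorem natDegree_toQuadraticMap'_map_C_le {k : Type} [Field k] {n : ℕ}
    (M : Matrix (Fin n) (Fin n) k) {v : Fin n → k[X]} {d : ℕ} (hd : ∀ i, (v i).natDegree ≤ d) :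
    ((M.map Polynomial.C).toQuadraticMap' v).natDegree ≤ d + d := by
  rw [toQuadraticMap'_apply]
  refine Polynomial.natDegree_sum_le_of_forall_le _ _ fun i _ => Polynomial.natDegree_sum_le_of_forall_le _ _ fun j _ => ?_
  refine (Polynomial.natDegree_C_mul_le _ _).trans (Polynomial.natDegree_mul_le.trans (add_le_add (hd i) (hd j)))

open scoped Polynomial in
theorem exists_natDegree_toQuadraticMap'_map_C {k : Type} [Field k] {n : ℕ}
    {M : Matrix (Fin n) (Fin n) k} (hM : M.toQuadraticMap'.Anisotropic) {v : Fin n → k[X]}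
    (hv : v ≠ 0) : ∃ d, (∀ i, (v i).natDegree ≤ d) ∧
      ((M.map Polynomial.C).toQuadraticMap' v).coeff (d + d) ≠ 0 := by
  obtain ⟨j, hj⟩ := Function.ne_iff.mp hv
  obtain ⟨i, -, hi⟩ := Finset.exists_max_image Finset.univ (fun i => (v i).degree) ⟨j, Finset.mem_univ j⟩
  have hi0 : v i ≠ 0 := by
    intro h
    have := hi j (Finset.mem_univ j)
    rw [h, Polynomial.degree_zero, le_bot_iff, Polynomial.degree_eq_bot] at this
    exact hj this
  have hd : ∀ l, (v l).natDegree ≤ (v i).natDegree := fun l =>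
    Polynomial.natDegree_le_natDegree (hi l (Finset.mem_univ l))
  refine ⟨_, hd, ?_⟩
  rw [coeff_toQuadraticMap'_map_C M hd]
  intro h
  have := congrFun (hM _ h) i
  exact hi0 (Polynomial.leadingCoeff_eq_zero.mp this)

open scoped Polynomial in
theorem QuadraticMap.Anisotropic.map_C {k : Type} [Field k] {n : ℕ}
    {M : Matrix (Fin n) (Fin n) k} (hM : M.toQuadraticMap'.Anisotropic) :
    (M.map Polynomial.C).toQuadraticMap'.Anisotropic := by
  intro v hv
  by_contra h
  obtain ⟨d, -, hd⟩ := exists_natDegree_toQuadraticMap'_map_C hM h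
  rw [hv, Polynomial.coeff_zero] at hd
  exact hd rfl

theorem toQuadraticMap'_map_apply {R S : Type} [CommRing R] [CommRing S] (f : R →+* S) {n : ℕ}
    (M : Matrix (Fin n) (Fin n) R) (v : Fin n → R) :
    (M.map f).toQuadraticMap' (fun i => f (v i)) = f (M.toQuadraticMap' v) := by
  simp [toQuadraticMap'_apply, map_sum]

open scoped Polynomial in
theorem exists_common_denominator {k : Type} [Field k] {n : ℕ} (g : Fin n → RatFunc k) :
    ∃ (D : k[X]) (N : Fin n → k[X]), D ≠ 0 ∧
      ∀ i, algebraMap k[X] (RatFunc k) (N i) = algebraMap k[X] (RatFunc k) D * g i := by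
  obtain ⟨D, hD⟩ := IsLocalization.exist_integer_multiples_of_finite (nonZeroDivisors k[X]) g
  choose N hN using hD
  exact ⟨D, N, nonZeroDivisors.coe_ne_zero D, fun i => by rw [hN, Algebra.smul_def]⟩

open scoped Polynomial in
theorem map_algebraMap_ratFunc {k : Type} [Field k] {n : ℕ} (M : Matrix (Fin n) (Fin n) k) :
    M.map (algebraMap k (RatFunc k)) = (M.map Polynomial.C).map (algebraMap k[X] (RatFunc k)) := by
  ext i j
  simp [RatFunc.algebraMap_eq_C]

open scoped Polynomial in
theorem toQuadraticMap'_ratFunc {k : Type} [Field k] {n : ℕ} (M : Matrix (Fin n) (Fin n) k)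
    {g : Fin n → RatFunc k} {D : k[X]} {N : Fin n → k[X]}
    (hN : ∀ i, algebraMap k[X] (RatFunc k) (N i) = algebraMap k[X] (RatFunc k) D * g i) :
    algebraMap k[X] (RatFunc k) ((M.map Polynomial.C).toQuadraticMap' N) =
      algebraMap k[X] (RatFunc k) D ^ 2 * (M.map (algebraMap k (RatFunc k))).toQuadraticMap' g := by
  rw [← toQuadraticMap'_map_apply, map_algebraMap_ratFunc, funext hN]
  have := QuadraticMap.map_smul ((M.map Polynomial.C).map (algebraMap k[X] (RatFunc k))).toQuadraticMap'
    (algebraMap k[X] (RatFunc k) D) g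
  rw [smul_eq_mul, ← _root_.sq] at this
  exact this

theorem QuadraticMap.Anisotropic.map_ratFunc {k : Type} [Field k] {n : ℕ}
    {M : Matrix (Fin n) (Fin n) k} (hM : M.toQuadraticMap'.Anisotropic) :
    (M.map (algebraMap k (RatFunc k))).toQuadraticMap'.Anisotropic := by
  intro g hg
  obtain ⟨D, N, hD, hN⟩ := exists_common_denominator g
  have h1 := toQuadraticMap'_ratFunc M hN
  rw [hg, mul_zero, map_eq_zero_iff _ (IsFractionRing.injective _ _)] at h1
  have h2 := hM.map_C N h1
  have hD' : algebraMap (Polynomial k) (RatFunc k) D ≠ 0 := by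
    rwa [Ne, map_eq_zero_iff _ (IsFractionRing.injective _ _)]
  ext1 i
  have h3 := hN i
  rw [h2, Pi.zero_apply, map_zero, eq_comm, mul_eq_zero] at h3
  simpa [hD'] using h3

open scoped Polynomial in
theorem cassels_pfister_polynomial {k : Type} [Field k] {n : ℕ}
    {M : Matrix (Fin n) (Fin n) k} (hM : M.toQuadraticMap'.Anisotropic) (f : k[X])
    (J : Set (Fin n)) (c : Fin n → k) (d : ℕ) : ∀ (D : k[X]) (N : Fin n → k[X]), D.natDegree = d →
    D ≠ 0 → (M.map Polynomial.C).toQuadraticMap' N = D ^ 2 * f → (∀ j ∈ J, N j = D * Polynomial.C (c j)) →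
    ∃ q : Fin n → k[X], (M.map Polynomial.C).toQuadraticMap' q = f ∧ ∀ j ∈ J, q j = Polynomial.C (c j) := by
  induction d using Nat.strong_induction_on with
  | _ d ih =>
    intro D N hd hD hN hJ
    obtain ⟨q, hq⟩ : ∃ q : Fin n → k[X], q = fun i => N i / D := ⟨_, rfl⟩
    obtain ⟨r, hr⟩ : ∃ r : Fin n → k[X], r = fun i => N i % D := ⟨_, rfl⟩
    have hqr : N = D • q + r := by
      ext1 i
      simp [hq, hr, EuclideanDomain.div_add_mod]
    have hqJ : ∀ j ∈ J, q j = Polynomial.C (c j) := fun j hj => by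
      rw [hq]
      simp only [hJ j hj]
      rw [mul_comm]
      exact mul_div_cancel_right₀ _ hD
    have hrJ : ∀ j ∈ J, r j = 0 := fun j hj => by
      rw [hr]
      simp only [hJ j hj]
      rw [mul_comm]
      exact EuclideanDomain.mod_eq_zero.mpr (dvd_mul_left _ _)
    rw [hqr] at hN
    by_cases hr0 : r = 0
    · refine ⟨q, ?_, hqJ⟩
      rw [hr0, add_zero, QuadraticMap.map_smul, smul_eq_mul, ← _root_.sq] at hN
      exact mul_left_cancel₀ (pow_ne_zero 2 hD) hN
    · obtain ⟨h1, h2⟩ := QuadraticMap.descent_step _ hN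
      obtain ⟨D', hD'⟩ : ∃ D', D' = D * (f - (M.map Polynomial.C).toQuadraticMap' q) -
        polar (M.map Polynomial.C).toQuadraticMap' q r := ⟨_, rfl⟩
      rw [← hD'] at h1 h2
      have hr1 : (M.map Polynomial.C).toQuadraticMap' r ≠ 0 := fun h => hr0 (hM.map_C _ h)
      have hD'0 : D' ≠ 0 := by
        rintro rfl
        rw [mul_zero] at h1
        exact hr1 h1
      have hdpos : 0 < D.natDegree := by
        by_contra h
        rw [not_lt, Nat.le_zero, Polynomial.natDegree_eq_zero] at h
        obtain ⟨x, rfl⟩ := h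
        apply hr0
        ext1 i
        rw [hr]
        have : IsUnit (Polynomial.C x) := Polynomial.isUnit_C.mpr (isUnit_iff_ne_zero.mpr (by simpa using hD))
        exact (EuclideanDomain.mod_eq_zero).mpr this.dvd
      have hrd : ∀ i, (r i).natDegree ≤ D.natDegree - 1 := fun i => by
        have : (r i).natDegree < D.natDegree := by
          rw [hr]
          exact Polynomial.natDegree_mod_lt _ hdpos.ne'
        omega
      have h3 := natDegree_toQuadraticMap'_map_C_le M hrd
      rw [h1, Polynomial.natDegree_mul hD hD'0] at h3
      refine ih D'.natDegree (by omega) D' _ rfl hD'0 h2 fun j hj => ?_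
      simp [hqJ j hj, hrJ j hj]

open scoped Polynomial in
/-- The Cassels–Pfister theorem for polynomials of degree at most two, keeping track of the
coordinates which are already constant. -/
theorem cassels_pfister {k : Type} [Field k] {n : ℕ} {M : Matrix (Fin n) (Fin n) k}
    (hM : M.toQuadraticMap'.Anisotropic) (f₀ f₁ f₂ : k) (J : Set (Fin n)) (c : Fin n → k)
    (g : Fin n → RatFunc k)
    (hg : (M.map (algebraMap k (RatFunc k))).toQuadraticMap' g =
      algebraMap k (RatFunc k) f₀ + algebraMap k (RatFunc k) f₁ * RatFunc.X +
        algebraMap k (RatFunc k) f₂ * RatFunc.X ^ 2)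
    (hJ : ∀ j ∈ J, g j = algebraMap k (RatFunc k) (c j)) :
    ∃ g₀ g₁ : Fin n → k, M.toQuadraticMap' g₀ = f₀ ∧ polar M.toQuadraticMap' g₀ g₁ = f₁ ∧
      M.toQuadraticMap' g₁ = f₂ ∧ ∀ j ∈ J, g₀ j = c j ∧ g₁ j = 0 := by
  obtain ⟨D, N, hD, hN⟩ := exists_common_denominator g
  have hD' : algebraMap k[X] (RatFunc k) D ≠ 0 := by
    rwa [Ne, map_eq_zero_iff _ (IsFractionRing.injective _ _)]
  have hC : ∀ x : k, algebraMap k (RatFunc k) x = algebraMap k[X] (RatFunc k) (Polynomial.C x) := fun x => by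
    simp [RatFunc.algebraMap_eq_C]
  obtain ⟨q, hq, hqJ⟩ := cassels_pfister_polynomial hM (Polynomial.C f₀ + Polynomial.C f₁ * Polynomial.X + Polynomial.C f₂ * Polynomial.X ^ 2) J c _ D N rfl hD
    (by
      apply IsFractionRing.injective k[X] (RatFunc k)
      rw [toQuadraticMap'_ratFunc M hN, hg]
      simp only [hC, map_add, map_mul, map_pow, RatFunc.algebraMap_X])
    (fun j hj => by
      apply IsFractionRing.injective k[X] (RatFunc k)
      rw [hN, hJ j hj, map_mul, hC])
  have hdeg : ∀ i, (q i).natDegree ≤ 1 := by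
    by_cases hq0 : q = 0
    · simp [hq0]
    · obtain ⟨d, hd, hd'⟩ := exists_natDegree_toQuadraticMap'_map_C hM hq0
      have h1 : d + d ≤ 2 := by
        refine (Polynomial.le_natDegree_of_ne_zero hd').trans ?_
        rw [hq]
        compute_degree
      intro i
      have := hd i
      omega
  have hqe : q = (fun i => Polynomial.C ((q i).coeff 0)) + (Polynomial.X : k[X]) • fun i => Polynomial.C ((q i).coeff 1) := by
    ext1 i
    simp only [Pi.add_apply, Pi.smul_apply, smul_eq_mul]
    rw [mul_comm, add_comm]
    exact Polynomial.eq_X_add_C_of_natDegree_le_one (hdeg i)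
  refine ⟨fun i => (q i).coeff 0, fun i => (q i).coeff 1, ?_⟩
  have hpol : ∀ v w : Fin n → k, polar (M.map Polynomial.C).toQuadraticMap' (fun i => Polynomial.C (v i))
      (fun i => Polynomial.C (w i)) = Polynomial.C (polar M.toQuadraticMap' v w) := fun v w => by
    simp only [polar, map_sub]
    rw [← toQuadraticMap'_map_apply, ← toQuadraticMap'_map_apply, ← toQuadraticMap'_map_apply]
    congr 3
    ext1 i
    simp
  rw [hqe, QuadraticMap.map_add (M.map Polynomial.C).toQuadraticMap', QuadraticMap.map_smul, polar_smul_right, toQuadraticMap'_map_apply,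
    toQuadraticMap'_map_apply, hpol] at hq
  have e0 := congrArg (fun p : k[X] => p.coeff 0) hq
  have e1 := congrArg (fun p : k[X] => p.coeff 1) hq
  have e2 := congrArg (fun p : k[X] => p.coeff 2) hq
  simp [← _root_.sq, Polynomial.coeff_X, Polynomial.coeff_C] at e0 e1 e2
  refine ⟨e0, e1, e2, fun j hj => ?_⟩
  simp [hqJ j hj, Polynomial.coeff_C]

end CasselsPfister

section Represent

/-- The Gram matrix of `[a,b] ⊥ ⟨1⟩`. -/
def ternaryMatrix {k : Type} [Field k] (a b : k) : Matrix (Fin 3) (Fin 3) k :=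
  Matrix.of ![![a, 1, 0], ![0, b, 0], ![0, 0, 1]]

theorem ternaryMatrix_apply {k : Type} [Field k] (a b : k) (v : Fin 3 → k) :
    (ternaryMatrix a b).toQuadraticMap' v =
      a * v 0 ^ 2 + v 0 * v 1 + b * v 1 ^ 2 + v 2 ^ 2 := by
  simp [toQuadraticMap'_apply, ternaryMatrix, Fin.sum_univ_succ]
  ring

theorem ternaryMatrix_map {k K : Type} [Field k] [Field K] (f : k →+* K) (a b : k) :
    (ternaryMatrix a b).map f = ternaryMatrix (f a) (f b) := by
  ext i j
  fin_cases i <;> fin_cases j <;> simp [ternaryMatrix]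

theorem ternaryMatrix_anisotropic_iff {k : Type} [Field k] [CharP k 2] {a b : k} :
    (ternaryMatrix a b).toQuadraticMap'.Anisotropic ↔
      ∀ x y z : k, a * x ^ 2 + x * y + b * y ^ 2 = z ^ 2 → x = 0 ∧ y = 0 := by
  refine ⟨fun h x y z hz => ?_, fun h v hv => ?_⟩
  · have := h ![x, y, z] (by simp only [ternaryMatrix_apply, Matrix.cons_val]; grind)
    exact ⟨congrFun this 0, congrFun this 1⟩
  · rw [ternaryMatrix_apply] at hv
    obtain ⟨h0, h1⟩ := h (v 0) (v 1) (v 2) (by grind)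
    rw [h0, h1] at hv
    have h2 : v 2 = 0 := by simpa using hv
    ext i
    fin_cases i <;> assumption

variable {F : Type} [Field F] [CharP F 2] {a' b' u' v' a b u v : F}

theorem eq_zero_of_eq_sq_ratFunc {K : Type} [Field K] (f : F →+* K)
    (hq : ∀ x y z : K, f a * x ^ 2 + x * y + f b * y ^ 2 = z ^ 2 → x = 0 ∧ y = 0)
    (x y z : RatFunc K) (h : algebraMap K (RatFunc K) (f a) * x ^ 2 + x * y +
      algebraMap K (RatFunc K) (f b) * y ^ 2 = z ^ 2) : x = 0 ∧ y = 0 := by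
  have : CharP K 2 := charP_of_injective_ringHom f.injective 2
  have : CharP (RatFunc K) 2 := charP_of_injective_ringHom (algebraMap K (RatFunc K)).injective 2
  have h1 := (ternaryMatrix_anisotropic_iff.mpr hq).map_ratFunc
  rw [ternaryMatrix_map, ternaryMatrix_anisotropic_iff] at h1
  exact h1 x y z h

theorem PointTransfer.exists_constant_representation (H : PointTransfer a' b' u' v' a b u v)
    {k : Type} [Field k] (f : F →+* k) {α β : k} (hα : α ^ 2 = f u) (hβ : β ^ 2 = f v)
    (hq : ∀ x y z : k, f a * x ^ 2 + x * y + f b * y ^ 2 = z ^ 2 → x = 0 ∧ y = 0)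
    {x y z₀ z₁ z₂ : RatFunc k} (hxy : x ≠ 0 ∨ y ≠ 0)
    (hz : z₀ ^ 2 + algebraMap k (RatFunc k) (f u') * z₁ ^ 2 +
      algebraMap k (RatFunc k) (f v') * z₂ ^ 2 ≠ 0) (f₀ f₁ f₂ : k)
    (hf : (algebraMap k (RatFunc k) (f a') * x ^ 2 + x * y +
      algebraMap k (RatFunc k) (f b') * y ^ 2) *
      (z₀ ^ 2 + algebraMap k (RatFunc k) (f u') * z₁ ^ 2 +
      algebraMap k (RatFunc k) (f v') * z₂ ^ 2) =
      algebraMap k (RatFunc k) f₀ + algebraMap k (RatFunc k) f₁ * RatFunc.X +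
        algebraMap k (RatFunc k) f₂ * RatFunc.X ^ 2) :
    ∃ x₀ y₀ l₀ x₁ y₁ l₁ : k, f₀ = f a * x₀ ^ 2 + x₀ * y₀ + f b * y₀ ^ 2 + l₀ ^ 2 ∧
      f₁ = x₀ * y₁ + x₁ * y₀ ∧ f₂ = f a * x₁ ^ 2 + x₁ * y₁ + f b * y₁ ^ 2 + l₁ ^ 2 := by
  have : CharP k 2 := charP_of_injective_ringHom f.injective 2
  obtain ⟨p₁, p₂, l, h⟩ := H.exists_representation ((algebraMap k (RatFunc k)).comp f)
    (α := algebraMap k (RatFunc k) α) (β := algebraMap k (RatFunc k) β)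
    (by rw [← map_pow, hα]; rfl) (by rw [← map_pow, hβ]; rfl) (eq_zero_of_eq_sq_ratFunc f hq) hxy hz
  obtain ⟨g₀, g₁, h0, h1, h2, -⟩ := cassels_pfister (ternaryMatrix_anisotropic_iff.mpr hq) f₀ f₁ f₂
    ∅ 0 ![p₁, p₂, l] (by
      rw [ternaryMatrix_map, ternaryMatrix_apply, ← hf]
      exact h.symm) (by simp)
  refine ⟨g₀ 0, g₀ 1, g₀ 2, g₁ 0, g₁ 1, g₁ 2, ?_, ?_, ?_⟩
  · rw [← h0, ternaryMatrix_apply]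
  · rw [← h1, polar]
    simp only [ternaryMatrix_apply, Pi.add_apply]
    grind
  · rw [← h2, ternaryMatrix_apply]

open scoped Polynomial in
theorem eq_zero_of_separable_mul_eq_sq {K : Type} [Field K] [CharP K 2] (a b : K) (n r : K[X])
    (hn : n.derivative = 0)
    (h : (Polynomial.C a + Polynomial.X + Polynomial.C b * Polynomial.X ^ 2) * n = r ^ 2) :
    n = 0 := by
  have h2 : (2 : K[X]) = 0 := CharTwo.two_eq_zero
  have := congrArg Polynomial.derivative h
  simpa [hn, Polynomial.derivative_pow, h2, CharTwo.two_eq_zero] using this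

open scoped Polynomial in
theorem one_add_mul_X_sq_ne_zero {k : Type} [Field k] (c : k) :
    1 + algebraMap k (RatFunc k) c * RatFunc.X ^ 2 ≠ 0 := by
  intro h
  have h1 : algebraMap k[X] (RatFunc k) (1 + Polynomial.C c * Polynomial.X ^ 2) = 0 := by
    rw [← h]
    simp [RatFunc.algebraMap_eq_C]
  rw [map_eq_zero_iff _ (IsFractionRing.injective _ _)] at h1
  simpa using congrArg (fun p : k[X] => p.coeff 0) h1

theorem PointTransfer.swap (H : PointTransfer a' b' u' v' a b u v) :
    PointTransfer a' b' v' u' a b u v := by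
  intro E _ f x y z₀ z₁ z₂ hxy h
  exact H E f x y z₀ z₂ z₁ hxy (by rw [← h]; ring)

open scoped Polynomial in
theorem PointTransfer.exists_sq_eq (H : PointTransfer a' b' u' v' a b u v)
    {K : Type} [Field K] (f : F →+* K) {α β : K} (hα : α ^ 2 = f u) (hβ : β ^ 2 = f v)
    (hq : ∀ x y z : K, f a * x ^ 2 + x * y + f b * y ^ 2 = z ^ 2 → x = 0 ∧ y = 0) :
    ∃ w : K, w ^ 2 = f u' := by
  have : CharP K 2 := charP_of_injective_ringHom f.injective 2
  have : CharP (RatFunc K) 2 := charP_of_injective_ringHom (algebraMap K (RatFunc K)).injective 2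
  have : CharP (RatFunc (RatFunc K)) 2 :=
    charP_of_injective_ringHom (algebraMap (RatFunc K) (RatFunc (RatFunc K))).injective 2
  have h2 : (2 : K[X]) = 0 := CharTwo.two_eq_zero
  by_contra hw
  push Not at hw
  obtain ⟨m, hm⟩ : ∃ m : K[X], m = Polynomial.C (f a') + Polynomial.X +
    Polynomial.C (f b') * Polynomial.X ^ 2 := ⟨_, rfl⟩
  obtain ⟨i, hi⟩ : ∃ i : K[X] →+* RatFunc K, i = algebraMap K[X] (RatFunc K) := ⟨_, rfl⟩
  have hinj : Function.Injective i := by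
    rw [hi]; exact IsFractionRing.injective _ _
  have hiC : ∀ x, algebraMap K (RatFunc K) x = i (Polynomial.C x) := fun x => by
    simp [hi, RatFunc.algebraMap_eq_C]
  have hiX : i Polynomial.X = RatFunc.X := by rw [hi, RatFunc.algebraMap_X]
  obtain ⟨x₀, y₀, l₀, x₁, y₁, l₁, h0, h1, h2'⟩ := H.exists_constant_representation
    ((algebraMap K (RatFunc K)).comp f)
    (α := algebraMap K (RatFunc K) α) (β := algebraMap K (RatFunc K) β)
    (by rw [← map_pow, hα]; rfl) (by rw [← map_pow, hβ]; rfl) (eq_zero_of_eq_sq_ratFunc f hq)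
    (x := 1) (y := algebraMap (RatFunc K) (RatFunc (RatFunc K)) RatFunc.X) (z₀ := 1) (z₁ := RatFunc.X) (z₂ := 0) (by simp)
    (by
      simpa using one_add_mul_X_sq_ne_zero (algebraMap K (RatFunc K) (f u')))
    (i m) 0 (i m * i (Polynomial.C (f u'))) (by
      simp only [RingHom.comp_apply, hiC, hm, ← hiX, map_add, map_mul, map_pow, map_zero]
      ring)
  have key : ∀ n s l : RatFunc K, i m * (i (Polynomial.C (f u')) * n ^ 2 + s ^ 2) = l ^ 2 →
      n = 0 ∧ s = 0 := by
    intro n s l h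
    obtain ⟨D, N, hD, hN⟩ := exists_common_denominator ![n, s, l]
    rw [← hi] at hN
    have hN0 := hN 0
    have hN1 := hN 1
    have hN2 := hN 2
    simp only [Matrix.cons_val] at hN0 hN1 hN2
    have hD' : i D ≠ 0 := by rwa [Ne, map_eq_zero_iff _ hinj]
    have h3 := eq_zero_of_separable_mul_eq_sq (f a') (f b')
      (Polynomial.C (f u') * N 0 ^ 2 + N 1 ^ 2) (N 2)
      (by simp [Polynomial.derivative_pow, CharTwo.two_eq_zero]) (by
        rw [← hm]
        apply hinj
        simp only [map_mul, map_add, map_pow, hN0, hN1, hN2]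
        linear_combination i D ^ 2 * h)
    have h4 : N 0 = 0 := by
      by_contra h4
      have h5 : (Polynomial.C (f u') * N 0 ^ 2).leadingCoeff = (N 1 ^ 2).leadingCoeff :=
        congrArg Polynomial.leadingCoeff (by grind)
      rw [Polynomial.leadingCoeff_mul, Polynomial.leadingCoeff_C, Polynomial.leadingCoeff_pow,
        Polynomial.leadingCoeff_pow] at h5
      have h6 : (N 0).leadingCoeff ≠ 0 := by simpa using h4
      exact hw ((N 1).leadingCoeff / (N 0).leadingCoeff) (by rw [div_pow, ← h5]; field_simp)
    rw [h4] at h3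
    have h5 : N 1 = 0 := by simpa using h3
    rw [h4, map_zero, eq_comm, mul_eq_zero] at hN0
    rw [h5, map_zero, eq_comm, mul_eq_zero] at hN1
    tauto
  simp only [RingHom.comp_apply] at h0 h2'
  by_cases hp : x₀ = 0 ∧ y₀ = 0
  · obtain ⟨rfl, rfl⟩ := hp
    have := (key 0 1 l₀ (by linear_combination h0)).2
    simp at this
  · obtain ⟨t, ht₁, ht₂⟩ : ∃ t, x₁ = t * x₀ ∧ y₁ = t * y₀ := by
      by_cases hX₀ : x₀ = 0
      · have hY₀ : y₀ ≠ 0 := by tauto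
        refine ⟨y₁ / y₀, ?_, by field_simp⟩
        subst hX₀
        have : x₁ * y₀ = 0 := by simpa using h1.symm
        rw [(mul_eq_zero.mp this).resolve_right hY₀]; ring
      · refine ⟨x₁ / x₀, by field_simp, ?_⟩
        field_simp
        grind
    subst ht₁ ht₂
    have := (key 1 t (t * l₀ + l₁) (by grind)).1
    simp at this

end Represent

section Biquadratic

variable {F : Type} [Field F] [CharP F 2] {K : Type} [Field K] [Algebra F K] {u v s t : F}
  {α β σ τ : K}

/-- The linear combinations of `1, α, β, αβ`. -/
noncomputable def biquadraticMap (F : Type) [Field F] {K : Type} [Field K] [Algebra F K]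
    (α β : K) : (Fin 4 → F) →ₗ[F] K :=
  Fintype.linearCombination F ![1, α, β, α * β]

theorem biquadraticMap_apply (α β : K) (x : Fin 4 → F) : biquadraticMap F α β x =
    algebraMap F K (x 0) + algebraMap F K (x 1) * α + algebraMap F K (x 2) * β +
      algebraMap F K (x 3) * (α * β) := by
  simp [biquadraticMap, Fintype.linearCombination_apply, Fin.sum_univ_succ, Algebra.smul_def]
  ring

theorem AnisotropicBilin.biquadraticMap_injective (h : AnisotropicBilin u v)
    (hα : α ^ 2 = algebraMap F K u) (hβ : β ^ 2 = algebraMap F K v) :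
    Function.Injective (biquadraticMap F α β) := by
  rw [injective_iff_map_eq_zero]
  intro x hx
  rw [biquadraticMap_apply] at hx
  obtain ⟨h0, h1, h2, h3⟩ := IsBiquadratic.coords_eq_zero h hα hβ hx
  ext i
  fin_cases i <;> assumption

theorem IsBiquadratic.biquadraticMap_surjective (hK : IsBiquadratic u v α β) :
    Function.Surjective (biquadraticMap F α β) := by
  intro e
  obtain ⟨x₀, x₁, x₂, x₃, h⟩ := hK.exists_coords e
  exact ⟨![x₀, x₁, x₂, x₃], by rw [biquadraticMap_apply, h]; rfl⟩

theorem IsBiquadratic.of_sq_eq (hK : IsBiquadratic u v α β) (h : AnisotropicBilin u v)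
    (hst : AnisotropicBilin s t) (hσ : σ ^ 2 = algebraMap F K s) (hτ : τ ^ 2 = algebraMap F K t) :
    IsBiquadratic s t σ τ := by
  refine ⟨hσ, hτ, fun e => ?_⟩
  let L := LinearEquiv.ofBijective (biquadraticMap F α β)
    ⟨h.biquadraticMap_injective hK.sq_left hK.sq_right, hK.biquadraticMap_surjective⟩
  have hinj : Function.Injective (L.symm.toLinearMap ∘ₗ biquadraticMap F σ τ) :=
    L.symm.injective.comp (hst.biquadraticMap_injective hσ hτ)
  obtain ⟨x, hx⟩ := LinearMap.injective_iff_surjective.mp hinj (L.symm e)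
  have hx' : biquadraticMap F σ τ x = e := L.symm.injective hx
  exact ⟨x 0, x 1, x 2, x 3, by rw [← hx', biquadraticMap_apply]⟩

theorem IsBiquadratic.exists_coord_functionals (hK : IsBiquadratic u v α β)
    (h : AnisotropicBilin u v) : ∃ c : Fin 4 → K →ₗ[F] F, (∀ e : K, e =
      algebraMap F K (c 0 e) + algebraMap F K (c 1 e) * α + algebraMap F K (c 2 e) * β +
      algebraMap F K (c 3 e) * (α * β)) ∧ c 3 1 = 0 ∧ c 3 α = 0 ∧ c 3 β = 0 ∧ c 3 (α * β) = 1 := by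
  let L := LinearEquiv.ofBijective (biquadraticMap F α β)
    ⟨h.biquadraticMap_injective hK.sq_left hK.sq_right, hK.biquadraticMap_surjective⟩
  have hL : ∀ x e, biquadraticMap F α β x = e → L.symm e = x := fun x e hx => by
    rw [LinearEquiv.symm_apply_eq]; exact hx.symm
  refine ⟨fun i => LinearMap.proj i ∘ₗ L.symm.toLinearMap, fun e => ?_, ?_, ?_, ?_, ?_⟩
  · have := L.apply_symm_apply e
    change biquadraticMap F α β (L.symm e) = e at this
    rw [biquadraticMap_apply] at this
    exact this.symm
  all_goals simp only [LinearMap.comp_apply, LinearEquiv.coe_coe, LinearMap.proj_apply]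
  · rw [hL ![1, 0, 0, 0] 1 (by simp [biquadraticMap_apply])]; rfl
  · rw [hL ![0, 1, 0, 0] α (by simp [biquadraticMap_apply])]; rfl
  · rw [hL ![0, 0, 1, 0] β (by simp [biquadraticMap_apply])]; rfl
  · rw [hL ![0, 0, 0, 1] (α * β) (by simp [biquadraticMap_apply])]; rfl

theorem exists_common_scalar (S : Subfield K) (hS : ∀ x : K, x ^ 2 ∈ S) {x₀ y₀ x₁ y₁ : K}
    (h0 : x₀ * y₀ ∈ S) (h1 : x₁ * y₁ ∈ S) (h : x₀ * y₁ + x₁ * y₀ = 1) :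
    ∃ κ : K, κ ≠ 0 ∧ x₀ / κ ∈ S ∧ y₀ / κ ∈ S ∧ x₁ / κ ∈ S ∧ y₁ / κ ∈ S := by
  suffices ∃ κ : K, κ ≠ 0 ∧ x₀ * κ ∈ S ∧ y₀ * κ ∈ S ∧ x₁ * κ ∈ S ∧ y₁ * κ ∈ S by
    obtain ⟨κ, hκ, h⟩ := this
    have hd : ∀ x, x * κ ∈ S → x / κ ∈ S := fun x hx => by
      have : x / κ = x * κ / κ ^ 2 := by field_simp
      rw [this]
      exact S.div_mem hx (hS κ)
    exact ⟨κ, hκ, hd _ h.1, hd _ h.2.1, hd _ h.2.2.1, hd _ h.2.2.2⟩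
  by_cases hx₀ : x₀ = 0
  · subst hx₀
    have hy₀ : y₀ ≠ 0 := by rintro rfl; simp at h
    have hx₁ : x₁ ≠ 0 := by rintro rfl; simp at h
    have h' : x₁ * y₀ = 1 := by simpa using h
    refine ⟨y₀, hy₀, by simp [S.zero_mem], by rw [← _root_.sq]; exact hS _, by
      rw [h']; exact S.one_mem, ?_⟩
    have : y₁ * y₀ = x₁ * y₁ / x₁ ^ 2 := by
      field_simp
      linear_combination y₁ * h'
    rw [this]
    exact S.div_mem h1 (hS _)
  · have hy : ∀ x y : K, x ≠ 0 → y = x * (x * y / x ^ 2) := fun x y hx => by field_simp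
    have hxx : x₁ * x₀ ∈ S := by
      by_cases hx₁ : x₁ = 0
      · simp [hx₁, S.zero_mem]
      · have h2 : x₁ * x₀ * (x₁ * y₁ / x₁ ^ 2 + x₀ * y₀ / x₀ ^ 2) = 1 := by
          rw [← h]; field_simp
        rw [eq_inv_of_mul_eq_one_left h2]
        exact S.inv_mem (S.add_mem (S.div_mem h1 (hS _)) (S.div_mem h0 (hS _)))
    refine ⟨x₀, hx₀, by rw [← _root_.sq]; exact hS _, by rw [mul_comm]; exact h0, hxx, ?_⟩
    have : y₁ * x₀ = 1 - x₁ * x₀ * (x₀ * y₀ / x₀ ^ 2) := by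
      field_simp
      linear_combination h
    rw [this]
    exact S.sub_mem S.one_mem (S.mul_mem hxx (S.div_mem h0 (hS _)))

end Biquadratic

section NormalForm

variable {F : Type} [Field F] [CharP F 2] {K : Type} [Field K] [Algebra F K]
  {a b u v a' b' u' v' s t : F} {α β α' β' σ τ : K}

theorem IsBiquadratic.exists_sq_mem (hK : IsBiquadratic u v α β) (e : K) :
    ∃ d : F, e ^ 2 = algebraMap F K d := by
  obtain ⟨_, _, _, _, h⟩ := hK.exists_sq_eq e
  exact ⟨_, h⟩

/-- Up to a scalar of `K`, the plane `[a', b']` is the image of `[a, b]` modulo squares of `K`. -/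
theorem PointTransfer.exists_comparison (H : PointTransfer a' b' u' v' a b u v)
    (hK : IsBiquadratic u v α β) (hab : AvoidsBilin a b u v) :
    ∃ (κ l₀ l₁ : K) (x₀ y₀ x₁ y₁ : F), κ ≠ 0 ∧
      algebraMap F K a' = κ ^ 2 * algebraMap F K (a * x₀ ^ 2 + x₀ * y₀ + b * y₀ ^ 2) + l₀ ^ 2 ∧
      algebraMap F K b' = κ ^ 2 * algebraMap F K (a * x₁ ^ 2 + x₁ * y₁ + b * y₁ ^ 2) + l₁ ^ 2 ∧
      κ ^ 2 * algebraMap F K (x₀ * y₁ + x₁ * y₀) = 1 := by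
  have : CharP K 2 := charP_of_injective_algebraMap (algebraMap F K).injective 2
  obtain ⟨x₀, y₀, l₀, x₁, y₁, l₁, h0, h1, h2⟩ := H.exists_constant_representation
    (algebraMap F K) hK.sq_left hK.sq_right (fun x y z h => hK.eq_zero_of_eq_sq hab h)
    (x := 1) (y := RatFunc.X) (z₀ := 1) (z₁ := 0) (z₂ := 0) (by simp) (by simp)
    (algebraMap F K a') 1 (algebraMap F K b') (by simp only [map_one]; ring)
  have hS : ∀ x : K, x ^ 2 ∈ (algebraMap F K).fieldRange := fun x => by
    obtain ⟨d, hd⟩ := hK.exists_sq_mem x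
    exact ⟨d, hd.symm⟩
  have hmem : ∀ x : F, algebraMap F K x ∈ (algebraMap F K).fieldRange := fun x => ⟨x, rfl⟩
  have hprod : ∀ (c : F) (x y l : K), algebraMap F K c = algebraMap F K a * x ^ 2 + x * y +
      algebraMap F K b * y ^ 2 + l ^ 2 → x * y ∈ (algebraMap F K).fieldRange := fun c x y l h => by
    have : x * y = algebraMap F K c - algebraMap F K a * x ^ 2 - algebraMap F K b * y ^ 2 - l ^ 2 := by
      rw [h]; ring
    rw [this]
    exact sub_mem (sub_mem (sub_mem (hmem c) (mul_mem (hmem a) (hS x))) (mul_mem (hmem b) (hS y)))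
      (hS l)
  obtain ⟨κ, hκ, ⟨e₀, he₀⟩, ⟨f₀, hf₀⟩, ⟨e₁, he₁⟩, ⟨f₁, hf₁⟩⟩ := exists_common_scalar
    (algebraMap F K).fieldRange hS (hprod _ _ _ _ h0) (hprod _ _ _ _ h2) h1.symm
  rw [eq_div_iff hκ] at he₀ hf₀ he₁ hf₁
  refine ⟨κ, l₀, l₁, e₀, f₀, e₁, f₁, hκ, ?_, ?_, ?_⟩
  · rw [h0, ← he₀, ← hf₀]
    simp only [map_add, map_mul, map_pow]
    ring
  · rw [h2, ← he₁, ← hf₁]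
    simp only [map_add, map_mul, map_pow]
    ring
  · rw [h1, ← he₀, ← hf₀, ← he₁, ← hf₁]
    simp only [map_add, map_mul]
    ring

/-- The scalar in the comparison can be moved out of any given `F`-line of `K`. -/
theorem PointTransfer.exists_comparison_notMem (H : PointTransfer a' b' u' v' a b u v)
    (hK : IsBiquadratic u v α β) (hab : AvoidsBilin a b u v) (huv : AnisotropicBilin u v)
    {δ : K} (hδ : δ ≠ 0) :
    ∃ (κ l₀ l₁ : K) (x₀ y₀ x₁ y₁ : F), κ ≠ 0 ∧ (∀ x : F, δ / κ ≠ algebraMap F K x) ∧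
      algebraMap F K a' = κ ^ 2 * algebraMap F K (a * x₀ ^ 2 + x₀ * y₀ + b * y₀ ^ 2) + l₀ ^ 2 ∧
      algebraMap F K b' = κ ^ 2 * algebraMap F K (a * x₁ ^ 2 + x₁ * y₁ + b * y₁ ^ 2) + l₁ ^ 2 ∧
      κ ^ 2 * algebraMap F K (x₀ * y₁ + x₁ * y₀) = 1 := by
  have : CharP K 2 := charP_of_injective_algebraMap (algebraMap F K).injective 2
  obtain ⟨κ, l₀, l₁, x₀, y₀, x₁, y₁, hκ, h0, h1, h2⟩ := H.exists_comparison hK hab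
  by_cases hσ : ∀ x : F, δ / κ ≠ algebraMap F K x
  · exact ⟨κ, l₀, l₁, x₀, y₀, x₁, y₁, hκ, hσ, h0, h1, h2⟩
  push Not at hσ
  obtain ⟨w, hw⟩ := hσ
  have hw0 : algebraMap F K w ≠ 0 := by rw [← hw]; exact div_ne_zero hδ hκ
  have hαF : ∀ x : F, α ≠ algebraMap F K x := fun x hx => by
    have := IsBiquadratic.coords_eq_zero huv hK.sq_left hK.sq_right (x₀ := x) (x₁ := 1) (x₂ := 0)
      (x₃ := 0) (by rw [← hx]; simp; grind)
    exact one_ne_zero this.2.1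
  obtain ⟨f, hf⟩ : ∃ f, f = a' * u + b' := ⟨_, rfl⟩
  obtain ⟨D, hD⟩ : ∃ D, D = α + algebraMap F K f := ⟨_, rfl⟩
  have hDF : ∀ x : F, D ≠ algebraMap F K x := fun x hx =>
    hαF (x - f) (by rw [map_sub, ← hx, hD]; ring)
  have hD0 : D ≠ 0 := fun h => hDF 0 (by rw [h, map_zero])
  have hD2 : D ^ 2 = algebraMap F K (u + f ^ 2) := by
    rw [hD, map_add, map_pow, ← hK.sq_left]
    grind
  refine ⟨κ / D, (algebraMap F K f * l₀ + l₁) / D, (algebraMap F K u * l₀ + algebraMap F K f * l₁) / D,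
    f * x₀ + x₁, f * y₀ + y₁, u * x₀ + f * x₁, u * y₀ + f * y₁, div_ne_zero hκ hD0, ?_, ?_, ?_, ?_⟩
  · intro x hx
    apply hDF (x / w)
    rw [map_div₀, ← hx, ← hw]
    field_simp
  · have : algebraMap F K a' * D ^ 2 = κ ^ 2 * algebraMap F K (a * (f * x₀ + x₁) ^ 2 +
        (f * x₀ + x₁) * (f * y₀ + y₁) + b * (f * y₀ + y₁) ^ 2) + (algebraMap F K f * l₀ + l₁) ^ 2 := by
      have hf' : algebraMap F K f = algebraMap F K a' * algebraMap F K u + algebraMap F K b' := by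
        rw [hf, map_add, map_mul]
      rw [hD2]
      simp only [map_add, map_mul, map_pow] at h0 h1 h2 ⊢
      clear hw hw0 hD hDF hD0 hD2 hαF hf hκ hδ H hab huv hK
      generalize algebraMap F K a = A at *
      grind
    rw [div_pow, div_pow, div_mul_eq_mul_div, ← add_div, eq_div_iff (pow_ne_zero 2 hD0)]
    exact this
  · have : algebraMap F K b' * D ^ 2 = κ ^ 2 * algebraMap F K (a * (u * x₀ + f * x₁) ^ 2 +
        (u * x₀ + f * x₁) * (u * y₀ + f * y₁) + b * (u * y₀ + f * y₁) ^ 2) + (algebraMap F K u * l₀ + algebraMap F K f * l₁) ^ 2 := by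
      have hf' : algebraMap F K f = algebraMap F K a' * algebraMap F K u + algebraMap F K b' := by
        rw [hf, map_add, map_mul]
      rw [hD2]
      simp only [map_add, map_mul, map_pow] at h0 h1 h2 ⊢
      clear hw hw0 hD hDF hD0 hD2 hαF hf hκ hδ H hab huv hK
      generalize algebraMap F K a = A at *
      grind
    rw [div_pow, div_pow, div_mul_eq_mul_div, ← add_div, eq_div_iff (pow_ne_zero 2 hD0)]
    exact this
  · have : κ ^ 2 * algebraMap F K ((f * x₀ + x₁) * (u * y₀ + f * y₁) +
        (u * x₀ + f * x₁) * (f * y₀ + y₁)) = D ^ 2 := by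
      rw [hD2]
      simp only [map_add, map_mul, map_pow] at h2 ⊢
      clear hw hw0 hD hDF hD0 hD2 hαF hf hκ hδ H hab huv hK
      grind
    rw [div_pow, div_mul_eq_mul_div, div_eq_one_iff_eq (pow_ne_zero 2 hD0)]
    exact this

end NormalForm

section NormalForm

variable {F : Type} [Field F] [CharP F 2] {K : Type} [Field K] [Algebra F K]
  {a b u v a' b' u' v' s t : F} {α β α' β' σ τ : K}

theorem exists_ne_zero_of_functionals {m n : ℕ} (hmn : m < n) (f : Fin m → (Fin n → F) →ₗ[F] F) :
    ∃ x : Fin n → F, x ≠ 0 ∧ ∀ i, f i x = 0 := by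
  have h := LinearMap.ker_ne_bot_of_finrank_lt (f := LinearMap.pi f) (by simpa using hmn)
  obtain ⟨x, hx, hx0⟩ := (Submodule.ne_bot_iff _).mp h
  exact ⟨x, hx0, fun i => congrFun hx i⟩

theorem IsBiquadratic.ne_algebraMap (huv : AnisotropicBilin u v) (hα : α ^ 2 = algebraMap F K u)
    (hβ : β ^ 2 = algebraMap F K v) (x : F) : α ≠ algebraMap F K x := by
  have : CharP K 2 := charP_of_injective_algebraMap (algebraMap F K).injective 2
  intro hx
  have := IsBiquadratic.coords_eq_zero huv hα hβ (x₀ := x) (x₁ := 1) (x₂ := 0)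
    (x₃ := 0) (by rw [← hx]; simp; grind)
  exact one_ne_zero this.2.1

theorem anisotropicBilin_of_notMem (hs : σ ^ 2 = algebraMap F K s) (ht : τ ^ 2 = algebraMap F K t)
    (hσ : ∀ x : F, σ ≠ algebraMap F K x)
    (hτ : ∀ x y : F, τ ≠ algebraMap F K x + algebraMap F K y * σ) : AnisotropicBilin s t := by
  have : CharP K 2 := charP_of_injective_algebraMap (algebraMap F K).injective 2
  refine anisotropicBilin_of_ternary fun z₀ z₁ z₂ h => ?_
  have h1 : algebraMap F K z₀ + algebraMap F K z₁ * σ + algebraMap F K z₂ * τ = 0 := by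
    have h2 := congrArg (algebraMap F K) h
    simp only [map_add, map_mul, map_pow, ← hs, ← ht, map_zero] at h2
    refine pow_eq_zero_iff two_ne_zero |>.mp ?_
    grind
  have hz₂ : z₂ = 0 := by
    by_contra hz
    have hz' : algebraMap F K z₂ ≠ 0 := by simpa using hz
    refine hτ (-z₀ / z₂) (-z₁ / z₂) ?_
    rw [map_div₀, map_div₀, map_neg, map_neg]
    field_simp
    linear_combination h1
  subst hz₂
  have hz₁ : z₁ = 0 := by
    by_contra hz
    have hz' : algebraMap F K z₁ ≠ 0 := by simpa using hz
    refine hσ (-z₀ / z₁) ?_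
    rw [map_div₀, map_neg]
    field_simp
    rw [map_zero] at h1
    linear_combination h1
  subst hz₁
  exact ⟨by simpa using h1, rfl, rfl⟩

/-- A hyperplane of `K` is spanned by `k, kσ, kτ` for suitable `k` and `τ`, for given `σ ∉ F`. -/
theorem IsBiquadratic.exists_hyperplane_basis (hK : IsBiquadratic u v α β)
    (huv : AnisotropicBilin u v) (T : K →ₗ[F] F) (h1 : T 1 = 0) (hα : T α = 0) (hβ : T β = 0)
    (hαβ : T (α * β) = 1) (hσ : ∀ x : F, σ ≠ algebraMap F K x) :
    ∃ (k τ : K) (s t : F) (w : Fin 3 → K →ₗ[F] F), k ≠ 0 ∧ σ ^ 2 = algebraMap F K s ∧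
      τ ^ 2 = algebraMap F K t ∧ AnisotropicBilin s t ∧ IsBiquadratic s t σ τ ∧
      ∀ n, T n = 0 → n = k * (algebraMap F K (w 0 n) + algebraMap F K (w 1 n) * σ +
        algebraMap F K (w 2 n) * τ) := by
  have : CharP K 2 := charP_of_injective_algebraMap (algebraMap F K).injective 2
  have hT : ∀ (x : F) (e : K), T (algebraMap F K x * e) = x * T e := fun x e => by
    rw [← Algebra.smul_def, map_smul, smul_eq_mul]
  have hα0 : α ≠ 0 := by
    have := IsBiquadratic.ne_algebraMap huv hK.sq_left hK.sq_right 0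
    rwa [map_zero] at this
  obtain ⟨k, hk, hkT, hkσ⟩ : ∃ k : K, k ≠ 0 ∧ T k = 0 ∧ T (k * σ) = 0 := by
    obtain ⟨x₀, x₁, x₂, x₃, hx⟩ := hK.exists_coords σ
    have hk : ∀ y₁ y₂ : F, T (algebraMap F K y₁ * α + algebraMap F K y₂ * β) = 0 := fun y₁ y₂ => by
      rw [map_add, hT, hT, hα, hβ]; ring
    have hkσ : ∀ y₁ y₂ : F, T ((algebraMap F K y₁ * α + algebraMap F K y₂ * β) * σ) =
        y₁ * x₂ + y₂ * x₁ := fun y₁ y₂ => by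
      have : (algebraMap F K y₁ * α + algebraMap F K y₂ * β) * σ =
          algebraMap F K (y₁ * x₁ * u + y₂ * x₂ * v) * 1 + algebraMap F K (y₁ * x₀ + y₂ * x₃ * v) * α +
          algebraMap F K (y₂ * x₀ + y₁ * x₃ * u) * β +
          algebraMap F K (y₁ * x₂ + y₂ * x₁) * (α * β) := by
        rw [hx]
        simp only [map_add, map_mul, ← hK.sq_left, ← hK.sq_right]
        ring
      rw [this, map_add, map_add, map_add, hT, hT, hT, hT, h1, hα, hβ, hαβ]
      ring
    by_cases hx0 : x₁ = 0 ∧ x₂ = 0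
    · exact ⟨_, by simpa using hα0, hk 1 0, by rw [hkσ, hx0.1, hx0.2]; ring⟩
    · refine ⟨_, fun h => hx0 ?_, hk x₁ x₂, by rw [hkσ, mul_comm x₂ x₁]; exact CharTwo.add_self_eq_zero _⟩
      have := IsBiquadratic.coords_eq_zero huv hK.sq_left hK.sq_right (x₀ := 0) (x₁ := x₁)
        (x₂ := x₂) (x₃ := 0) (by rw [← h]; simp)
      exact ⟨this.2.1, this.2.2.1⟩
  obtain ⟨τ, hkτ, hτ⟩ : ∃ τ : K, T (k * τ) = 0 ∧
      ∀ x y : F, τ ≠ algebraMap F K x + algebraMap F K y * σ := by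
    by_contra hcon
    push Not at hcon
    have hm : ∀ m : K, T m = 0 → ∃ x y : F, m = k * (algebraMap F K x + algebraMap F K y * σ) := by
      intro m hm
      obtain ⟨x, y, h⟩ := hcon (m / k) (by rwa [mul_div_cancel₀ _ hk])
      exact ⟨x, y, by rw [← h, mul_div_cancel₀ _ hk]⟩
    obtain ⟨p₀, q₀, h0⟩ := hm 1 h1
    obtain ⟨p₁, q₁, h1⟩ := hm α hα
    obtain ⟨p₂, q₂, h2⟩ := hm β hβ
    obtain ⟨x, hx, hx0⟩ := exists_ne_zero_of_functionals (F := F) (m := 2) (n := 3) (by norm_num)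
      ![p₀ • LinearMap.proj 0 + p₁ • LinearMap.proj 1 + p₂ • LinearMap.proj 2,
        q₀ • LinearMap.proj 0 + q₁ • LinearMap.proj 1 + q₂ • LinearMap.proj 2]
    have hp := hx0 0
    have hq := hx0 1
    simp at hp hq
    have := IsBiquadratic.coords_eq_zero huv hK.sq_left hK.sq_right (x₀ := x 0) (x₁ := x 1)
        (x₂ := x 2) (x₃ := 0) (by
      have hp' := congrArg (algebraMap F K) hp
      have hq' := congrArg (algebraMap F K) hq
      simp only [map_add, map_mul, map_zero] at hp' hq' ⊢
      linear_combination algebraMap F K (x 0) * h0 + algebraMap F K (x 1) * h1 +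
        algebraMap F K (x 2) * h2 + k * hp' + k * σ * hq')
    apply hx
    ext i
    fin_cases i
    exacts [this.1, this.2.1, this.2.2.1]
  obtain ⟨s, hs⟩ := hK.exists_sq_mem σ
  obtain ⟨t, ht⟩ := hK.exists_sq_mem τ
  have hst := anisotropicBilin_of_notMem hs ht hσ hτ
  have hL := hK.of_sq_eq huv hst hs ht
  obtain ⟨c, hc, -⟩ := hL.exists_coord_functionals hst
  have hTστ : T (k * (σ * τ)) ≠ 0 := by
    intro h
    obtain ⟨x₀, x₁, x₂, x₃, hx⟩ := hL.exists_coords (α * β / k)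
    have : α * β = algebraMap F K x₀ * k + algebraMap F K x₁ * (k * σ) +
        algebraMap F K x₂ * (k * τ) + algebraMap F K x₃ * (k * (σ * τ)) := by
      rw [div_eq_iff hk] at hx
      rw [hx]; ring
    rw [this, map_add, map_add, map_add, hT, hT, hT, hT, hkT, hkσ, hkτ, h] at hαβ
    simp at hαβ
  refine ⟨k, τ, s, t, fun i => c i.castSucc ∘ₗ LinearMap.mulLeft F k⁻¹, hk, hs, ht, hst, hL, ?_⟩
  intro n hn
  have h := hc (k⁻¹ * n)
  have hn' : n = algebraMap F K (c 0 (k⁻¹ * n)) * k + algebraMap F K (c 1 (k⁻¹ * n)) * (k * σ) +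
      algebraMap F K (c 2 (k⁻¹ * n)) * (k * τ) + algebraMap F K (c 3 (k⁻¹ * n)) * (k * (σ * τ)) := by
    have : n = k * (k⁻¹ * n) := by field_simp
    conv_lhs => rw [this, h]
    ring
  have h3 : c 3 (k⁻¹ * n) = 0 := by
    have := congrArg T hn'
    rw [hn, map_add, map_add, map_add, hT, hT, hT, hT, hkT, hkσ, hkτ] at this
    simpa [hTστ] using this.symm
  rw [h3] at hn'
  simp only [LinearMap.comp_apply, LinearMap.mulLeft_apply]
  change n = k * (algebraMap F K (c 0 (k⁻¹ * n)) + algebraMap F K (c 1 (k⁻¹ * n)) * σ +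
    algebraMap F K (c 2 (k⁻¹ * n)) * τ)
  conv_lhs => rw [hn', map_zero]
  ring

end NormalForm

section NormalForm

variable {F : Type} [Field F] [CharP F 2] {K : Type} [Field K] [Algebra F K]
  {a b u v a' b' u' v' s t : F} {α β α' β' σ τ : K}

theorem SimilarQF.of_hyperplane_coords {Q : QuadraticForm F (Fin 5 → F)} (hQ : Q.Anisotropic)
    {k : K} (T : K →ₗ[F] F) (w : Fin 3 → K →ₗ[F] F)
    (hw : ∀ n, T n = 0 → n = k * (algebraMap F K (w 0 n) + algebraMap F K (w 1 n) * σ +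
        algebraMap F K (w 2 n) * τ)) (hs : σ ^ 2 = algebraMap F K s) (ht : τ ^ 2 = algebraMap F K t)
    {d c r : F} (hd : k ^ 2 = algebraMap F K d) (hk : k ≠ 0) (hc : c ≠ 0)
    (X Y : (Fin 5 → F) →ₗ[F] F) (N : (Fin 5 → F) →ₗ[F] K) (hN : ∀ x, T (N x) = 0)
    (h : ∀ x, algebraMap F K (Q x) = algebraMap F K c *
      (algebraMap F K (r * (a * X x ^ 2 + X x * Y x + b * Y x ^ 2)) + N x ^ 2)) :
    SimilarQF Q (form5 (r * (a / d)) r (r * (b * d)) 1 s t) := by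
  have : CharP K 2 := charP_of_injective_algebraMap (algebraMap F K).injective 2
  have hd0 : d ≠ 0 := by
    rintro rfl
    simp [hk] at hd
  refine SimilarQF.of_linear hQ
    (LinearMap.pi ![X, d⁻¹ • Y, w 0 ∘ₗ N, w 1 ∘ₗ N, w 2 ∘ₗ N]) (mul_ne_zero hc hd0) fun x => ?_
  apply (algebraMap F K).injective
  rw [h, form5_apply]
  have hsq : N x ^ 2 = algebraMap F K (d * (w 0 (N x) ^ 2 + s * w 1 (N x) ^ 2 + t * w 2 (N x) ^ 2)) := by
    have h1 := hw _ (hN x)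
    generalize w 0 (N x) = w₀ at *
    generalize w 1 (N x) = w₁ at *
    generalize w 2 (N x) = w₂ at *
    rw [h1]
    simp only [map_add, map_mul, map_pow, ← hs, ← ht, ← hd]
    clear hw h hN h1
    grind
  rw [hsq, ← map_add, ← map_mul]
  congr 1
  simp
  field_simp
  ring

theorem SimilarQF.exists_normal_form (hφ : (form5 a 1 b 1 u v).Anisotropic)
    (hψ : (form5 a' 1 b' 1 u' v').Anisotropic) (hab : AvoidsBilin a b u v)
    (H : PointTransfer a' b' u' v' a b u v) :
    ∃ A B s t : F, AnisotropicBilin s t ∧ AvoidsBilin A B s t ∧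
      SimilarQF (form5 a' 1 b' 1 u' v') (form5 A 1 B 1 s t) ∧
      SimilarQF (form5 a 1 b 1 u v) (form5 (s * A) s (s * B) 1 s t) := by
  have huv : AnisotropicBilin u v := anisotropicBilin_of_ternary fun z₀ z₁ z₂ h =>
    (form5_anisotropic hφ (x := 0) (y := 0) (by linear_combination h)).2.2
  have huv' : AnisotropicBilin u' v' := anisotropicBilin_of_ternary fun z₀ z₁ z₂ h =>
    (form5_anisotropic hψ (x := 0) (y := 0) (by linear_combination h)).2.2
  obtain ⟨K, _, _, α, β, hK⟩ := exists_isBiquadratic huv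
  have : CharP K 2 := charP_of_injective_algebraMap (algebraMap F K).injective 2
  have hq : ∀ x y z : K, algebraMap F K a * x ^ 2 + x * y + algebraMap F K b * y ^ 2 = z ^ 2 →
      x = 0 ∧ y = 0 := fun x y z h => hK.eq_zero_of_eq_sq hab h
  obtain ⟨α', hα'⟩ := H.exists_sq_eq (algebraMap F K) hK.sq_left hK.sq_right hq
  obtain ⟨β', hβ'⟩ := H.swap.exists_sq_eq (algebraMap F K) hK.sq_left hK.sq_right hq
  have hK' : IsBiquadratic u' v' α' β' := hK.of_sq_eq huv huv' hα' hβ'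
  obtain ⟨c, -, h1, hTα, hTβ, hTαβ⟩ := hK'.exists_coord_functionals huv'
  obtain ⟨T, hT⟩ : ∃ T, T = c 3 := ⟨_, rfl⟩
  rw [← hT] at h1 hTα hTβ hTαβ
  clear hT c
  have hTm : ∀ (x : F) (e : K), T (algebraMap F K x * e) = x * T e := fun x e => by
    rw [← Algebra.smul_def, map_smul, smul_eq_mul]
  obtain ⟨δ, hδ, hδ0, hδ1, hδ2⟩ : ∃ δ : K, δ ≠ 0 ∧ T δ = 0 ∧ T (δ * α) = 0 ∧ T (δ * β) = 0 := by
    obtain ⟨x, hx, hx0⟩ := exists_ne_zero_of_functionals (F := F) (m := 3) (n := 4) (by norm_num)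
      ![T ∘ₗ biquadraticMap F α β, T ∘ₗ LinearMap.mulRight F α ∘ₗ biquadraticMap F α β,
        T ∘ₗ LinearMap.mulRight F β ∘ₗ biquadraticMap F α β]
    refine ⟨biquadraticMap F α β x, ?_, hx0 0, hx0 1, hx0 2⟩
    rw [Ne, map_eq_zero_iff _ (huv.biquadraticMap_injective hK.sq_left hK.sq_right)]
    exact hx
  obtain ⟨κ, l₀, l₁, x₀, y₀, x₁, y₁, hκ, hσ, e0, e1, e2⟩ := H.exists_comparison_notMem hK hab huv hδ
  obtain ⟨σ, hσκ⟩ : ∃ σ, σ = δ / κ := ⟨_, rfl⟩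
  rw [← hσκ] at hσ
  obtain ⟨k, τ, s, t, w, hk, hs, ht, hst, hL, hw⟩ :=
    hK'.exists_hyperplane_basis huv' T h1 hTα hTβ hTαβ hσ
  obtain ⟨h, hTh, hTσh⟩ : ∃ h : K, T h = 0 ∧ T (σ * h) ≠ 0 := by
    by_contra hcon
    push Not at hcon
    obtain ⟨s₀, s₁, s₂, s₃, hsx⟩ := hK'.exists_coords σ
    have t0 := hcon 1 h1
    have t1 := hcon α' hTα
    have t2 := hcon β' hTβ
    have i0 : s₃ = 0 := by
      have : σ * 1 = algebraMap F K s₀ * 1 + algebraMap F K s₁ * α' +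
        algebraMap F K s₂ * β' + algebraMap F K s₃ * (α' * β') := by rw [hsx]; ring
      rw [this, map_add, map_add, map_add, hTm, hTm, hTm, hTm, h1, hTα, hTβ, hTαβ] at t0
      simpa using t0
    subst i0
    have i1 : s₂ = 0 := by
      have : σ * α' = algebraMap F K s₀ * α' + algebraMap F K (s₁ * u') * 1 +
        algebraMap F K s₂ * (α' * β') := by rw [hsx, map_mul, ← hα', map_zero]; ring
      rw [this, map_add, map_add, hTm, hTm, hTm, h1, hTα, hTαβ] at t1
      simpa using t1
    subst i1
    have i2 : s₁ = 0 := by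
      have : σ * β' = algebraMap F K s₀ * β' + algebraMap F K s₁ * (α' * β') := by
        rw [hsx, map_zero]; ring
      rw [this, map_add, hTm, hTm, hTβ, hTαβ] at t2
      simpa using t2
    exact hσ s₀ (by rw [hsx, i2, map_zero]; ring)
  obtain ⟨hh, hhh⟩ := hK.exists_sq_mem h
  obtain ⟨d, hd⟩ := hK.exists_sq_mem k
  obtain ⟨D, hD⟩ := hK.exists_sq_mem δ
  have hd0 : d ≠ 0 := by
    rintro rfl
    simp [hk] at hd
  have hD0 : D ≠ 0 := by
    rintro rfl
    simp [hδ] at hD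
  obtain ⟨m₀, hm₀⟩ : ∃ m, m = T (σ * l₀) / T (σ * h) := ⟨_, rfl⟩
  obtain ⟨m₁, hm₁⟩ : ∃ m, m = T (σ * l₁) / T (σ * h) := ⟨_, rfl⟩
  rw [eq_div_iff hTσh] at hm₀ hm₁
  obtain ⟨e, he⟩ : ∃ e, e = x₀ * y₁ + x₁ * y₀ := ⟨_, rfl⟩
  rw [← he] at e2
  have he0 : e ≠ 0 := by
    rintro h
    rw [h, map_zero, mul_zero] at e2
    exact zero_ne_one e2
  have hsD : algebraMap F K s * κ ^ 2 = algebraMap F K D := by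
    rw [← hs, ← hD, hσκ]
    field_simp
  have hq' : ∀ x y : F, algebraMap F K (a' * x ^ 2 + x * y + b' * y ^ 2) =
      κ ^ 2 * algebraMap F K (a * (x₀ * x + x₁ * y) ^ 2 + (x₀ * x + x₁ * y) * (y₀ * x + y₁ * y) +
        b * (y₀ * x + y₁ * y) ^ 2) + (l₀ * algebraMap F K x + l₁ * algebraMap F K y) ^ 2 := by
    intro x y
    rw [he] at e2
    simp only [map_add, map_mul, map_pow] at e0 e1 e2 ⊢
    rw [e0, e1]
    clear hw hq hL hab H hTm hm₀ hm₁ hsD he hσ e0 e1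
    grind
  refine ⟨(a' + hh * m₀ ^ 2) / d, (b' + hh * m₁ ^ 2) * d, s, t, hst, ?_, ?_, ?_⟩
  · intro x y z₀ z₁ z₂ z₃ h0
    have h1 : a' * x ^ 2 + x * (d * y) + b' * (d * y) ^ 2 + hh * (m₀ * x + m₁ * (d * y)) ^ 2 =
        d * (z₀ ^ 2 + s * z₁ ^ 2 + t * z₂ ^ 2 + s * t * z₃ ^ 2) := by
      rw [← h0]
      field_simp
      clear hw hq hL hab H hTm hm₀ hm₁ hsD he hσ e0 e1
      grind
    obtain ⟨e', he'⟩ : ∃ e' : K, algebraMap F K (a' * x ^ 2 + x * (d * y) + b' * (d * y) ^ 2) =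
        e' ^ 2 := by
      refine ⟨k * (algebraMap F K z₀ + algebraMap F K z₁ * σ + algebraMap F K z₂ * τ +
        algebraMap F K z₃ * (σ * τ)) + h * algebraMap F K (m₀ * x + m₁ * (d * y)), ?_⟩
      rw [eq_sub_of_add_eq h1]
      simp only [map_add, map_mul, map_pow, map_sub, ← hd, ← hs, ← ht, ← hhh]
      clear hw hq hL hab H hTm hm₀ hm₁ hsD he hσ e0 e1
      grind
    rw [hq'] at he'
    obtain ⟨h2, h3⟩ := hq (algebraMap F K (x₀ * x + x₁ * (d * y)))
      (algebraMap F K (y₀ * x + y₁ * (d * y)))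
      ((e' + (l₀ * algebraMap F K x + l₁ * algebraMap F K (d * y))) / κ) (by
        rw [div_pow, eq_div_iff (pow_ne_zero 2 hκ)]
        simp only [map_add, map_mul, map_pow] at he' ⊢
        clear hw hq hL hab H hTm hm₀ hm₁ hsD he hσ e0 e1
        grind)
    rw [map_eq_zero] at h2 h3
    have h4 : e * x = 0 := by
      rw [he]
      clear hw hq hL hab H hTm hm₀ hm₁ hsD hσ e0 e1 he'
      grind
    have h5 : e * (d * y) = 0 := by
      rw [he]
      clear hw hq hL hab H hTm hm₀ hm₁ hsD hσ e0 e1 he'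
      grind
    simp only [mul_eq_zero, he0, hd0, false_or] at h4 h5
    exact ⟨h4, h5⟩
  · have := SimilarQF.of_hyperplane_coords (a := a' + hh * m₀ ^ 2) (b := b' + hh * m₁ ^ 2) hψ T w hw
      hs ht hd hk (c := 1) (r := 1) one_ne_zero (LinearMap.proj 0) (LinearMap.proj 1)
      ((LinearMap.proj 0 : (Fin 5 → F) →ₗ[F] F).smulRight (m₀ • h) +
        (LinearMap.proj 1 : (Fin 5 → F) →ₗ[F] F).smulRight (m₁ • h) +
        (LinearMap.proj 2 : (Fin 5 → F) →ₗ[F] F).smulRight 1 +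
        (LinearMap.proj 3 : (Fin 5 → F) →ₗ[F] F).smulRight α' +
        (LinearMap.proj 4 : (Fin 5 → F) →ₗ[F] F).smulRight β')
      (fun x => by simp [hTh, h1, hTα, hTβ]) (fun x => by
        simp only [form5_apply, LinearMap.add_apply, LinearMap.smulRight_apply, LinearMap.proj_apply,
          Algebra.smul_def, map_add, map_mul, map_pow, map_one, ← hα', ← hβ', ← hhh]
        clear hw hq hL hab H hTm hm₀ hm₁ hsD he hσ e0 e1
        grind)
    simpa only [one_mul] using this
  · obtain ⟨X, hX⟩ : ∃ X : (Fin 5 → F) →ₗ[F] F, X = (y₁ / e) • LinearMap.proj 0 +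
      (x₁ / e) • LinearMap.proj 1 := ⟨_, rfl⟩
    obtain ⟨Y, hY⟩ : ∃ Y : (Fin 5 → F) →ₗ[F] F, Y = (y₀ / e) • LinearMap.proj 0 +
      (x₀ / e) • LinearMap.proj 1 := ⟨_, rfl⟩
    refine SimilarQF.of_hyperplane_coords (a := a' + hh * m₀ ^ 2) (b := b' + hh * m₁ ^ 2) hφ T w hw
      hs ht hd hk (c := D⁻¹) (r := s) (inv_ne_zero hD0) X Y
      (X.smulRight (σ * l₀ + m₀ • (σ * h)) + Y.smulRight (σ * l₁ + m₁ • (σ * h)) +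
        (LinearMap.proj 2 : (Fin 5 → F) →ₗ[F] F).smulRight δ +
        (LinearMap.proj 3 : (Fin 5 → F) →ₗ[F] F).smulRight (δ * α) +
        (LinearMap.proj 4 : (Fin 5 → F) →ₗ[F] F).smulRight (δ * β))
      (fun x => ?_) (fun x => ?_)
    · simp only [LinearMap.add_apply, LinearMap.smulRight_apply, LinearMap.proj_apply, map_add,
        map_smul, smul_eq_mul, hδ0, hδ1, hδ2, ← hm₀, ← hm₁]
      clear hw hq hL hab H hTm hm₀ hm₁ hsD he hσ e0 e1 hq'
      grind
    · have hX' : x₀ * X x + x₁ * Y x = x 0 := by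
        simp only [hX, hY, LinearMap.add_apply, LinearMap.smul_apply, LinearMap.proj_apply, smul_eq_mul]
        field_simp
        rw [he]
        clear hw hq hL hab H hTm hm₀ hm₁ hsD hσ e0 e1 hq' hX hY
        grind
      have hY' : y₀ * X x + y₁ * Y x = x 1 := by
        simp only [hX, hY, LinearMap.add_apply, LinearMap.smul_apply, LinearMap.proj_apply, smul_eq_mul]
        field_simp
        rw [he]
        clear hw hq hL hab H hTm hm₀ hm₁ hsD hσ e0 e1 hq' hX hY
        grind
      have h2 := hq' (X x) (Y x)
      rw [hX', hY'] at h2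
      have hD0' : algebraMap F K D ≠ 0 := by simpa using hD0
      rw [map_inv₀, inv_mul_eq_div, eq_div_iff hD0']
      simp only [form5_apply, LinearMap.add_apply, LinearMap.smulRight_apply, LinearMap.proj_apply,
        Algebra.smul_def]
      generalize X x = x' at *
      generalize Y x = y' at *
      simp only [map_add, map_mul, map_pow, map_one, ← hhh, ← hs, ← hK.sq_left, ← hK.sq_right] at h2 hsD ⊢
      clear hw hq hL hab H hTm hm₀ hm₁ he hσ e0 e1 hq' hX hY hX' hY'
      grind

end NormalForm

section PurelyInseparableNorm

variable {k : Type} [Field k]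

/-- The square of the element of `k(√s, √A)` with coordinates `p` in the basis
`1, √s, √A, √s√A`. -/
def biquadSq (s A : k) (p : Fin 4 → k) : k :=
  p 0 ^ 2 + s * p 1 ^ 2 + A * p 2 ^ 2 + s * A * p 3 ^ 2

/-- Multiplication of `k(√s, √A)` in the basis `1, √s, √A, √s√A`. -/
def biquadMul (s A : k) (p q : Fin 4 → k) : Fin 4 → k :=
  ![p 0 * q 0 + s * (p 1 * q 1) + A * (p 2 * q 2) + s * A * (p 3 * q 3),
    p 0 * q 1 + p 1 * q 0 + A * (p 2 * q 3 + p 3 * q 2),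
    p 0 * q 2 + p 2 * q 0 + s * (p 1 * q 3 + p 3 * q 1),
    p 0 * q 3 + p 3 * q 0 + p 1 * q 2 + p 2 * q 1]

/-- The form `p ^ 2 + t(p * q) + B * q ^ 2` on `k(√s, √A)²`, where `t` is the coefficient of `√A`. -/
def biquadForm (s A B : k) (p q : Fin 4 → k) : k :=
  biquadSq s A p + biquadMul s A p q 2 + B * biquadSq s A q

variable [CharP k 2] {s A B t : k}

theorem biquadSq_mul (p q : Fin 4 → k) :
    biquadSq s A (biquadMul s A p q) = biquadSq s A p * biquadSq s A q := by
  simp only [biquadSq, biquadMul, Matrix.cons_val]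
  generalize p 0 = p₀, p 1 = p₁, p 2 = p₂, p 3 = p₃, q 0 = q₀, q 1 = q₁, q 2 = q₂, q 3 = q₃
  grind

/-- If `[A, B] ⊥ s[A, B]` avoids the values of `⟨1, s⟩`, then `biquadForm` is anisotropic. -/
theorem biquadForm_anisotropic
    (h : ∀ x₀ y₀ x₁ y₁ z₀ z₁ : k, A * x₀ ^ 2 + x₀ * y₀ + B * y₀ ^ 2 +
      s * (A * x₁ ^ 2 + x₁ * y₁ + B * y₁ ^ 2) = z₀ ^ 2 + s * z₁ ^ 2 →
      x₀ = 0 ∧ y₀ = 0 ∧ x₁ = 0 ∧ y₁ = 0) (hs : ∀ z₀ z₁ : k, z₀ ^ 2 + s * z₁ ^ 2 = 0 → z₀ = 0 ∧ z₁ = 0)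
    (p q : Fin 4 → k) (h0 : biquadForm s A B p q = 0) : p = 0 ∧ q = 0 := by
  have hN : ∀ p : Fin 4 → k, biquadSq s A p = 0 → p = 0 := fun p hp => by
    simp only [biquadSq] at hp
    obtain ⟨h2, -, h3, -⟩ := h (p 2) 0 (p 3) 0 (p 0) (p 1) (by grind)
    rw [h2, h3] at hp
    obtain ⟨h0, h1⟩ := hs (p 0) (p 1) (by linear_combination hp)
    ext i
    fin_cases i <;> assumption
  have hq : q = 0 := by
    by_contra hq
    have hn : biquadSq s A q ≠ 0 := fun h => hq (hN _ h)
    obtain ⟨r, hr⟩ : ∃ r, r = biquadMul s A p q := ⟨_, rfl⟩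
    have h1 := biquadSq_mul (s := s) (A := A) p q
    rw [biquadForm, ← hr] at h0
    rw [← hr] at h1
    generalize biquadSq s A q = n at *
    generalize biquadSq s A p = m at *
    obtain ⟨-, h2, -⟩ := h (r 2 / n) 1 (r 3 / n) 0 (r 0 / n) (r 1 / n) (by
      simp only [biquadSq] at h1
      field_simp
      clear hN h
      grind)
    exact one_ne_zero h2
  subst hq
  refine ⟨hN p ?_, rfl⟩
  simpa [biquadForm, biquadMul, biquadSq] using h0

theorem exists_biquadSq_add_coord (hN : ∀ p : Fin 4 → k, biquadSq s A p = 0 → p = 0)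
    {x₀ y₀ x₁ y₁ z₀ z₁ : k} (h0 : A * x₀ ^ 2 + x₀ * y₀ + B * y₀ ^ 2 +
      s * (A * x₁ ^ 2 + x₁ * y₁ + B * y₁ ^ 2) = z₀ ^ 2 + s * z₁ ^ 2)
    (hne : ¬(x₀ = 0 ∧ y₀ = 0 ∧ x₁ = 0 ∧ y₁ = 0)) :
    ∃ p : Fin 4 → k, biquadSq s A p + p 2 + B = 0 := by
  obtain ⟨n, hn⟩ : ∃ n, n = y₀ ^ 2 + s * y₁ ^ 2 := ⟨_, rfl⟩
  have hn0 : n ≠ 0 := by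
    rintro rfl
    have h1 := hN ![y₀, y₁, 0, 0] (by simp [biquadSq, ← hn])
    have h2 : y₀ = 0 := congrFun h1 0
    have h3 : y₁ = 0 := congrFun h1 1
    have h4 := hN ![z₀, z₁, x₀, x₁] (by
      simp only [biquadSq, Matrix.cons_val]
      clear hN
      grind)
    exact hne ⟨congrFun h4 2, h2, congrFun h4 3, h3⟩
  refine ⟨![(z₀ * y₀ + s * (z₁ * y₁)) / n, (z₀ * y₁ + z₁ * y₀) / n,
    (x₀ * y₀ + s * (x₁ * y₁)) / n, (x₀ * y₁ + x₁ * y₀) / n], ?_⟩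
  simp only [biquadSq, Matrix.cons_val]
  field_simp
  clear hN
  grind

theorem exists_biquadSq_add_coord_of_root (hN : ∀ p : Fin 4 → k, biquadSq s A p = 0 → p = 0)
    (hA : A ≠ 0) {θ z₀ z₁ z₂ x y w₀ w₁ w₂ : k}
    (hθ : θ ^ 2 + θ = A * (B + z₀ ^ 2 + s * z₁ ^ 2 + t * z₂ ^ 2)) (hxy : x ≠ 0 ∨ y ≠ 0)
    (h : s * (A * x ^ 2 + x * y + B * y ^ 2) = w₀ ^ 2 + s * w₁ ^ 2 + t * w₂ ^ 2) :
    ∃ p : Fin 4 → k, biquadSq s A p + p 2 + B = 0 := by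
  by_cases hw : w₂ = 0
  · subst hw
    exact exists_biquadSq_add_coord hN (x₀ := 0) (y₀ := 0) (x₁ := x) (y₁ := y) (z₀ := w₀) (z₁ := w₁)
      (by linear_combination h) (by tauto)
  · obtain ⟨α, hα⟩ : ∃ α, α = z₂ / w₂ := ⟨_, rfl⟩
    rw [eq_div_iff hw] at hα
    refine exists_biquadSq_add_coord hN (x₀ := θ / A) (y₀ := 1) (x₁ := α * x) (y₁ := α * y)
      (z₀ := z₀ + α * w₀) (z₁ := z₁ + α * w₁) ?_ (by simp)
    obtain ⟨η, hη⟩ : ∃ η, η = θ / A := ⟨_, rfl⟩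
    rw [← hη]
    rw [eq_div_iff hA] at hη
    have h1 : A * η ^ 2 + η = B + z₀ ^ 2 + s * z₁ ^ 2 + t * z₂ ^ 2 := by
      apply mul_left_cancel₀ hA
      rw [← hθ, ← hη]
      ring
    rw [← hα] at h1
    clear hN hθ hη hα
    grind

end PurelyInseparableNorm

section Generic

variable {F : Type} [Field F] [CharP F 2]

theorem exists_biquadForm_eq [Infinite F] {A B s t : F} (hA : A ≠ 0)
    (H : IsotropyImplies (form5 A 1 B 1 s t) (form5 (s * A) s (s * B) 1 s t)) (hs : s ≠ 0)
    {k : Type} [Field k] (f : F →+* k)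
    (hk : ∀ p q : Fin 4 → k, biquadForm (f s) (f A) (f B) p q = 0 → p = 0 ∧ q = 0) (z₀ z₁ z₂ : k) :
    ∃ p q : Fin 4 → k, biquadForm (f s) (f A) (f B) p q =
      f B + z₀ ^ 2 + f s * z₁ ^ 2 + f t * z₂ ^ 2 ∧ q 0 = 1 := by
  have : CharP k 2 := charP_of_injective_ringHom f.injective 2
  have H' : ∀ (E : Type) [Field E] (g : F →+* E) (θ z₀ z₁ z₂ : E),
      (∀ p : Fin 4 → E, biquadSq (g s) (g A) p = 0 → p = 0) →
      θ ^ 2 + θ = g A * (g B + z₀ ^ 2 + g s * z₁ ^ 2 + g t * z₂ ^ 2) →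
      ∃ p : Fin 4 → E, biquadSq (g s) (g A) p + p 2 + g B = 0 := by
    intro E _ g θ z₀ z₁ z₂ hN hθ
    have : CharP E 2 := charP_of_injective_ringHom g.injective 2
    have hgA : g A ≠ 0 := by simpa using hA
    have h1 := H E g
    rw [isNonradicallyIsotropic_form5 g one_ne_zero, isNonradicallyIsotropic_form5 g hs] at h1
    obtain ⟨x, y, w₀, w₁, w₂, hxy, h2⟩ := h1 ⟨θ / g A, 1, z₀, z₁, z₂, Or.inr one_ne_zero, by
      obtain ⟨η, hη⟩ : ∃ η, η = θ / g A := ⟨_, rfl⟩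
      rw [← hη]
      rw [eq_div_iff hgA] at hη
      have h1 : g A * η ^ 2 + η = g B + z₀ ^ 2 + g s * z₁ ^ 2 + g t * z₂ ^ 2 := by
        apply mul_left_cancel₀ hgA
        rw [← hθ, ← hη]
        ring
      rw [map_one]
      clear hN hθ hη
      grind⟩
    refine exists_biquadSq_add_coord_of_root hN hgA hθ hxy (w₀ := w₀) (w₁ := w₁) (w₂ := w₂) ?_
    simp only [map_mul, map_one] at h2
    clear hN hθ
    grind
  have hN : ∀ p : Fin 4 → k, biquadSq (f s) (f A) p = 0 → p = 0 := fun p hp =>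
    (hk p 0 (by rw [biquadForm, hp]; simp [biquadMul, biquadSq])).1
  have hB : ∀ p : Fin 4 → k, biquadSq (f s) (f A) p + p 2 + f B ≠ 0 := fun p hp => by
    have := (hk p ![1, 0, 0, 0] (by simpa [biquadForm, biquadMul, biquadSq] using hp)).2
    simpa using congrFun this 0
  obtain ⟨Δ, hΔ⟩ : ∃ Δ, Δ = f B + z₀ ^ 2 + f s * z₁ ^ 2 + f t * z₂ ^ 2 := ⟨_, rfl⟩
  by_cases hroot : ∃ θ : k, θ ^ 2 + 1 * θ + f A * Δ = 0
  · obtain ⟨θ, hθ⟩ := hroot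
    obtain ⟨p, hp⟩ := H' k f θ z₀ z₁ z₂ hN (by rw [← hΔ]; grind)
    exact absurd hp (hB p)
  · push Not at hroot
    obtain ⟨E, _, g, θ, hθ, hcoord, hinj⟩ := exists_quadratic_extension 1 (f A * Δ) hroot
    have : CharP E 2 := charP_of_injective_ringHom g.injective 2
    have hsq : ∀ p q : Fin 4 → k, biquadSq (g (f s)) (g (f A)) (fun i => g (p i) + g (q i) * θ) =
        g (biquadSq (f s) (f A) p + f A * Δ * biquadSq (f s) (f A) q) +
          g (biquadSq (f s) (f A) q) * θ := by
      intro p q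
      have hθ' : θ ^ 2 = θ + g (f A * Δ) := by
        rw [map_one] at hθ
        grind
      simp only [biquadSq, map_add, map_mul, map_pow]
      rw [map_mul] at hθ'
      clear hcoord hinj hroot hB hN hk H' hΔ H hθ
      generalize g (p 0) = p₀, g (p 1) = p₁, g (p 2) = p₂, g (p 3) = p₃, g (q 0) = q₀,
        g (q 1) = q₁, g (q 2) = q₂, g (q 3) = q₃
      grind
    have hdec : ∀ r : Fin 4 → E, ∃ p q : Fin 4 → k, r = fun i => g (p i) + g (q i) * θ := fun r => by
      choose p q h using fun i => hcoord (r i)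
      exact ⟨p, q, funext h⟩
    obtain ⟨r, hr⟩ := H' E (g.comp f) θ (g z₀) (g z₁) (g z₂) (fun r hr => by
      obtain ⟨p, q, rfl⟩ := hdec r
      simp only [RingHom.comp_apply] at hr
      rw [hsq] at hr
      obtain ⟨h1, h2⟩ := hinj _ _ hr
      have hq := hN _ h2
      rw [h2, mul_zero, add_zero] at h1
      have hp := hN _ h1
      subst hp hq
      ext i
      simp) (by
      simp only [RingHom.comp_apply]
      rw [hΔ] at hθ
      simp only [map_add, map_mul, map_pow, map_one] at hθ
      clear hcoord hinj hroot hB hN hk H' hΔ H hsq hdec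
      grind)
    obtain ⟨p, q, rfl⟩ := hdec r
    simp only [RingHom.comp_apply] at hr
    rw [hsq] at hr
    obtain ⟨h1, h2⟩ := hinj (biquadSq (f s) (f A) p + f A * Δ * biquadSq (f s) (f A) q + p 2 + f B)
      (biquadSq (f s) (f A) q + q 2) (by
        rw [← hr]
        simp only [map_add]
        ring)
    have hq2 : biquadSq (f s) (f A) q = q 2 := by grind
    have hw : q 2 ≠ 0 := by
      intro hw
      rw [hq2, hw, mul_zero, add_zero] at h1
      exact hB p h1
    have hfA : f A ≠ 0 := by simpa using hA
    rw [hq2] at h1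
    obtain ⟨ζ, hζ⟩ : ∃ ζ : Fin 4 → k, ζ = ![1, q 3 / q 2, q 0 / (f A * q 2), q 1 / (f A * q 2)] :=
      ⟨_, rfl⟩
    have hζ2 : biquadSq (f s) (f A) ζ * (f A * q 2) = 1 := by
      simp only [biquadSq] at hq2
      rw [hζ]
      simp only [biquadSq, Matrix.cons_val]
      field_simp
      clear hcoord hinj hroot hB hN hk H' hΔ H hsq hdec
      grind
    refine ⟨biquadMul (f s) (f A) p ζ, ζ, ?_, by simp [hζ]⟩
    have h3 : biquadMul (f s) (f A) (biquadMul (f s) (f A) p ζ) ζ 2 =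
        biquadSq (f s) (f A) ζ * p 2 := by
      simp only [biquadSq, biquadMul, Matrix.cons_val]
      clear hcoord hinj hroot hB hN hk H' hΔ H hsq hdec hζ2 hζ hq2 hr h1 h2
      generalize p 0 = p₀, p 1 = p₁, p 2 = p₂, p 3 = p₃, ζ 0 = q₀, ζ 1 = q₁, ζ 2 = q₂, ζ 3 = q₃
      grind
    rw [biquadForm, h3, biquadSq_mul, ← hΔ]
    apply mul_right_cancel₀ (mul_ne_zero hfA hw)
    generalize biquadSq (f s) (f A) ζ = n at *
    generalize biquadSq (f s) (f A) p = m at *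
    clear hcoord hinj hroot hB hN hk H' hΔ H hsq hdec hζ hq2 hr h2 h3
    grind

end Generic

section Descent

/-- Specialising the variable in a representation of `c + Q(h)X²`, followed by a reflection making
the result orthogonal to `h`. -/
theorem exists_orthogonal_representation {k : Type} [Field k] [CharP k 2] {n : ℕ}
    {M : Matrix (Fin n) (Fin n) k} (hM : M.toQuadraticMap'.Anisotropic) (f₀ : k) (h : Fin n → k)
    (J : Set (Fin n)) (hh : ∀ j ∈ J, h j = 0) (c : Fin n → k) (g : Fin n → RatFunc k)
    (hg : (M.map (algebraMap k (RatFunc k))).toQuadraticMap' g = algebraMap k (RatFunc k) f₀ +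
      algebraMap k (RatFunc k) (M.toQuadraticMap' h) * RatFunc.X ^ 2)
    (hJ : ∀ j ∈ J, g j = algebraMap k (RatFunc k) (c j)) :
    ∃ v : Fin n → k, M.toQuadraticMap' v = f₀ ∧ polar M.toQuadraticMap' v h = 0 ∧
      ∀ j ∈ J, v j = c j := by
  obtain ⟨v, w, h0, h1, h2, hvw⟩ := cassels_pfister hM f₀ 0 (M.toQuadraticMap' h) J c g
    (by rw [hg, map_zero, zero_mul, add_zero]) hJ
  obtain ⟨Q, hQ⟩ : ∃ Q, Q = M.toQuadraticMap' := ⟨_, rfl⟩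
  rw [← hQ] at h0 h1 h2 hM ⊢
  by_cases hr : w + h = 0
  · have : w = h := by
      rw [eq_neg_of_add_eq_zero_left hr]
      ext i
      exact CharTwo.neg_eq _
    exact ⟨v, h0, this ▸ h1, fun j hj => (hvw j hj).1⟩
  · have hQr : Q (w + h) ≠ 0 := fun h => hr (hM _ h)
    have e1 : Q (w + h) = polar Q w h := by
      rw [QuadraticMap.map_add Q, h2, CharTwo.add_self_eq_zero, zero_add]
    have e2 : polar Q v (w + h) = polar Q v h := by rw [polar_add_right, h1, zero_add]
    have e3 : polar Q (w + h) h = polar Q w h := by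
      rw [polar_add_left, polar_self, ofNat_smul_eq_nsmul, two_nsmul, CharTwo.add_self_eq_zero, add_zero]
    refine ⟨v + (polar Q v (w + h) / Q (w + h)) • (w + h), ?_, ?_, fun j hj => ?_⟩
    · rw [QuadraticMap.map_add Q, QuadraticMap.map_smul, polar_smul_right, h0]
      simp only [smul_eq_mul]
      field_simp
      grind
    · rw [polar_add_left, polar_smul_left, e3, e2, ← e1, smul_eq_mul, div_mul_cancel₀ _ hQr,
        CharTwo.add_self_eq_zero]
    · simp [(hvw j hj).1, (hvw j hj).2, hh j hj]

variable {k : Type} [Field k]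

/-- The matrix of `biquadForm`. -/
def biquadMatrix (s A B : k) : Matrix (Fin 8) (Fin 8) k :=
  Matrix.of ![![1, 0, 0, 0, 0, 0, 1, 0], ![0, s, 0, 0, 0, 0, 0, s], ![0, 0, A, 0, 1, 0, 0, 0],
    ![0, 0, 0, s * A, 0, s, 0, 0], ![0, 0, 0, 0, B, 0, 0, 0], ![0, 0, 0, 0, 0, B * s, 0, 0],
    ![0, 0, 0, 0, 0, 0, B * A, 0], ![0, 0, 0, 0, 0, 0, 0, B * (s * A)]]

theorem biquadMatrix_apply (s A B : k) (v : Fin 8 → k) :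
    (biquadMatrix s A B).toQuadraticMap' v =
      biquadForm s A B ![v 0, v 1, v 2, v 3] ![v 4, v 5, v 6, v 7] := by
  rw [toQuadraticMap'_apply]
  simp only [Fin.sum_univ_eight, biquadMatrix, Matrix.of_apply, Matrix.cons_val, biquadForm,
    biquadSq, biquadMul]
  ring

theorem biquadMatrix_map {k' : Type} [Field k'] (f : k →+* k') (s A B : k) :
    (biquadMatrix s A B).map f = biquadMatrix (f s) (f A) (f B) := by
  ext i j
  fin_cases i <;> fin_cases j <;> simp [biquadMatrix]

theorem biquadMatrix_anisotropic_iff {s A B : k} :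
    (biquadMatrix s A B).toQuadraticMap'.Anisotropic ↔
      ∀ p q : Fin 4 → k, biquadForm s A B p q = 0 → p = 0 ∧ q = 0 := by
  constructor
  · intro h p q h0
    have h1 := h ![p 0, p 1, p 2, p 3, q 0, q 1, q 2, q 3] (by
      rw [biquadMatrix_apply, ← h0]
      simp only [biquadForm, biquadSq, biquadMul, Matrix.cons_val])
    constructor <;> ext i <;> fin_cases i
    exacts [congrFun h1 0, congrFun h1 1, congrFun h1 2, congrFun h1 3, congrFun h1 4,
      congrFun h1 5, congrFun h1 6, congrFun h1 7]
  · intro h v hv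
    rw [biquadMatrix_apply] at hv
    obtain ⟨h1, h2⟩ := h _ _ hv
    ext i
    fin_cases i
    exacts [congrFun h1 0, congrFun h1 1, congrFun h1 2, congrFun h1 3, congrFun h2 0,
      congrFun h2 1, congrFun h2 2, congrFun h2 3]

theorem not_biquadForm_representation [CharP k 2] {s t A B : k} (hst : AnisotropicBilin s t)
    (hAB : AvoidsBilin A B s t) {w₀ w₁ α₀ β₀ d w₀' w₁' α β d' : k}
    (h0 : A * α₀ ^ 2 + α₀ + s * (A * β₀ ^ 2 + β₀ * d + B * d ^ 2) = w₀ ^ 2 + s * w₁ ^ 2)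
    (h1 : A * α ^ 2 + s * (A * β ^ 2 + β * d' + B * d' ^ 2) = t + w₀' ^ 2 + s * w₁' ^ 2)
    (h2 : α = s * (β * d + β₀ * d')) : False := by
  have hs : s ≠ 0 := by
    rintro rfl
    exact one_ne_zero (hst 0 1 0 0 (by ring)).2.1
  obtain ⟨h3, h4⟩ := hAB (β + (α₀ * d' + α * d)) d' (w₁' + d * w₀' + d' * w₀)
    ((w₀' + s * d * w₁' + s * d' * w₁) / s) d (1 / s) (by
      field_simp
      clear hst hAB
      grind)
  subst h4
  have h5 : β * (1 + s * d ^ 2) = 0 := by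
    clear hst hAB
    grind
  have h6 : 1 + s * d ^ 2 ≠ 0 := fun h => one_ne_zero (hst 1 d 0 0 (by linear_combination h)).1
  have h7 : β = 0 := (mul_eq_zero.mp h5).resolve_right h6
  rw [h7] at h1 h2
  refine one_ne_zero (hst w₀' w₁' 1 0 ?_).2.2.1
  clear hst hAB
  grind

end Descent

section Generic

variable {F : Type} [Field F] [CharP F 2]

theorem polar_biquadMatrix_single {k : Type} [Field k] [CharP k 2] (s A B : k) (v : Fin 8 → k) :
    polar (biquadMatrix s A B).toQuadraticMap' v (Pi.single 0 1) = v 6 ∧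
    polar (biquadMatrix s A B).toQuadraticMap' v (Pi.single 1 1) = s * v 7 := by
  constructor <;>
  · rw [polar, biquadMatrix_apply, biquadMatrix_apply, biquadMatrix_apply]
    simp only [biquadForm, biquadSq, biquadMul, Matrix.cons_val, Pi.add_apply, Pi.single_apply, Fin.isValue,
      Fin.reduceEq, if_true, if_false]
    grind

theorem not_isotropyImplies_of_biquadForm [Infinite F] {A B s t : F} (hst : AnisotropicBilin s t)
    (hAB : AvoidsBilin A B s t)
    (hk : ∀ p q : Fin 4 → F, biquadForm s A B p q = 0 → p = 0 ∧ q = 0)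
    (H : IsotropyImplies (form5 A 1 B 1 s t) (form5 (s * A) s (s * B) 1 s t)) : False := by
  have hA : A ≠ 0 := by
    rintro rfl
    exact one_ne_zero (hAB 1 0 0 0 0 0 (by ring)).1
  have hs : s ≠ 0 := by
    rintro rfl
    exact one_ne_zero (hst 0 1 0 0 (by ring)).2.1
  rw [← biquadMatrix_anisotropic_iff] at hk
  have hk₁ := hk.map_ratFunc
  obtain ⟨f₁, hf₁⟩ : ∃ f, f = algebraMap F (RatFunc F) := ⟨_, rfl⟩
  have : CharP (RatFunc F) 2 := charP_of_injective_ringHom f₁.injective 2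
  have hk₂ := hk₁.map_ratFunc
  obtain ⟨f₂, hf₂⟩ : ∃ f, f = algebraMap (RatFunc F) (RatFunc (RatFunc F)) := ⟨_, rfl⟩
  have : CharP (RatFunc (RatFunc F)) 2 := charP_of_injective_ringHom f₂.injective 2
  have hk₃ := hk₂.map_ratFunc
  obtain ⟨f₃, hf₃⟩ : ∃ f, f = algebraMap (RatFunc (RatFunc F)) (RatFunc (RatFunc (RatFunc F))) :=
    ⟨_, rfl⟩
  rw [← hf₁] at hk₁ hk₂ hk₃
  rw [← hf₂] at hk₂ hk₃
  rw [← hf₃] at hk₃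
  simp only [biquadMatrix_map] at hk₁ hk₂ hk₃
  have hk₃' := hk₃
  rw [biquadMatrix_anisotropic_iff] at hk₃'
  obtain ⟨p, q, hpq, hq⟩ := exists_biquadForm_eq hA H hs (f₃.comp (f₂.comp f₁)) hk₃' RatFunc.X
    (f₃ RatFunc.X) (f₃ (f₂ RatFunc.X))
  simp only [RingHom.comp_apply] at hpq
  obtain ⟨x, hx, hx0, hxJ⟩ := exists_orthogonal_representation hk₂
    (f₂ (f₁ B) + f₂ (f₁ s) * RatFunc.X ^ 2 + f₂ (f₁ t) * f₂ RatFunc.X ^ 2) (Pi.single 0 1) {4}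
    (by simp) (fun _ => 1) ![p 0, p 1, p 2, p 3, q 0, q 1, q 2, q 3] (by
      rw [← hf₃, biquadMatrix_map, biquadMatrix_apply, biquadMatrix_apply]
      trans biquadForm (f₃ (f₂ (f₁ s))) (f₃ (f₂ (f₁ A))) (f₃ (f₂ (f₁ B))) p q
      · simp only [biquadForm, biquadSq, biquadMul, Matrix.cons_val]
      · rw [hpq]
        simp only [biquadForm, biquadSq, biquadMul, Matrix.cons_val, Pi.single_apply, Fin.isValue,
          Fin.reduceEq, if_true, if_false, map_add, map_mul, map_pow]
        simp
        ring) (by simp [hq])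
  rw [(polar_biquadMatrix_single _ _ _ _).1] at hx0
  obtain ⟨y, hy, hy0, hyJ⟩ := exists_orthogonal_representation hk₁
    (f₁ B + f₁ t * RatFunc.X ^ 2) (Pi.single 1 1) {4, 6}
    (by simp) ![0, 0, 0, 0, 1, 0, 0, 0] x (by
      rw [← hf₂, biquadMatrix_map, hx, biquadMatrix_apply]
      simp only [biquadForm, biquadSq, biquadMul, Matrix.cons_val, Pi.single_apply, Fin.isValue,
          Fin.reduceEq, if_true, if_false, map_add, map_mul, map_pow]
      simp
      ring) (by simpa [hx0] using hxJ)
  rw [(polar_biquadMatrix_single _ _ _ _).2] at hy0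
  have hy7 : y 7 = 0 := by simpa [hs] using hy0
  have hy4 : y 4 = 1 := by simpa using hyJ 4 (by simp)
  have hy6 : y 6 = 0 := by simpa using hyJ 6 (by simp)
  obtain ⟨v, w, h0, h1, h2, hvw⟩ := cassels_pfister hk B 0 t {4, 6, 7} ![0, 0, 0, 0, 1, 0, 0, 0] y
    (by rw [← hf₁, biquadMatrix_map, hy]; simp) (by simp [hy4, hy6, hy7])
  have hv4 : v 4 = 1 ∧ w 4 = 0 := by simpa using hvw 4 (by simp)
  have hv6 : v 6 = 0 ∧ w 6 = 0 := by simpa using hvw 6 (by simp)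
  have hv7 : v 7 = 0 ∧ w 7 = 0 := by simpa using hvw 7 (by simp)
  rw [polar, biquadMatrix_apply, biquadMatrix_apply, biquadMatrix_apply] at h1
  rw [biquadMatrix_apply] at h0 h2
  simp only [biquadForm, biquadSq, biquadMul, Matrix.cons_val, Pi.add_apply, hv4, hv6, hv7] at h0 h1 h2
  clear hvw hyJ hxJ hk hk₁ hk₂ hk₃ hk₃' H hy hx hx0 hy0 hpq hq hf₁ hf₂ hf₃
  refine not_biquadForm_representation hst hAB (w₀ := v 0) (w₁ := v 1) (α₀ := v 2) (β₀ := v 3)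
    (d := v 5) (w₀' := w 0) (w₁' := w 1) (α := w 2) (β := w 3) (d' := w 5) ?_ ?_ ?_
  all_goals
    clear hst hAB
    grind

end Generic

section Similarity

variable {F : Type} [Field F] [CharP F 2]

theorem similarQF_form5_normalize {a b c₁ c₂ c₃ : F}
    (hQ : (form5 a 1 b c₁ c₂ c₃).Anisotropic) :
    SimilarQF (form5 a 1 b c₁ c₂ c₃) (form5 (a / c₁) 1 (b * c₁) 1 (c₂ / c₁) (c₃ / c₁)) := by
  have hc : c₁ ≠ 0 := by
    rintro rfl
    exact one_ne_zero (form5_anisotropic hQ (x := 0) (y := 0) (z₁ := 1) (z₂ := 0) (z₃ := 0)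
      (by ring)).2.2.1
  refine SimilarQF.of_linear hQ (LinearMap.pi ![LinearMap.proj 0, c₁⁻¹ • LinearMap.proj 1,
    LinearMap.proj 2, LinearMap.proj 3, LinearMap.proj 4]) hc fun v => ?_
  rw [form5_apply, form5_apply]
  simp
  field_simp

theorem similarQF_form5_of_represents {A B s t x₀ y₀ x₁ y₁ z₀ z₁ : F}
    (hQ : (form5 (s * A) s (s * B) 1 s t).Anisotropic)
    (h : A * x₀ ^ 2 + x₀ * y₀ + B * y₀ ^ 2 + s * (A * x₁ ^ 2 + x₁ * y₁ + B * y₁ ^ 2) =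
      z₀ ^ 2 + s * z₁ ^ 2) (hD : x₀ * y₁ + x₁ * y₀ ≠ 0) :
    SimilarQF (form5 (s * A) s (s * B) 1 s t) (form5 A 1 B 1 s t) := by
  obtain ⟨D, hD'⟩ : ∃ D, D = x₀ * y₁ + x₁ * y₀ := ⟨_, rfl⟩
  rw [← hD'] at hD
  obtain ⟨m, hm⟩ : ∃ m : (Fin 5 → F) →ₗ[F] F, m = (y₀ / D) • LinearMap.proj 0 +
    (x₀ / D) • LinearMap.proj 1 := ⟨_, rfl⟩
  obtain ⟨n, hn⟩ : ∃ n : (Fin 5 → F) →ₗ[F] F, n = (y₁ / D) • LinearMap.proj 0 +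
    (x₁ / D) • LinearMap.proj 1 := ⟨_, rfl⟩
  refine SimilarQF.of_linear hQ (LinearMap.pi ![x₀ • m + (s * x₁) • n, y₀ • m + (s * y₁) • n,
    LinearMap.proj 2 + z₀ • m + (s * z₁) • n, LinearMap.proj 3 + z₁ • m + z₀ • n,
    LinearMap.proj 4]) one_ne_zero fun v => ?_
  have h0 : v 0 = x₁ * m v + x₀ * n v := by
    simp only [hm, hn, LinearMap.add_apply, LinearMap.smul_apply, LinearMap.proj_apply, smul_eq_mul]
    field_simp
    clear hm hn h
    grind
  have h1 : v 1 = y₁ * m v + y₀ * n v := by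
    simp only [hm, hn, LinearMap.add_apply, LinearMap.smul_apply, LinearMap.proj_apply, smul_eq_mul]
    field_simp
    clear hm hn h
    grind
  rw [form5_apply, form5_apply, h0, h1]
  simp only [LinearMap.pi_apply, Matrix.cons_val, LinearMap.add_apply, LinearMap.smul_apply,
    LinearMap.proj_apply, smul_eq_mul]
  clear hm hn h0 h1 hD' hD
  generalize m v = p, n v = q, v 2 = v₂, v 3 = v₃, v 4 = v₄
  grind

theorem AvoidsBilin.eq_zero_of_dependent {A B s t x₀ y₀ x₁ y₁ z₀ z₁ : F}
    (hst : AnisotropicBilin s t) (hAB : AvoidsBilin A B s t)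
    (h : A * x₀ ^ 2 + x₀ * y₀ + B * y₀ ^ 2 + s * (A * x₁ ^ 2 + x₁ * y₁ + B * y₁ ^ 2) =
      z₀ ^ 2 + s * z₁ ^ 2) (hD : x₀ * y₁ + x₁ * y₀ = 0) :
    x₀ = 0 ∧ y₀ = 0 ∧ x₁ = 0 ∧ y₁ = 0 := by
  have hs : ∀ z₀ z₁ : F, z₀ ^ 2 + s * z₁ ^ 2 = 0 → z₀ = 0 ∧ z₁ = 0 := fun z₀ z₁ h =>
    ⟨(hst z₀ z₁ 0 0 (by linear_combination h)).1, (hst z₀ z₁ 0 0 (by linear_combination h)).2.1⟩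
  have hs0 : s ≠ 0 := by
    rintro rfl
    exact one_ne_zero (hs 0 1 (by ring)).2
  by_cases h0 : x₀ = 0 ∧ y₀ = 0
  · obtain ⟨rfl, rfl⟩ := h0
    obtain ⟨rfl, rfl⟩ := hAB x₁ y₁ z₁ (z₀ / s) 0 0 (by
      field_simp
      linear_combination h)
    simp
  · obtain ⟨n, hn⟩ : ∃ n, n = x₀ ^ 2 + s * x₁ ^ 2 := ⟨_, rfl⟩
    obtain ⟨n', hn'⟩ : ∃ n', n' = y₀ ^ 2 + s * y₁ ^ 2 := ⟨_, rfl⟩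
    exfalso
    by_cases hx : x₀ = 0
    · subst hx
      have hy : y₀ ≠ 0 := fun h => h0 ⟨rfl, h⟩
      have hx₁ : x₁ = 0 := by simpa [hy] using hD
      subst hx₁
      obtain ⟨-, h1⟩ := hAB 0 n' (z₀ * y₀ + s * (z₁ * y₁)) (z₀ * y₁ + z₁ * y₀) 0 0 (by
        clear hst hAB hs
        grind)
      rw [h1] at hn'
      exact hy (hs _ _ hn'.symm).1
    · obtain ⟨h1, -⟩ := hAB (n * x₀) (n * y₀) (x₀ * (z₀ * x₀ + s * (z₁ * x₁)))
        (x₀ * (z₀ * x₁ + z₁ * x₀)) 0 0 (by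
          have e1 : x₀ ^ 2 * (A * x₁ ^ 2 + x₁ * y₁ + B * y₁ ^ 2) =
            x₁ ^ 2 * (A * x₀ ^ 2 + x₀ * y₀ + B * y₀ ^ 2) := by
            clear hst hAB hs h
            grind
          have e2 : n * (A * x₀ ^ 2 + x₀ * y₀ + B * y₀ ^ 2) = x₀ ^ 2 * (z₀ ^ 2 + s * z₁ ^ 2) := by
            rw [← h, hn]
            linear_combination -s * e1
          have e3 : n * (z₀ ^ 2 + s * z₁ ^ 2) = (z₀ * x₀ + s * (z₁ * x₁)) ^ 2 +
            s * (z₀ * x₁ + z₁ * x₀) ^ 2 := by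
            rw [hn]
            clear hst hAB hs h e1 e2 hD
            grind
          linear_combination n * e2 + x₀ ^ 2 * e3)
      have h2 : n = 0 := by simpa [hx] using h1
      rw [h2] at hn
      exact hx (hs _ _ hn.symm).1

theorem similarQF_of_isotropyImplies_normal_form [Infinite F] {A B s t : F}
    (hst : AnisotropicBilin s t) (hAB : AvoidsBilin A B s t)
    (hQ : (form5 (s * A) s (s * B) 1 s t).Anisotropic)
    (H : IsotropyImplies (form5 A 1 B 1 s t) (form5 (s * A) s (s * B) 1 s t)) :
    SimilarQF (form5 (s * A) s (s * B) 1 s t) (form5 A 1 B 1 s t) := by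
  by_contra hcon
  refine not_isotropyImplies_of_biquadForm hst hAB (biquadForm_anisotropic (fun _ _ _ _ _ _ h =>
    hAB.eq_zero_of_dependent hst h ?_) fun z₀ z₁ h =>
    ⟨(hst z₀ z₁ 0 0 (by linear_combination h)).1, (hst z₀ z₁ 0 0 (by linear_combination h)).2.1⟩) H
  by_contra hD
  exact hcon (similarQF_form5_of_represents hQ h hD)

theorem IsotropyImplies.similarQF [Infinite F] {a b u v a' b' u' v' : F}
    (hφ : (form5 a 1 b 1 u v).Anisotropic) (hψ : (form5 a' 1 b' 1 u' v').Anisotropic)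
    (hab : AvoidsBilin a b u v)
    (H : IsotropyImplies (form5 a' 1 b' 1 u' v') (form5 a 1 b 1 u v)) :
    SimilarQF (form5 a 1 b 1 u v) (form5 a' 1 b' 1 u' v') := by
  obtain ⟨A, B, s, t, hst, hAB, h1, h2⟩ := SimilarQF.exists_normal_form hφ hψ hab H.pointTransfer
  exact (h2.trans (similarQF_of_isotropyImplies_normal_form hst hAB (h2.anisotropic hφ)
    (H.of_similar h1 h2))).trans h1.symm

theorem avoidsBilin_of_not_isPfisterNeighbour {a b u v : F}
    (hQ : (form5 a 1 b 1 u v).Anisotropic) (hPN : ¬ IsPfisterNeighbour (form5 a 1 b 1 u v)) :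
    AvoidsBilin a b u v := by
  intro x y z₀ z₁ z₂ z₃ h
  by_contra hxy
  exact hPN (isPfisterNeighbour_form5 hQ (x := x) (y := y) (z₁ := z₀) (z₂ := z₁) (z₃ := z₂) (z₄ := z₃)
    (by linear_combination h) (by tauto))

end Similarity

theorem stmt7 (F : Type) [Field F] [CharP F 2]
    (φ : QuadraticForm F (Fin 5 → F)) (hφa : φ.Anisotropic) (hφt : HasTypeRS φ 1 3)
    (hφpn : ¬ IsPfisterNeighbour φ)
    (ψ : QuadraticForm F (Fin 5 → F)) (hψa : ψ.Anisotropic) (hψt : HasTypeRS ψ 1 3) :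
    (¬ (extendQF F (funFieldMap F ψ) φ).Anisotropic ↔
      ∃ c : Fˣ, φ.Equivalent ((c : F) • ψ)) := by
  obtain ⟨a, b, c₁, c₂, c₃, hφ⟩ := hφt.exists_form5
  obtain ⟨a', b', d₁, d₂, d₃, hψ⟩ := hψt.exists_form5
  have hφ1 := hφ.anisotropic hφa
  have hψ1 := hψ.anisotropic hψa
  have : Infinite F := infinite_of_form5_anisotropic hφ1
  constructor
  · intro h
    obtain ⟨V, hV, hV'⟩ := exists_dvd_bind₁_of_similar hψ
      (exists_dvd_bind₁_of_not_anisotropic (not_anisotropic_extendQF_of_similar hφ h))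
    have hφ2 := similarQF_form5_normalize hφ1
    have hψ2 := similarQF_form5_normalize hψ1
    have H := (isotropyImplies_of_dvd hφ1 hψ1 hV hV').of_similar hψ2 hφ2
    have hφ3 := hφ2.anisotropic hφ1
    have hab := avoidsBilin_of_not_isPfisterNeighbour hφ3 fun h =>
      hφpn (h.of_similar (hφ.trans hφ2))
    exact (hφ.trans hφ2).trans ((H.similarQF hφ3 (hψ2.anisotropic hψ1) hab).trans
      (hψ.trans hψ2).symm)
  · exact fun h => not_anisotropic_of_similar hψa h
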